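/- Every finitely generated involutive commutative two-valued group is isomorphic to one of the following: (1) X^a_{C_{d1}×⋯×C_{dk}} where 2 ≤ d_i ≤ ∞ and d_1 | d_2 | ⋯ | d_k; (2) X^u_n × C_2^m where n ≥ 1, m ≥ 0; (3) Y_n × C_2^m where n ≥ 1, m ≥ 0. Moreover, for each m ≥ 0 there are isomorphisms X^a_{C_2^m×C_4} ≅ X^u_1 × C_2^m ≅ Y_1 × C_2^m and X^a_{C_2^m×C_4×C_4} ≅ X^u_2 × C_2^m, and these exhaust all isomorphisms among the listed two-valued groups. -/

import Mathlib

/-!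
Two-valued groups after V.M. Buchstaber, A.P. Veselov and A.A. Gaifullin.

`X.mul x y` is the two-element multiset `x * y`.
-/

universe u v w u' v' w'

/-- A two-valued group: a set with a multiplication valued in two-element multisets,
a strong identity `e`, and a (unique) inverse. -/
structure TwoValuedGroup (T : Type u) where
  mul : T → T → Multiset T
  e : T
  inv : T → T
  card_mul : ∀ x y, Multiset.card (mul x y) = 2
  assoc : ∀ x y z, (mul x y).bind (fun t => mul t z) = (mul y z).bind (fun t => mul x t)
  e_mul : ∀ x, mul e x = {x, x}
  mul_e : ∀ x, mul x e = {x, x}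
  e_mem_mul_inv : ∀ x, e ∈ mul x (inv x)
  e_mem_inv_mul : ∀ x, e ∈ mul (inv x) x
  inv_unique : ∀ x y, (e ∈ mul x y ∨ e ∈ mul y x) → y = inv x

namespace TwoValuedGroup

/-- Commutativity of a two-valued group. -/
def Commutative {T : Type u} (X : TwoValuedGroup T) : Prop := ∀ x y, X.mul x y = X.mul y x

/-- Involutivity: every element is its own inverse. -/
def Involutive {T : Type u} (X : TwoValuedGroup T) : Prop := ∀ x, X.inv x = x

/-- A homomorphism of two-valued groups. -/
def IsHom {T : Type u} {S : Type v} (X : TwoValuedGroup T) (Z : TwoValuedGroup S)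
    (f : T → S) : Prop :=
  f X.e = Z.e ∧ ∀ x y, (X.mul x y).map f = Z.mul (f x) (f y)

/-- Two two-valued groups are isomorphic if there is a bijective homomorphism. -/
def Isomorphic {T : Type u} {S : Type v} (X : TwoValuedGroup T) (Z : TwoValuedGroup S) : Prop :=
  ∃ f : T → S, Function.Bijective f ∧ IsHom X Z f

/-- A subgroup of a two-valued group: a subset closed under multiplication. -/
def IsSubgroup {T : Type u} (X : TwoValuedGroup T) (Y : Set T) : Prop :=
  ∀ y₁ ∈ Y, ∀ y₂ ∈ Y, ∀ z ∈ X.mul y₁ y₂, z ∈ Y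

/-- `S` generates `X` if the only subgroup of `X` containing `S` is all of `X`. -/
def Generates {T : Type u} (X : TwoValuedGroup T) (S : Set T) : Prop :=
  ∀ Y : Set T, X.IsSubgroup Y → S ⊆ Y → Y = Set.univ

/-- Finitely generated two-valued group. -/
def FinitelyGenerated {T : Type u} (X : TwoValuedGroup T) : Prop :=
  ∃ S : Set T, S.Finite ∧ X.Generates S

/-- A family of integer power sequences: `P x k` is the `k`-th power `x^k` of `x`;
these are uniquely determined in an involutive two-valued group. -/
def IsPowFamily {T : Type u} (X : TwoValuedGroup T) (P : T → ℤ → T) : Prop :=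
  ∀ x : T, P x 0 = X.e ∧ P x 1 = x ∧ (∀ k : ℤ, P x (-k) = P x k) ∧
    ∀ k : ℤ, 1 ≤ k → X.mul x (P x k) = {P x (k - 1), P x (k + 1)}

/-- The order of an element: the least positive `k` with `x^k = e`;
the value `0` encodes infinite order. -/
noncomputable def ordOf {T : Type u} (X : TwoValuedGroup T) (P : T → ℤ → T) (x : T) : ℕ :=
  sInf {n : ℕ | 0 < n ∧ P x (n : ℤ) = X.e}

/-- `ord x > 2` (where infinite order counts as `> 2`). -/
def OrdGT2 {T : Type u} (X : TwoValuedGroup T) (P : T → ℤ → T) (x : T) : Prop :=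
  X.ordOf P x = 0 ∨ 2 < X.ordOf P x

/-- A two-valued group is special if it contains a special pair: `ord x > 2`, `ord y > 2`,
and `x * y` consists of two equal elements. -/
def IsSpecial {T : Type u} (X : TwoValuedGroup T) (P : T → ℤ → T) : Prop :=
  ∃ x y z : T, X.OrdGT2 P x ∧ X.OrdGT2 P y ∧ X.mul x y = {z, z}

/-- `ι` is an involutive automorphism of the group `G`. -/
def IsInvolutiveAut (G : Type v) [Group G] (ι : G → G) : Prop :=
  Function.Bijective ι ∧ (∀ g h : G, ι (g * h) = ι g * ι h) ∧ (∀ g : G, ι (ι g) = g)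

/-- `X` is isomorphic to the coset two-valued group `G/ι`: there is a quotient map
`π : G → X` whose fibres are exactly the `ι`-orbits and which carries the coset
two-valued multiplication `π g * π h = [π (g h), π (g ι(h))]`. -/
def IsCosetOf {T : Type u} {G : Type v} [Group G] (X : TwoValuedGroup T) (ι : G → G) : Prop :=
  ∃ π : G → T, Function.Surjective π ∧ π 1 = X.e ∧
    (∀ g, π (ι g) = π g) ∧
    (∀ g h, π g = π h → h = g ∨ h = ι g) ∧
    (∀ g h, X.mul (π g) (π h) = {π (g * h), π (g * ι h)}) ∧
    (∀ g, X.inv (π g) = π g⁻¹)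

/-- `X` is isomorphic to the coset two-valued group `X^a_A = A/ι_a`
for the antipodal involution `ι_a (a) = a⁻¹` of the abelian group `A`. -/
def IsAntipodalCosetOf {T : Type u} (X : TwoValuedGroup T) (A : Type v) [CommGroup A] : Prop :=
  ∃ π : A → T, Function.Surjective π ∧ π 1 = X.e ∧
    (∀ a, π a⁻¹ = π a) ∧
    (∀ a b, π a = π b → b = a ∨ b = a⁻¹) ∧
    (∀ a b, X.mul (π a) (π b) = {π (a * b), π (a * b⁻¹)}) ∧
    (∀ a, X.inv (π a) = π a⁻¹)

/-- A Boolean group: every element squares to the identity. -/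
def IsBooleanGroup (V : Type v) [CommGroup V] : Prop := ∀ x : V, x * x = 1

/-- For a Boolean group, `dim V ≥ 2` (as an `𝔽₂`-vector space) is equivalent to the
existence of two distinct nontrivial elements. -/
def BoolDimGE2 (V : Type v) [CommGroup V] : Prop := ∃ a b : V, a ≠ 1 ∧ b ≠ 1 ∧ a ≠ b

/-- For a Boolean group, `dim V ≥ 3` is equivalent to the existence of three
linearly independent elements. -/
def BoolDimGE3 (V : Type v) [CommGroup V] : Prop :=
  ∃ a b c : V, a ≠ 1 ∧ b ≠ 1 ∧ a ≠ b ∧ c ≠ 1 ∧ c ≠ a ∧ c ≠ b ∧ c ≠ a * b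

/-- Isomorphism of (single-valued) groups. -/
def GroupIsomorphic (A : Type v) (B : Type w) [CommGroup A] [CommGroup B] : Prop :=
  Nonempty (A ≃* B)

/-- `X` is isomorphic to the coset two-valued group `X^u_V = (V × V)/ι_u`,
where `ι_u (a, b) = (a, a b)` is the unipotent involution of the Boolean group `V × V`. -/
def IsUnipotentCosetOf {T : Type u} (X : TwoValuedGroup T) (V : Type v) [CommGroup V] : Prop :=
  ∃ π : V × V → T, Function.Surjective π ∧ π (1, 1) = X.e ∧
    (∀ a b : V, π (a, a * b) = π (a, b)) ∧
    (∀ p q : V × V, π p = π q → q = p ∨ q = (p.1, p.1 * p.2)) ∧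
    (∀ a₁ b₁ a₂ b₂ : V,
      X.mul (π (a₁, b₁)) (π (a₂, b₂)) = {π (a₁ * a₂, b₁ * b₂), π (a₁ * a₂, a₂ * b₁ * b₂)}) ∧
    (∀ p : V × V, X.inv (π p) = π p)

/-- `X` is isomorphic to the direct product `X^u_V × W` of the unipotent coset
two-valued group `X^u_V = (V × V)/ι_u` and the Boolean group `W`. -/
def IsUnipotentCosetProdOf {T : Type u} (X : TwoValuedGroup T) (V : Type v) (W : Type w)
    [CommGroup V] [CommGroup W] : Prop :=
  ∃ f : (V × V) × W → T, Function.Surjective f ∧ f ((1, 1), 1) = X.e ∧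
    (∀ (a b : V) (w : W), f ((a, a * b), w) = f ((a, b), w)) ∧
    (∀ p q : (V × V) × W, f p = f q → q.2 = p.2 ∧ (q.1 = p.1 ∨ q.1 = (p.1.1, p.1.1 * p.1.2))) ∧
    (∀ (a₁ b₁ a₂ b₂ : V) (w₁ w₂ : W),
      X.mul (f ((a₁, b₁), w₁)) (f ((a₂, b₂), w₂)) =
        {f ((a₁ * a₂, b₁ * b₂), w₁ * w₂), f ((a₁ * a₂, a₂ * b₁ * b₂), w₁ * w₂)}) ∧
    (∀ p, X.inv (f p) = f p)

open Classical in
/-- The multiplication table of the special two-valued group `Y_V` on `Option V`: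
`none` is the extra element `s`, `some v` are the elements of the Boolean group `V`. -/
noncomputable def mulY {V : Type v} [CommGroup V] : Option V → Option V → Multiset (Option V)
  | some x, some y =>
      if x = y then (if x = 1 then {some 1, some 1} else {some 1, none})
      else {some (x * y), some (x * y)}
  | some x, none => if x = 1 then {none, none} else {some x, some x}
  | none, some y => if y = 1 then {none, none} else {some y, some y}
  | none, none => {some 1, some 1}

/-- `X` is isomorphic to the special two-valued group `Y_V`. -/
def IsYOf {T : Type u} (X : TwoValuedGroup T) (V : Type v) [CommGroup V] : Prop :=
  ∃ f : Option V → T, Function.Bijective f ∧ f (some 1) = X.e ∧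
    (∀ uu vv : Option V, X.mul (f uu) (f vv) = (mulY uu vv).map f) ∧
    (∀ uu : Option V, X.inv (f uu) = f uu)

/-- `X` is isomorphic to the direct product `Y_V × W`. -/
def IsYProdOf {T : Type u} (X : TwoValuedGroup T) (V : Type v) (W : Type w)
    [CommGroup V] [CommGroup W] : Prop :=
  ∃ f : Option V × W → T, Function.Bijective f ∧ f (some 1, 1) = X.e ∧
    (∀ (uu vv : Option V) (w₁ w₂ : W),
      X.mul (f (uu, w₁)) (f (vv, w₂)) = (mulY uu vv).map (fun z => f (z, w₁ * w₂))) ∧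
    (∀ p : Option V × W, X.inv (f p) = f p)

/-- `X` is isomorphic to the direct product `X' × W` of the two-valued group `X'`
and the (single-valued) Boolean group `W`. -/
def IsDirectProdOf {T : Type u} {T' : Type v} (W : Type w) [CommGroup W]
    (X : TwoValuedGroup T) (X' : TwoValuedGroup T') : Prop :=
  ∃ f : T' × W → T, Function.Bijective f ∧ f (X'.e, 1) = X.e ∧
    (∀ (x₁ x₂ : T') (w₁ w₂ : W),
      X.mul (f (x₁, w₁)) (f (x₂, w₂)) = (X'.mul x₁ x₂).map (fun z => f (z, w₁ * w₂))) ∧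
    (∀ (x : T') (w : W), X.inv (f (x, w)) = f (X'.inv x, w))

/-- `X` contains a single-valued direct factor: `X ≅ X' × W` with `W` a nontrivial
Boolean group. -/
def HasSingleValuedDirectFactor {T : Type u} (X : TwoValuedGroup T) : Prop :=
  ∃ (T' : Type u) (X' : TwoValuedGroup T') (W : Type u) (iW : CommGroup W),
    X'.Commutative ∧ X'.Involutive ∧ @IsBooleanGroup W iW ∧ Nontrivial W ∧
    @IsDirectProdOf T T' W iW X X'

/-- The Boolean group `C₂ⁿ`. -/
abbrev C2vec (n : ℕ) : Type := Fin n → Multiplicative (ZMod 2)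

/-- The group `C₄ⁿ`. -/
abbrev C4vec (n : ℕ) : Type := Fin n → Multiplicative (ZMod 4)

end TwoValuedGroup

namespace TwoValuedGroup

/-- A label for the two-valued groups listed in the classification theorem:
`princ k d` stands for `X^a_{C_{d 0} × ⋯ × C_{d (k-1)}}` (with `d i = 0` encoding the
infinite cyclic factor `C_∞`), `unip n m` stands for `X^u_n × C₂^m`, and `spec n m`
stands for `Y_n × C₂^m`. -/
inductive ListedLabel : Type where
  | princ : (k : ℕ) → (d : Fin k → ℕ) → ListedLabel
  | unip : (n m : ℕ) → ListedLabel
  | spec : (n m : ℕ) → ListedLabel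

/-- The side conditions of the classification theorem: for the principal series,
`2 ≤ dᵢ ≤ ∞` (`dᵢ ≠ 1`, with `0` encoding `∞`) and `d₁ ∣ d₂ ∣ ⋯ ∣ d_k`
(in `ℕ`, where everything divides `0 = ∞`); for the other two series, `n ≥ 1`. -/
def ValidLabel : ListedLabel → Prop
  | .princ k d => (∀ i, d i ≠ 1) ∧ (∀ i j : Fin k, i ≤ j → d i ∣ d j)
  | .unip n _ => 1 ≤ n
  | .spec n _ => 1 ≤ n

/-- `Y` realizes (is isomorphic to) the two-valued group named by the label. -/
def Realizes {S : Type v} (Y : TwoValuedGroup S) : ListedLabel → Prop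
  | .princ k d => IsAntipodalCosetOf Y (∀ i : Fin k, Multiplicative (ZMod (d i)))
  | .unip n m => IsUnipotentCosetProdOf Y (C2vec n) (C2vec m)
  | .spec n m => IsYProdOf Y (C2vec n) (C2vec m)

/-- The invariant factor sequence `(2, …, 2, 4)` of length `m + 1`. -/
def dSeqA (m : ℕ) : Fin (m + 1) → ℕ := fun i => if i.1 < m then 2 else 4

/-- The invariant factor sequence `(2, …, 2, 4, 4)` of length `m + 2`. -/
def dSeqB (m : ℕ) : Fin (m + 2) → ℕ := fun i => if i.1 < m then 2 else 4

/-- The exceptional coincidences of the classification theorem: for each `m ≥ 0`,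
`X^a_{m×2,4} ≅ X^u_1 × C₂^m ≅ Y_1 × C₂^m` and `X^a_{m×2,4,4} ≅ X^u_2 × C₂^m`;
apart from these, distinct labels give non-isomorphic two-valued groups. -/
def SameClass : ListedLabel → ListedLabel → Prop := fun l₁ l₂ =>
  l₁ = l₂ ∨
  (∃ m : ℕ,
    (l₁ = .princ (m + 1) (dSeqA m) ∨ l₁ = .unip 1 m ∨ l₁ = .spec 1 m) ∧
    (l₂ = .princ (m + 1) (dSeqA m) ∨ l₂ = .unip 1 m ∨ l₂ = .spec 1 m)) ∨
  (∃ m : ℕ,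
    (l₁ = .princ (m + 2) (dSeqB m) ∨ l₁ = .unip 2 m) ∧
    (l₂ = .princ (m + 2) (dSeqB m) ∨ l₂ = .unip 2 m))

end TwoValuedGroup

namespace TwoValuedGroup

/-- A commutative ring spanned by the elements of a two-valued group, in which the product
`x * y = [z, w]` becomes `2 x y = z + w`. -/
structure Model (T : Type u) (R : Type v) [CommRing R] where
  ε : T → R
  e : T
  one : ε e = 1
  c : T → R →+ ℚ
  c_self : ∀ x, c x (ε x) = 1
  c_ne : ∀ x y, x ≠ y → c y (ε x) = 0
  cancel2 : ∀ a b : R, 2 * a = 2 * b → a = b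
  mul : ∀ x y, ∃ z w, 2 * ε x * ε y = ε z + ε w
  sq : ∀ x, ∃ y, 2 * ε x * ε x = 1 + ε y
  eq_of : ∀ x y z, 2 * ε x * ε y = 1 + ε z → x = y

namespace Model

variable {T : Type u} {R : Type v} [CommRing R] (M : Model T R)

instance : CoeFun (Model T R) (fun _ => T → R) := ⟨Model.ε⟩

theorem inj {x y : T} (h : M x = M y) : x = y := by
  by_contra hne
  have h1 := M.c_self y
  rw [← h, M.c_ne x y hne] at h1
  norm_num at h1

open Classical in
theorem c_eps (x t : T) : M.c t (M x) = if x = t then 1 else 0 := by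
  split_ifs with h
  · rw [h, M.c_self]
  · exact M.c_ne _ _ h

theorem pair {a b c d : T} (h : M a + M b = M c + M d) :
    (a = c ∧ b = d) ∨ (a = d ∧ b = c) := by
  have h1 := congrArg (M.c a) h
  have h2 := congrArg (M.c b) h
  simp only [map_add, c_eps] at h1 h2
  grind

theorem mem4 {a b c d f g h k : T} (H : M a + M b + M c + M d = M f + M g + M h + M k) :
    a = f ∨ a = g ∨ a = h ∨ a = k := by
  have h1 := congrArg (M.c a) H
  simp only [map_add, c_eps] at h1
  grind

theorem mul_one_of {x y z : T} (h : 2 * M x * M y = M M.e + M z) : x = y :=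
  M.eq_of x y z (by rw [h, M.one])

def Mem (z x y : T) : Prop := ∃ w, 2 * M x * M y = M z + M w

theorem Mem.comm {M : Model T R} {z x y : T} (h : M.Mem z x y) : M.Mem z y x := by
  obtain ⟨w, h⟩ := h
  exact ⟨w, by rw [← h]; ring⟩

theorem Mem.recip {M : Model T R} {z x y : T} (h : M.Mem z x y) : M.Mem x y z := by
  obtain ⟨w, h⟩ := h
  obtain ⟨u, v, h1⟩ := M.mul y z
  obtain ⟨s, h2⟩ := M.sq z
  obtain ⟨p, p', h3⟩ := M.mul w z
  obtain ⟨m, m', h4⟩ := M.mul x u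
  obtain ⟨n, n', h5⟩ := M.mul x v
  have h6 : M M.e + M s + M p + M p' = M m + M m' + M n + M n' := by
    rw [M.one]
    linear_combination -h2 - h3 + h4 + h5 - 2 * M z * h + 2 * M x * h1
  rcases M.mem4 h6 with rfl | rfl | rfl | rfl
  · obtain rfl := M.mul_one_of h4
    exact ⟨_, h1⟩
  · obtain rfl := M.mul_one_of (by rw [h4]; ring)
    exact ⟨_, h1⟩
  · obtain rfl := M.mul_one_of h5
    exact ⟨u, by rw [h1]; ring⟩
  · obtain rfl := M.mul_one_of (by rw [h5]; ring)
    exact ⟨u, by rw [h1]; ring⟩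

theorem Mem.rot {M : Model T R} {z x y : T} (h : M.Mem z x y) : M.Mem y x z := h.comm.recip

/-- The other element of the product. -/
theorem Mem.eq {M : Model T R} {z x y u v : T} (h : M.Mem z x y)
    (h' : 2 * M x * M y = M u + M v) : z = u ∨ z = v := by
  obtain ⟨w, h⟩ := h
  rcases M.pair (h.symm.trans h') with h | h
  · exact Or.inl h.1
  · exact Or.inr h.1

theorem mem_left {x y u v : T} (h : 2 * M x * M y = M u + M v) : M.Mem u x y := ⟨v, h⟩
theorem mem_right {x y u v : T} (h : 2 * M x * M y = M u + M v) : M.Mem v x y :=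
  ⟨u, by rw [h, add_comm]⟩

/-- The nontrivial square. -/
noncomputable def q (x : T) : T := (M.sq x).choose

theorem q_spec (x : T) : 2 * M x * M x = 1 + M (M.q x) := (M.sq x).choose_spec

def B (b : T) : Prop := M.q b = M.e

theorem B_iff {b : T} : M.B b ↔ M b * M b = 1 := by
  have h := M.q_spec b
  constructor
  · intro hb
    rw [hb, M.one] at h
    exact M.cancel2 _ _ (by linear_combination h)
  · intro hb
    apply M.inj
    rw [M.one]
    linear_combination -h + 2 * hb

theorem B_e : M.B M.e := by rw [B_iff, M.one, one_mul]

theorem q_e : M.q M.e = M.e := M.B_e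

open Classical in
/-- The single-valued product, where defined. -/
noncomputable def dot (b x : T) : T :=
  if h : ∃ z, M b * M x = M z then h.choose else x

theorem dot_eq {b x z : T} (h : M b * M x = M z) : M.dot b x = z := by
  have H : ∃ z, M b * M x = M z := ⟨z, h⟩
  rw [dot, dif_pos H]
  exact M.inj (H.choose_spec.symm.trans h)

theorem dot_spec {b : T} (hb : M.B b) (x : T) : M (M.dot b x) = M b * M x := by
  obtain ⟨z, w, h⟩ := M.mul b x
  obtain ⟨p, p', h1⟩ := M.mul b z
  obtain ⟨r, r', h2⟩ := M.mul b w
  have h3 := M.B_iff.1 hb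
  have h4 : M p + M p' + M r + M r' = M x + M x + M x + M x := by
    linear_combination -h1 - h2 - 2 * M b * h + 4 * M x * h3
  have hp : p = x := by have := M.mem4 h4; tauto
  have hp' : p' = x := by
    have := M.mem4 (show M p' + M p + M r + M r' = M x + M x + M x + M x by rw [← h4]; ring)
    tauto
  rw [hp, hp'] at h1
  have h5 : M b * M z = M x := M.cancel2 _ _ (by linear_combination h1)
  have h6 : M b * M x = M z := by rw [← h5]; linear_combination M z * h3
  rw [M.dot_eq h6, h6]

theorem mem_of_dot {x y z : T} (h : M x * M y = M z) : M.Mem z x y :=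
  ⟨z, by linear_combination 2 * h⟩

theorem mem_dot {b : T} (hb : M.B b) (x : T) : M.Mem (M.dot b x) b x :=
  M.mem_of_dot (M.dot_spec hb x).symm

theorem mem_B {b x z : T} (hb : M.B b) (h : M.Mem z b x) : z = M.dot b x := by
  have := h.eq (show 2 * M b * M x = M (M.dot b x) + M (M.dot b x) by rw [M.dot_spec hb]; ring)
  tauto

/-- If the Boolean element `b` occurs in `x * y`, then `y = b x`. -/
theorem B_mem {b x y : T} (hb : M.B b) (h : M.Mem b x y) : y = M.dot b x :=
  M.mem_B hb h.rot.comm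

theorem dot_e (x : T) : M.dot M.e x = x := M.dot_eq (by rw [M.one, one_mul])

theorem dot_e' (x : T) : M.dot x M.e = x := M.dot_eq (by rw [M.one, mul_one])

theorem B_dot {b c : T} (hb : M.B b) (hc : M.B c) : M.B (M.dot b c) := by
  rw [B_iff, M.dot_spec hb]
  rw [B_iff] at hb hc
  linear_combination M c * M c * hb + hc

theorem q_unique {x y : T} (h : 2 * M x * M x = 1 + M y) : M.q x = y :=
  M.inj (by linear_combination h - M.q_spec x)

theorem q_dot {b : T} (hb : M.B b) (x : T) : M.q (M.dot b x) = M.q x := by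
  apply M.q_unique
  rw [M.dot_spec hb, ← M.q_spec]
  linear_combination 2 * M x * M x * M.B_iff.1 hb

theorem B_dot_iff {b x : T} (hb : M.B b) : M.B (M.dot b x) ↔ M.B x := by
  rw [B, B, M.q_dot hb]

theorem dot_eq_self {b x : T} (hb : M.B b) (h : M.dot b x = x) : b = M.e ∨ b = M.q x := by
  have h1 : M b * M x = M x := by rw [← M.dot_spec hb, h]
  have h2 : M b + M (M.dot b (M.q x)) = M M.e + M (M.q x) := by
    rw [M.dot_spec hb, M.one]
    linear_combination 2 * M x * h1 + (1 - M b) * M.q_spec x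
  rcases M.pair h2 with h | h
  · exact Or.inl h.1
  · exact Or.inr h.1

theorem q_dot_self {x : T} (h : M.B (M.q x)) : M.dot (M.q x) x = x := by
  symm
  apply M.eq_of x _ (M.q x)
  rw [M.dot_spec h]
  linear_combination M (M.q x) * M.q_spec x + M.B_iff.1 h

theorem dot_comm (x y : T) (hx : M.B x) (hy : M.B y) : M.dot x y = M.dot y x := by
  apply M.inj; rw [M.dot_spec hx, M.dot_spec hy, mul_comm]

theorem dot_assoc {b c x : T} (hb : M.B b) (hc : M.B c) :
    M.dot (M.dot b c) x = M.dot b (M.dot c x) := by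
  apply M.inj; rw [M.dot_spec (M.B_dot hb hc), M.dot_spec hb, M.dot_spec hb, M.dot_spec hc, mul_assoc]

theorem dot_self {b : T} (hb : M.B b) : M.dot b b = M.e := by
  apply M.inj; rw [M.dot_spec hb, M.one]; exact M.B_iff.1 hb

theorem dot_dot_cancel {b x : T} (hb : M.B b) : M.dot b (M.dot b x) = x := by
  rw [← M.dot_assoc hb hb, M.dot_self hb, M.dot_e]

theorem dot_inj {b x y : T} (hb : M.B b) (h : M.dot b x = M.dot b y) : x = y := by
  rw [← M.dot_dot_cancel (x := x) hb, h, M.dot_dot_cancel hb]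

theorem mem_dot_dot {b z x y : T} (hb : M.B b) (h : M.Mem z x y) :
    M.Mem (M.dot b z) (M.dot b x) y := by
  obtain ⟨w, h⟩ := h
  refine ⟨M.dot b w, ?_⟩
  rw [M.dot_spec hb, M.dot_spec hb, M.dot_spec hb]
  linear_combination M b * h

/-- Two distinct elements of a product determine it. -/
theorem mul_eq_of_mem {x y z w : T} (hz : M.Mem z x y) (hw : M.Mem w x y) (h : z ≠ w) :
    2 * M x * M y = M z + M w := by
  obtain ⟨u, hu⟩ := hz
  rcases hw.eq hu with h' | h'
  · exact absurd h'.symm h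
  · rw [hu, h']

theorem square_identity {x y z w r r' k k' : T} (h : 2 * M x * M y = M z + M w)
    (hr : 2 * M (M.q x) * M (M.q y) = M r + M r') (hk : 2 * M z * M w = M k + M k') :
    2 * M (M.q x) + 2 * M (M.q y) + M r + M r' =
      M (M.q z) + M (M.q w) + 2 * M k + 2 * M k' := by
  linear_combination 2 * (2 * M x * M y + M z + M w) * h - hr + 2 * hk + M.q_spec z + M.q_spec w
    - 2 * (1 + M (M.q y)) * M.q_spec x - 4 * M x * M x * M.q_spec y

theorem ne_e_of_ne {z w k k' : T} (hk : 2 * M z * M w = M k + M k') (h : z ≠ w) : k ≠ M.e ∧ k' ≠ M.e := by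
  constructor
  · rintro rfl
    exact h (M.mul_one_of hk)
  · rintro rfl
    exact h (M.mul_one_of (by rw [hk, add_comm]))

theorem c_two (t : T) (r : R) : M.c t (2 * r) = 2 * M.c t r := by
  rw [two_mul, map_add, two_mul]

end Model
end TwoValuedGroup

namespace TwoValuedGroup
namespace Model

variable {T : Type u} {R : Type v} [CommRing R] (M : Model T R)

theorem comb_parity {a b r r' z w k k' : T} (H : 2 * M a + 2 * M b + M r + M r' =
    M z + M w + 2 * M k + 2 * M k') :
    (M r + M r' = M z + M w) ∨ (r = r' ∧ z = w ∧ r ≠ z) := by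
  have h1 := congrArg (M.c r) H
  have h2 := congrArg (M.c r') H
  have h3 := congrArg (M.c z) H
  simp only [map_add, c_eps, c_two] at h1 h2 h3
  by_cases e1 : r = r'
  · subst e1
    by_cases e2 : z = w
    · subst e2
      by_cases e3 : r = z
      · subst e3; simp
      · simp [e3]
    · exfalso
      grind
  · left
    have i1 : r = z ∨ r = w := by clear h2 h3; grind
    have i2 : r' = z ∨ r' = w := by clear h1 h3; grind
    have : (r = z ∧ r' = w) ∨ (r = w ∧ r' = z) := by
      by_cases e2 : z = w
      · subst e2
        simp only [or_self] at i1 i2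
        exact absurd (i1.trans i2.symm) e1
      · grind only
    rcases this with ⟨h, h'⟩ | ⟨h, h'⟩
    · rw [h, h']
    · rw [h, h', add_comm]

theorem comb_cases {a b r r' z w k k' : T} (H : 2 * M a + 2 * M b + M r + M r' =
    M z + M w + 2 * M k + 2 * M k') :
    (M r + M r' = M z + M w ∧ M k + M k' = M a + M b) ∨
    (r = r' ∧ z = w ∧ r ≠ z ∧ ((z = a ∧ M k + M k' = M b + M r) ∨
      (z = b ∧ M k + M k' = M a + M r))) := by
  rcases M.comb_parity H with h | ⟨rfl, rfl, h⟩
  · exact Or.inl ⟨h, M.cancel2 _ _ (by linear_combination -H + h)⟩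
  · right
    have h3 := congrArg (M.c z) H
    simp only [map_add, c_eps, c_two] at h3
    have : z = a ∨ z = b := by grind
    refine ⟨rfl, rfl, h, ?_⟩
    rcases this with rfl | rfl
    · exact Or.inl ⟨rfl, M.cancel2 _ _ (by linear_combination -H)⟩
    · exact Or.inr ⟨rfl, M.cancel2 _ _ (by linear_combination -H)⟩

/-- Nonspecial: a product of two non-Boolean elements is never a doubled element. -/
def NS : Prop := ∀ x y z, M x * M y = M z → M.B x ∨ M.B y

variable {M}

theorem NS.ne (hM : M.NS) {x y z w : T} (h : 2 * M x * M y = M z + M w)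
    (hx : ¬ M.B x) (hy : ¬ M.B y) : z ≠ w := by
  rintro rfl
  rcases hM x y z (M.cancel2 _ _ (by linear_combination h)) with h | h
  · exact hx h
  · exact hy h

theorem squares_of_B {x y z w : T} (h : 2 * M x * M y = M z + M w)
    (hx : M.B x) : 2 * M (M.q x) * M (M.q y) = M (M.q z) + M (M.q w) ∧
      2 * M z * M w = M (M.q x) + M (M.q y) := by
  have hz := M.mem_B hx (M.mem_left h)
  have hw := M.mem_B hx (M.mem_right h)
  have hx' : M.q x = M.e := hx
  rw [hz, hw, M.q_dot hx, hx', M.one, M.dot_spec hx]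
  refine ⟨by ring, ?_⟩
  linear_combination 2 * M y * M y * M.B_iff.1 hx + M.q_spec y

/-- No coincidence `(q z = q w = q x, r = r')` occurs in the square identity. -/
theorem NS.squares_aux (hM : M.NS) {x y z w r : T}
    (h : 2 * M x * M y = M z + M w) (hx : ¬ M.B x) (hy : ¬ M.B y)
    (hr : 2 * M (M.q x) * M (M.q y) = M r + M r) (hzw : M.q z = M.q w) (hrz : r ≠ M.q z)
    (hzx : M.q z = M.q x) (hk : 2 * M z * M w = M (M.q y) + M r) : False := by
  have hne : z ≠ w := hM.ne h hx hy
  have hr' : M (M.q x) * M (M.q y) = M r := M.cancel2 _ _ (by linear_combination hr)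
  have hz : ¬ M.B z := by rw [B, hzx]; exact hx
  have hw : ¬ M.B w := by rw [B, ← hzw, hzx]; exact hx
  by_cases hb : M.B (M.q y)
  · obtain ⟨y', hy'⟩ := (M.mem_left h).rot
    have hyy : y ≠ y' := hM.ne hy' hx hz
    obtain ⟨l, l', hl⟩ := M.mul y y'
    obtain ⟨hl1, hl2⟩ := M.ne_e_of_ne hl hyy
    have hid := M.square_identity hy' (r := M.e) (r' := M.q (M.q x))
      (by rw [hzx, M.one, M.q_spec]) hl
    have h1 := congrArg (M.c M.e) hid
    rw [hzx] at h1
    simp only [map_add, c_eps, c_two] at h1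
    have hy2 : M.q y ≠ M.e := hy
    have hx2 : M.q x ≠ M.e := hx
    have hy3 : M.B y' := by
      show M.q y' = M.e
      simp only [hx2, hl1, hl2, hy2, if_false, if_true] at h1
      by_contra hc
      simp only [hc, if_false] at h1
      split_ifs at h1 <;> norm_num at h1
    have e1 : z = M.dot y' x := M.B_mem hy3 (M.mem_right hy')
    have e2 : 2 * M x * M z = M (M.dot y' M.e) + M (M.dot y' (M.q x)) := by
      rw [e1, M.dot_spec hy3, M.dot_spec hy3, M.dot_spec hy3, M.one]
      linear_combination M y' * M.q_spec x
    rw [M.dot_e'] at e2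
    have e3 : y = M.dot y' (M.q x) := by
      rcases M.pair (e2.symm.trans hy') with e | e
      · exact absurd e.1.symm hyy
      · exact e.2.symm
    have e4 : M.q y = M.q (M.q x) := by rw [e3, M.q_dot hy3]
    apply hrz
    rw [hzx]
    apply M.inj
    rw [← hr', mul_comm, ← M.dot_spec hb, e4, M.q_dot_self (by rw [← e4]; exact hb)]
  · have ha : M.B (M.q x) := by rcases hM _ _ _ hr' with h | h; exacts [h, absurd h hb]
    have hbr : M.q y ≠ r := hM.ne hk hz hw
    obtain ⟨l, l', hl⟩ := M.mul (M.q y) r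
    obtain ⟨hl1, hl2⟩ := M.ne_e_of_ne hl hbr
    have hid := M.square_identity hk (r := M.e) (r' := M.q (M.q x))
      (by rw [← hzw, hzx, M.one, M.q_spec]) hl
    rw [← hzw, hzx, show M.q (M.q x) = M.e from ha] at hid
    have h1 := congrArg (M.c M.e) hid
    simp only [map_add, c_eps, c_two] at h1
    have hx2 : M.q x ≠ M.e := hx
    simp only [hx2, hl1, hl2, if_false, if_true] at h1
    apply hb
    show M.q (M.q y) = M.e
    by_contra hc
    simp only [hc, if_false] at h1
    split_ifs at h1 <;> norm_num at h1

theorem NS.squares (hM : M.NS) {x y z w : T} (h : 2 * M x * M y = M z + M w) :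
    2 * M (M.q x) * M (M.q y) = M (M.q z) + M (M.q w) ∧
      2 * M z * M w = M (M.q x) + M (M.q y) := by
  by_cases hx : M.B x
  · exact squares_of_B h hx
  by_cases hy : M.B y
  · have := squares_of_B (x := y) (y := x) (z := z) (w := w) (by rw [← h]; ring) hy
    refine ⟨by rw [← this.1]; ring, by rw [this.2]; ring⟩
  obtain ⟨r, r', hr⟩ := M.mul (M.q x) (M.q y)
  obtain ⟨k, k', hk⟩ := M.mul z w
  rcases M.comb_cases (M.square_identity h hr hk) with ⟨h1, h2⟩ | ⟨rfl, h2, h3, h4⟩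
  · exact ⟨by rw [hr, h1], by rw [hk, h2]⟩
  · exfalso
    rcases h4 with ⟨h4, h5⟩ | ⟨h4, h5⟩
    · exact hM.squares_aux h hx hy hr h2 h3 h4 (by rw [hk, h5])
    · exact hM.squares_aux (x := y) (y := x) (by rw [← h]; ring) hy hx (by rw [← hr]; ring)
        h2 h3 h4 (by rw [hk, h5])

/-- Elements with equal squares differ by a Boolean element. -/
theorem NS.same_q (hM : M.NS) {x y : T} (h : M.q x = M.q y) :
    ∃ b, M.B b ∧ y = M.dot b x := by
  obtain ⟨z, w, hz⟩ := M.mul x y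
  have h1 := (hM.squares hz).1
  rw [← h, M.q_spec, ← M.one] at h1
  rcases M.pair h1 with ⟨h2, h3⟩ | ⟨h2, h3⟩
  · exact ⟨z, h2.symm, M.B_mem h2.symm (M.mem_left hz)⟩
  · exact ⟨w, h2.symm, M.B_mem h2.symm (M.mem_right hz)⟩

theorem NS.translate (hM : M.NS) {x g s : T} (hs : M.Mem s x g) (hq : M.q s = M.q x)
    (hg : ¬ M.B g) : ∃ b, M.B b ∧ s = M.dot b x ∧ g = M.dot b (M.q x) := by
  obtain ⟨g', hg'⟩ := hs.rot
  have h1 := (hM.squares hg').1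
  rw [hq, M.q_spec, ← M.one] at h1
  have hb : M.B g' := by
    rcases M.pair h1 with h | h
    · exact absurd h.1.symm hg
    · exact h.1.symm
  have hs' := M.B_mem hb (M.mem_right hg')
  refine ⟨g', hb, hs', ?_⟩
  apply M.inj
  rw [M.dot_spec hb]
  rw [hs', M.dot_spec hb] at hg'
  linear_combination -hg' + M g' * M.q_spec x

theorem NS.no_crossing (hM : M.NS) {x g k s t : T} (hg : ¬ M.B g) (hxk : M.q x ≠ M.q k)
    (hs : M.Mem s x g) (ht : M.Mem t g k) (h : 2 * M s * M k = 2 * M t * M x) : False := by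
  obtain ⟨w, w', hw⟩ := M.mul s k
  have h1 := (hM.squares hw).2
  have h2 := (hM.squares (h.symm.trans hw)).2
  rw [h1] at h2
  have h3 : M.q s = M.q x ∧ M.q t = M.q k := by
    rcases M.pair h2 with h | h
    · exact absurd h.2.symm hxk
    · exact ⟨h.1, h.2.symm⟩
  obtain ⟨b, hb, hbs, hbg⟩ := hM.translate hs h3.1 hg
  obtain ⟨d, hd, hdt, hdg⟩ := hM.translate ht.comm h3.2 hg
  have hr := M.B_dot hb hd
  set ρ := M.dot b d with hρ
  have e1 : M.q k = M.dot ρ (M.q x) := by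
    rw [hρ, M.dot_comm b d hb hd, M.dot_assoc hd hb, ← hbg, hdg, M.dot_dot_cancel hd]
  have hρe : ρ ≠ M.e := by
    intro h0
    rw [h0, M.dot_e] at e1
    exact hxk e1.symm
  obtain ⟨r, r', hrr⟩ := M.mul x k
  have hbb := M.B_iff.1 hb
  have hdd := M.B_iff.1 hd
  have e2 : M (M.dot ρ r) + M (M.dot ρ r') = M r + M r' := by
    rw [M.dot_spec hr, M.dot_spec hr, hρ, M.dot_spec hb]
    rw [hbs, hdt, M.dot_spec hb, M.dot_spec hd] at h
    linear_combination M d * h - (M b * M d - 1) * hrr + 2 * M x * M k * hdd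
  have e3 : M (M.q r) + M (M.q r') = M ρ + M (M.dot ρ (M.q (M.q x))) := by
    rw [← (hM.squares hrr).1, e1, M.dot_spec hr, M.dot_spec hr]
    linear_combination M ρ * M.q_spec (M.q x)
  have e4 : M.q g ≠ M.e := hg
  have e5 : M.q g = M.q (M.q x) := by rw [hbg, M.q_dot hb]
  have e6 : M.q r = M.q r' := by
    rcases M.pair e2 with e | e
    · have i1 := (M.dot_eq_self hr e.1).resolve_left hρe
      have i2 := (M.dot_eq_self hr e.2).resolve_left hρe
      rw [← i1, i2]
    · rw [← e.1, M.q_dot hr]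
  have e7 : ρ = M.dot ρ (M.q (M.q x)) := by
    rcases M.pair e3 with e | e
    · exact e.1.symm.trans (e6.trans e.2)
    · exact e.2.symm.trans (e6.symm.trans e.1)
  apply e4
  rw [e5]
  apply M.dot_inj hr
  rw [← e7, M.dot_e']

end Model
end TwoValuedGroup

namespace TwoValuedGroup
namespace Model

variable {T : Type u} {R : Type v} [CommRing R] {M : Model T R}

/-- A d'Alembert map from an abelian group. -/
structure DAl (M : Model T R) {G : Type w} [AddCommGroup G] (π : G → T) : Prop where
  zero : π 0 = M.e
  mul : ∀ a b, 2 * M (π a) * M (π b) = M (π (a + b)) + M (π (a - b))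

namespace DAl

variable {G : Type w} [AddCommGroup G] {π : G → T}

theorem neg (D : DAl M π) (a : G) : π (-a) = π a := by
  have h := D.mul 0 a
  rw [D.zero, M.one, zero_add, zero_sub] at h
  exact M.inj (by linear_combination -h)

theorem mem_add (D : DAl M π) (a b : G) : M.Mem (π (a + b)) (π a) (π b) := ⟨_, D.mul a b⟩

theorem mem_sub (D : DAl M π) (a b : G) : M.Mem (π (a - b)) (π a) (π b) :=
  ⟨π (a + b), by rw [D.mul, add_comm]⟩

theorem q_eq (D : DAl M π) (a : G) : M.q (π a) = π (a + a) := by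
  apply M.q_unique
  rw [D.mul, sub_self, D.zero, M.one, add_comm]

theorem eq_e (D : DAl M π) {a b : G} (h : π a = π b) : π (a + b) = M.e ∨ π (a - b) = M.e := by
  have h1 := D.mul a b
  rw [h, M.q_spec, ← M.one] at h1
  rcases M.pair h1 with h | h
  · exact Or.inl h.1.symm
  · exact Or.inr h.1.symm

theorem add_ker (D : DAl M π) (a : G) {k : G} (h : π k = M.e) : π (a + k) = π a := by
  have h1 : 2 * M (π a) * M (π k) = M (π a) + M (π a) := by rw [h, M.one]; ring
  rw [D.mul] at h1
  rcases M.pair h1 with h | h <;> exact h.1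

/-- The kernel of a d'Alembert map. -/
def ker (D : DAl M π) : AddSubgroup G where
  carrier := {a | π a = M.e}
  zero_mem' := D.zero
  add_mem' := fun {a b} ha hb => by
    show π (a + b) = M.e
    rw [D.add_ker a hb]; exact ha
  neg_mem' := fun {a} ha => by
    show π (-a) = M.e
    rw [D.neg]; exact ha

/-- Passing to the quotient by the kernel. -/
theorem exists_quotient (D : DAl M π) : ∃ π' : G ⧸ D.ker → T, DAl M π' ∧
    (∀ a, π' a = M.e → a = 0) ∧ ∀ a : G, π' (QuotientAddGroup.mk a) = π a := by
  let π' : G ⧸ D.ker → T := fun a => Quotient.liftOn' a π (fun a b h => by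
    rw [QuotientAddGroup.leftRel_apply] at h
    have h1 := D.add_ker a h
    rw [add_neg_cancel_left] at h1
    exact h1.symm)
  have h : ∀ a : G, π' (QuotientAddGroup.mk a) = π a := fun a => rfl
  refine ⟨π', ⟨?_, ?_⟩, ?_, h⟩
  · rw [← QuotientAddGroup.mk_zero, h, D.zero]
  · intro a b
    obtain ⟨a, rfl⟩ := QuotientAddGroup.mk_surjective a
    obtain ⟨b, rfl⟩ := QuotientAddGroup.mk_surjective b
    rw [← QuotientAddGroup.mk_add, ← QuotientAddGroup.mk_sub, h, h, h, h, D.mul]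
  · intro a ha
    obtain ⟨a, rfl⟩ := QuotientAddGroup.mk_surjective a
    rw [h] at ha
    exact (QuotientAddGroup.eq_zero_iff a).2 ha

theorem eq_or (D : DAl M π) (hk : ∀ a, π a = M.e → a = 0) {a b : G} (h : π a = π b) :
    a = b ∨ a = -b := by
  rcases D.eq_e h with h | h
  · exact Or.inr (eq_neg_of_add_eq_zero_left (hk _ h))
  · exact Or.inl (sub_eq_zero.1 (hk _ h))

end DAl

theorem cheb_zero (x : R) (f : ℤ → R) (h : ∀ k, f (k + 1) + f (k - 1) = 2 * x * f k)
    (h0 : f 0 = 0) (h1 : f 1 = 0) (k : ℤ) : f k = 0 := by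
  suffices H : ∀ k : ℤ, f k = 0 ∧ f (k + 1) = 0 from (H k).1
  intro k
  induction k using Int.induction_on with
  | zero => exact ⟨h0, by simpa using h1⟩
  | succ n ih =>
    refine ⟨ih.2, ?_⟩
    have := h (n + 1)
    rw [ih.2, add_sub_cancel_right, ih.1] at this
    simpa using this
  | pred n ih =>
    have h2 := h (-(n : ℤ))
    rw [ih.1, ih.2] at h2
    refine ⟨by simpa using h2, by simpa using ih.1⟩

theorem cheb_eq (x : R) (f g : ℤ → R) (hf : ∀ k, f (k + 1) + f (k - 1) = 2 * x * f k)
    (hg : ∀ k, g (k + 1) + g (k - 1) = 2 * x * g k)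
    (h0 : f 0 = g 0) (h1 : f 1 = g 1) (k : ℤ) : f k = g k := by
  have := cheb_zero x (fun k => f k - g k) (fun k => by linear_combination hf k - hg k)
    (by simp [h0]) (by simp [h1]) k
  exact sub_eq_zero.1 this

open Classical in
/-- The element completing `y` to the product `x * z`. -/
noncomputable def other (M : Model T R) (x z y : T) : T :=
  if h : ∃ w, 2 * M x * M z = M y + M w then h.choose else y

theorem other_spec {x z y : T} (h : M.Mem y x z) :
    2 * M x * M z = M y + M (M.other x z y) := by
  have h' : ∃ w, 2 * M x * M z = M y + M w := h
  rw [other, dif_pos h']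
  exact h'.choose_spec

variable {G : Type w} [AddCommGroup G] {π : G → T}

/-- The Chebyshev-type iterates of `F` over `π`. -/
noncomputable def iter (M : Model T R) (π F : G → T) (a : G) : ℕ → T
  | 0 => π a
  | 1 => F a
  | k + 2 => M.other (F 0) (iter M π F a (k + 1)) (iter M π F a k)

noncomputable def iterZ (M : Model T R) (π F : G → T) (k : ℤ) (a : G) : T :=
  if 0 ≤ k then M.iter π F a k.toNat else M.iter π F (-a) (-k).toNat

theorem DAl.extend_of (D : DAl M π) (F D' : G → T)
    (good : ∀ a b, 2 * M (F a) * M (π b) = M (F (a + b)) + M (F (a - b)))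
    (hS : ∀ a b, 2 * M (F a) * M (F b) = M (π (a - b)) + M (D' (a + b))) :
    ∃ π' : G × ℤ → T, DAl M π' ∧ (∀ a, π' (a, 0) = π a) ∧ ∀ a, π' (a, 1) = F a := by
  have hmem : ∀ a (k : ℕ), M.Mem (M.iter π F a k) (F 0) (M.iter π F a (k + 1)) := by
    intro a k
    induction k with
    | zero =>
      refine ⟨D' a, ?_⟩
      have := hS a 0
      rw [sub_zero, add_zero] at this
      show 2 * M (F 0) * M (F a) = M (π a) + _
      rw [← this]; ring
    | succ k ih => exact (M.mem_right (other_spec ih)).rot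
  have hrec : ∀ a (k : ℕ), M (M.iter π F a (k + 2)) + M (M.iter π F a k) =
      2 * M (F 0) * M (M.iter π F a (k + 1)) := by
    intro a k
    rw [other_spec (hmem a k), add_comm]
    rfl
  set p := M.iterZ π F with hp
  have p0 : ∀ a, p 0 a = π a := fun a => rfl
  have p1 : ∀ a, p 1 a = F a := fun a => rfl
  have pneg : ∀ k a, p (-k) a = p k (-a) := by
    intro k a
    rcases lt_trichotomy k 0 with h | rfl | h
    · simp [hp, iterZ, h.le, not_le.2 h]
    · rw [neg_zero, p0, p0, D.neg]
    · simp [hp, iterZ, h.le, not_le.2 h]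
  have pnat : ∀ (k : ℕ) a, p k a = M.iter π F a k := fun k a => by simp [hp, iterZ]
  have prec_nat : ∀ (k : ℕ) a, M (p (k + 1) a) + M (p (k - 1) a) = 2 * M (F 0) * M (p k a) := by
    intro k a
    rcases k with _ | k
    · have h1 := good 0 a
      rw [zero_add, zero_sub] at h1
      have h2 := pneg 1 a
      rw [Nat.cast_zero, zero_add, zero_sub, p1, h2, p1, p0]
      exact h1.symm
    · have := hrec a k
      have e1 : p ((k + 1 : ℕ) + 1) a = M.iter π F a (k + 2) := by
        rw [← pnat]; push_cast; congr 1
      have e2 : p ((k + 1 : ℕ) - 1) a = M.iter π F a k := by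
        rw [← pnat]; push_cast; congr 1; ring
      rw [e1, e2, pnat, this]
  have prec : ∀ (k : ℤ) a, M (p (k + 1) a) + M (p (k - 1) a) = 2 * M (F 0) * M (p k a) := by
    intro k a
    obtain ⟨n, rfl | rfl⟩ := k.eq_nat_or_neg
    · exact prec_nat n a
    · have := prec_nat n (-a)
      rw [pneg, ← this, add_comm (M (p (n + 1) (-a))), ← pneg, ← pneg]
      congr 4 <;> ring
  have hl0 : ∀ k a b, 2 * M (p k a) * M (π b) = M (p k (a + b)) + M (p k (a - b)) := by
    intro k a b
    refine cheb_eq (M (F 0)) (fun k => 2 * M (p k a) * M (π b))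
      (fun k => M (p k (a + b)) + M (p k (a - b))) ?_ ?_ ?_ ?_ k
    · intro k; linear_combination 2 * M (π b) * prec k a
    · intro k; linear_combination prec k (a + b) + prec k (a - b)
    · exact D.mul a b
    · exact good a b
  have hl1 : ∀ k a b, 2 * M (p k a) * M (F b) = M (p (k + 1) (a + b)) + M (p (k - 1) (a - b)) := by
    intro k a b
    refine cheb_eq (M (F 0)) (fun k => 2 * M (p k a) * M (F b))
      (fun k => M (p (k + 1) (a + b)) + M (p (k - 1) (a - b))) ?_ ?_ ?_ ?_ k
    · intro k; linear_combination 2 * M (F b) * prec k a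
    · intro k
      have e1 := prec (k + 1) (a + b)
      have e2 := prec (k - 1) (a - b)
      rw [add_sub_cancel_right] at e1
      rw [sub_add_cancel] at e2
      rw [add_sub_cancel_right, sub_add_cancel]
      linear_combination e1 + e2
    · have h1 := good b a
      have h2 := pneg 1 (a - b)
      rw [p0, zero_add, zero_sub, p1, h2, p1, neg_sub, add_comm a b, ← h1]
      ring
    · have h1 := prec 1 (a + b)
      have h2 := hS (a + b) 0
      have h3 := hS a b
      rw [sub_zero, add_zero] at h2
      rw [sub_self, p0, p1] at h1
      rw [p1, sub_self, p0]
      linear_combination h3 - h1 - h2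
  have hall : ∀ k l a b, 2 * M (p k a) * M (p l b) =
      M (p (k + l) (a + b)) + M (p (k - l) (a - b)) := by
    intro k l a b
    refine cheb_eq (M (F 0)) (fun l => 2 * M (p k a) * M (p l b))
      (fun l => M (p (k + l) (a + b)) + M (p (k - l) (a - b))) ?_ ?_ ?_ ?_ l
    · intro l; linear_combination 2 * M (p k a) * prec l b
    · intro l
      have e1 := prec (k + l) (a + b)
      have e2 := prec (k - l) (a - b)
      rw [show k + (l + 1) = k + l + 1 by ring, show k + (l - 1) = k + l - 1 by ring,
        show k - (l + 1) = k - l - 1 by ring, show k - (l - 1) = k - l + 1 by ring]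
      linear_combination e1 + e2
    · have := hl0 k a b
      simpa [p0] using this
    · have := hl1 k a b
      simpa [p1] using this
  refine ⟨fun g => p g.2 g.1, ⟨?_, ?_⟩, fun a => p0 a, fun a => p1 a⟩
  · show p 0 0 = M.e
    rw [p0, D.zero]
  · rintro ⟨a, k⟩ ⟨b, l⟩
    exact hall k l a b

end Model
end TwoValuedGroup

namespace TwoValuedGroup
namespace Model

variable {T : Type u} {R : Type v} [CommRing R] {M : Model T R}

theorem comb_two_two {u v u' v' s s' t t' : T}
    (H : M u + M v + M u' + M v' = M s + M s' + M t + M t') :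
    ((u = s ∨ u = s') ∧ (v = t ∨ v = t')) ∨ ((u = t ∨ u = t') ∧ (v = s ∨ v = s')) ∨
    M u + M v = M s + M s' ∨ M u + M v = M t + M t' := by
  have h1 := M.mem4 H
  have h2 := M.mem4 (show M v + M u + M u' + M v' = M s + M s' + M t + M t' by rw [← H]; ring)
  have key : (u = s ∧ v = s') ∨ (u = s' ∧ v = s) → M u + M v = M s + M s' := by
    rintro (⟨rfl, rfl⟩ | ⟨rfl, rfl⟩)
    · rfl
    · ring
  have key' : (u = t ∧ v = t') ∨ (u = t' ∧ v = t) → M u + M v = M t + M t' := by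
    rintro (⟨rfl, rfl⟩ | ⟨rfl, rfl⟩)
    · rfl
    · ring
  by_cases e : u = v
  · subst e
    have h3 := congrArg (M.c u) H
    simp only [map_add, c_eps] at h3
    have h4 : ((u = s ∨ u = s') ∧ (u = t ∨ u = t')) ∨ (u = s ∧ u = s') ∨ (u = t ∧ u = t') := by
      clear key key' h1 h2 H
      grind
    rcases h4 with h4 | ⟨h4, h5⟩ | ⟨h4, h5⟩
    · exact Or.inl h4
    · exact Or.inr (Or.inr (Or.inl (key (Or.inl ⟨h4, h5⟩))))
    · exact Or.inr (Or.inr (Or.inr (key' (Or.inl ⟨h4, h5⟩))))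
  · grind only

namespace DAl
variable {G : Type w} [AddCommGroup G] {π : G → T}

theorem dot_pi (D : DAl M π) {b : G} (hb : M.B (π b)) (a : G) :
    M.dot (π b) (π a) = π (b + a) := (M.mem_B hb (D.mem_add b a)).symm

theorem B_iff (D : DAl M π) (hk : ∀ a, π a = M.e → a = 0) {a : G} :
    M.B (π a) ↔ a + a = 0 := by
  rw [B, D.q_eq]
  exact ⟨hk _, fun h => by rw [h, D.zero]⟩

end DAl

variable {G : Type w} [AddCommGroup G] {π : G → T}

/-- An element `x` outside the image of a d'Alembert map, together with a chosen
`h ∈ x * π g` where `g` has order not dividing `4`. -/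
structure Adjoin (M : Model T R) (π : G → T) (x h : T) (g : G) : Prop where
  ns : M.NS
  dal : DAl M π
  ker : ∀ a, π a = M.e → a = 0
  B_range : ∀ b, M.B b → ∃ a, π a = b
  notMem : ∀ a, π a ≠ x
  order : g + g + (g + g) ≠ 0
  mem : M.Mem h x (π g)

theorem NS.q_ne (hM : M.NS) (D : DAl M π) (hB : ∀ b, M.B b → ∃ a, π a = b) {y : T}
    (hy : ∀ a, π a ≠ y) (a : G) : M.q y ≠ M.q (π a) := by
  intro h
  obtain ⟨b, hb, hb'⟩ := hM.same_q h.symm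
  obtain ⟨β, rfl⟩ := hB b hb
  rw [D.dot_pi hb] at hb'
  exact hy _ hb'.symm

/-- If `f` lies in `y * π c` and `y * π d` with `c + d` even, then `π c = π d`. -/
theorem NS.disjoint (hM : M.NS) (D : DAl M π) (hB : ∀ b, M.B b → ∃ a, π a = b) {y f : T}
    (hy : ∀ a, π a ≠ y) {c d u : G} (hc : M.Mem f y (π c)) (hd : M.Mem f y (π d))
    (hu : c + d = u + u) : π c = π d := by
  by_contra hne
  have h1 := M.mul_eq_of_mem hc.rot hd.rot hne
  have h2 := (hM.squares h1).2
  rw [D.mul] at h2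
  have h3 : M.q y = π (c + d) ∨ M.q y = π (c - d) := by
    rcases M.pair h2 with h | h
    · exact Or.inl h.1.symm
    · exact Or.inr h.2.symm
  rcases h3 with h | h
  · rw [hu, ← D.q_eq] at h
    exact hM.q_ne D hB hy _ h
  · rw [show c - d = (u - d) + (u - d) by rw [sub_add_sub_comm, ← hu]; abel, ← D.q_eq] at h
    exact hM.q_ne D hB hy _ h

theorem NS.one_each (hM : M.NS) (D : DAl M π) (hB : ∀ b, M.B b → ∃ a, π a = b) {x f : T}
    (hx : ∀ a, π a ≠ x) {a : G} (hf : M.Mem f x (π a)) (b : G) :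
    ∃ u v, 2 * M f * M (π b) = M u + M v ∧ M.Mem u x (π (a + b)) ∧ M.Mem v x (π (a - b)) := by
  obtain ⟨u, v, huv⟩ := M.mul f (π b)
  by_cases ha : M.B (π a)
  · have e1 := M.mem_B ha hf.comm
    have e2 : π (a - b) = π (a + b) := by
      rw [sub_eq_add_neg, ← D.dot_pi ha, ← D.dot_pi ha, D.neg]
    have e3 : 2 * M x * M (π (a + b)) = M u + M v := by
      rw [← huv, ← D.dot_pi ha, e1, M.dot_spec ha, M.dot_spec ha]
      ring
    exact ⟨u, v, huv, M.mem_left e3, by rw [e2]; exact M.mem_right e3⟩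
  obtain ⟨f', hf'⟩ := id hf
  obtain ⟨u', v', huv'⟩ := M.mul f' (π b)
  obtain ⟨s, s', hs⟩ := M.mul x (π (a + b))
  obtain ⟨t, t', ht⟩ := M.mul x (π (a - b))
  have H : M u + M v + M u' + M v' = M s + M s' + M t + M t' := by
    linear_combination -huv - huv' + hs + ht - 2 * M (π b) * hf' + 2 * M x * D.mul a b
  rcases M.comb_two_two H with ⟨h1, h2⟩ | ⟨h1, h2⟩ | h | h
  · refine ⟨u, v, huv, ?_, ?_⟩
    · rcases h1 with rfl | rfl
      exacts [M.mem_left hs, M.mem_right hs]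
    · rcases h2 with rfl | rfl
      exacts [M.mem_left ht, M.mem_right ht]
  · refine ⟨v, u, by rw [huv, add_comm], ?_, ?_⟩
    · rcases h2 with rfl | rfl
      exacts [M.mem_left hs, M.mem_right hs]
    · rcases h1 with rfl | rfl
      exacts [M.mem_left ht, M.mem_right ht]
  · exact (hM.no_crossing ha (hM.q_ne D hB hx b) hf (D.mem_add a b)
      (by rw [huv, h, ← hs]; ring)).elim
  · exact (hM.no_crossing ha (hM.q_ne D hB hx b) hf (D.mem_sub a b)
      (by rw [huv, h, ← ht]; ring)).elim

/-- Elements of `(h * y) * z` lie in `h * (y * z)`. -/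
theorem Mem.assoc {h y z f u s t : T} (hf : M.Mem f h y) (hu : M.Mem u f z)
    (hyz : 2 * M y * M z = M s + M t) : M.Mem u h s ∨ M.Mem u h t := by
  obtain ⟨f', hf⟩ := hf
  obtain ⟨u', hu⟩ := hu
  obtain ⟨v, v', hv⟩ := M.mul f' z
  obtain ⟨p, p', hp⟩ := M.mul h s
  obtain ⟨r, r', hr⟩ := M.mul h t
  have H : M u + M u' + M v + M v' = M p + M p' + M r + M r' := by
    linear_combination -hu - hv + hp + hr - 2 * M z * hf + 2 * M h * hyz
  rcases M.mem4 H with rfl | rfl | rfl | rfl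
  exacts [Or.inl (M.mem_left hp), Or.inl (M.mem_right hp), Or.inr (M.mem_left hr),
    Or.inr (M.mem_right hr)]

namespace Adjoin

variable {x h : T} {g : G}

theorem h_notMem (A : Adjoin M π x h g) (a : G) : π a ≠ h := by
  rintro rfl
  have h1 := A.mem.comm.rot.comm
  rcases h1.eq (A.dal.mul a g) with h | h
  · exact A.notMem _ h.symm
  · exact A.notMem _ h.symm

theorem g_ne (A : Adjoin M π x h g) : g + g ≠ 0 := by
  intro h0
  exact A.order (by rw [h0, add_zero])

theorem exists_F (A : Adjoin M π x h g) (a : G) :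
    ∃ f, M.Mem f x (π a) ∧ M.Mem f h (π (a - g)) := by
  obtain ⟨u, v, h1, h2, -⟩ := A.ns.one_each A.dal A.B_range A.notMem A.mem (a - g)
  rw [add_sub_cancel] at h2
  exact ⟨u, h2, M.mem_left h1⟩

theorem unique_F (A : Adjoin M π x h g) {a : G} {f f' : T} (h1 : M.Mem f x (π a))
    (h2 : M.Mem f h (π (a - g))) (h1' : M.Mem f' x (π a)) (h2' : M.Mem f' h (π (a - g))) :
    f = f' := by
  by_contra hne
  obtain ⟨u, v, h3, h4, h5⟩ := A.ns.one_each A.dal A.B_range A.notMem A.mem (a - g)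
  have h6 := M.mul_eq_of_mem h2 h2' hne
  have hv : M.Mem v x (π a) := by
    rcases (M.mem_right h3).eq h6 with rfl | rfl
    exacts [h1, h1']
  have h7 := A.ns.disjoint A.dal A.B_range A.notMem hv h5 (u := g) (by abel)
  rcases A.dal.eq_or A.ker h7 with h8 | h8
  · have hB : M.B (π (a - g)) := by
      rw [A.dal.B_iff A.ker]
      have : a - g + (a - g) = a - (g - (a - g)) := by abel
      rw [this, ← h8, sub_self]
    exact hne ((M.mem_B hB h2.comm).trans (M.mem_B hB h2'.comm).symm)
  · apply A.g_ne
    have : g + g = a + (g - (a - g)) := by abel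
    rw [this]
    nth_rewrite 1 [h8]
    simp

/-- The translate of `x` by `a`. -/
noncomputable def F (A : Adjoin M π x h g) (a : G) : T := (A.exists_F a).choose

theorem F_mem (A : Adjoin M π x h g) (a : G) : M.Mem (A.F a) x (π a) := (A.exists_F a).choose_spec.1
theorem F_mem' (A : Adjoin M π x h g) (a : G) : M.Mem (A.F a) h (π (a - g)) :=
  (A.exists_F a).choose_spec.2

theorem F_eq (A : Adjoin M π x h g) {a : G} {f : T} (h1 : M.Mem f x (π a))
    (h2 : M.Mem f h (π (a - g))) : A.F a = f := A.unique_F (A.F_mem a) (A.F_mem' a) h1 h2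

theorem F_zero (A : Adjoin M π x h g) : A.F 0 = x := by
  have h := A.F_mem 0
  rw [A.dal.zero] at h
  rw [M.mem_B M.B_e h.comm, M.dot_e]

theorem F_g (A : Adjoin M π x h g) : A.F g = h := by
  have h := A.F_mem' g
  rw [sub_self, A.dal.zero] at h
  rw [M.mem_B M.B_e h.comm, M.dot_e]

theorem F_add (A : Adjoin M π x h g) {b : G} (hb : M.B (π b)) (a : G) :
    A.F (b + a) = M.dot (π b) (A.F a) := by
  apply A.F_eq
  · rw [← A.dal.dot_pi hb]
    exact (M.mem_dot_dot hb (A.F_mem a).comm).comm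
  · rw [add_sub_assoc, ← A.dal.dot_pi hb]
    exact (M.mem_dot_dot hb (A.F_mem' a).comm).comm

theorem disj (A : Adjoin M π x h g) {f : T} {c d : G} (u : G) (hc : M.Mem f x (π c))
    (hd : M.Mem f x (π d)) (hu : c + d = u + u) : c = d ∨ c = -d :=
  A.dal.eq_or A.ker (A.ns.disjoint A.dal A.B_range A.notMem hc hd hu)

theorem disj' (A : Adjoin M π x h g) {f : T} {c d : G} (u : G) (hc : M.Mem f h (π c))
    (hd : M.Mem f h (π d)) (hu : c + d = u + u) : c = d ∨ c = -d :=
  A.dal.eq_or A.ker (A.ns.disjoint A.dal A.B_range A.h_notMem hc hd hu)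

/-- Membership is invariant under translating both factors by a Boolean element. -/
theorem mem_translate (A : Adjoin M π x h g) {b c : G} (hb : M.B (π b)) {f y : T}
    (hf : M.Mem f y (π c)) : M.Mem f (M.dot (π b) y) (π (c - b)) := by
  have h1 := M.mem_dot_dot hb hf
  have h2 := (M.mem_dot_dot hb h1.comm).comm
  rw [M.dot_dot_cancel hb, A.dal.dot_pi hb] at h2
  have : b + c = c - b := by
    have := (A.dal.B_iff A.ker).1 hb
    rw [eq_sub_iff_add_eq, add_right_comm, this, zero_add]
  rwa [this] at h2

theorem mg_or (A : Adjoin M π x h g) (a a' : G) :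
    M.Mem (A.F a') (A.F a) (π (a' - a)) ∨ a' + a' = a + a - (g + g) := by
  obtain ⟨u, v, h1, h2, -⟩ := A.ns.one_each A.dal A.B_range A.notMem (A.F_mem a) (a' - a)
  rw [add_sub_cancel] at h2
  rcases (A.F_mem' a).assoc (M.mem_left h1) (A.dal.mul _ _) with h3 | h3
  · rw [show a - g + (a' - a) = a' - g by abel] at h3
    rw [A.F_eq h2 h3]
    exact Or.inl (M.mem_left h1)
  · obtain ⟨u1, v1, h4, h5, h6⟩ := A.ns.one_each A.dal A.B_range A.notMem A.mem (a - g - (a' - a))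
    rcases h3.eq h4 with rfl | rfl
    · rcases A.disj a h2 h5 (by abel) with h7 | h7
      · left
        have hb : M.B (π (a' - a)) := by
          rw [A.dal.B_iff A.ker]
          have : a' - a + (a' - a) = a' - (g + (a - g - (a' - a))) := by abel
          rw [this, ← h7, sub_self]
        have := A.F_add hb a
        rw [sub_add_cancel] at this
        rw [this]
        exact (M.mem_dot hb _).comm
      · left
        have hb : M.B (π a) := by
          rw [A.dal.B_iff A.ker]
          have : a + a = a' + (g + (a - g - (a' - a))) := by abel
          rw [this]; exact eq_neg_iff_add_eq_zero.1 h7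
        have := A.F_add hb 0
        rw [add_zero, A.F_zero] at this
        rw [this]
        exact A.mem_translate hb (A.F_mem a')
    · rcases A.disj (g - a + a') h2 h6 (by abel) with h7 | h7
      · left
        have hb : M.B (π (a - g)) := by
          rw [A.dal.B_iff A.ker]
          have : a - g + (a - g) = a' - (g - (a - g - (a' - a))) := by abel
          rw [this, ← h7, sub_self]
        have := A.F_add hb g
        rw [sub_add_cancel, A.F_g] at this
        rw [this]
        have h8 := A.mem_translate hb (A.F_mem' a')
        rwa [show a' - g - (a - g) = a' - a by abel] at h8
      · right
        rw [eq_neg_iff_add_eq_zero] at h7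
        rw [← sub_eq_zero, ← h7]
        abel

theorem mg (A : Adjoin M π x h g) (a a' : G) : M.Mem (A.F a') (A.F a) (π (a' - a)) := by
  rcases A.mg_or a a' with h1 | h1
  · exact h1
  rcases A.mg_or a' a with h2 | h2
  · have := h2.comm.rot.comm
    rwa [← neg_sub a' a, A.dal.neg] at this
  · exfalso
    apply A.order
    rw [h1] at h2
    have : g + g + (g + g) = (a + a) - (a + a - (g + g) - (g + g)) := by abel
    rw [this, ← h2, sub_self]

theorem good (A : Adjoin M π x h g) (a b : G) :
    2 * M (A.F a) * M (π b) = M (A.F (a + b)) + M (A.F (a - b)) := by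
  have h1 := A.mg a (a + b)
  have h2 := A.mg a (a - b)
  rw [add_sub_cancel_left] at h1
  rw [sub_sub_cancel_left, A.dal.neg] at h2
  by_cases hne : A.F (a + b) = A.F (a - b)
  · have hb : M.B (π b) := by
      rw [A.dal.B_iff A.ker]
      rcases A.disj a (A.F_mem (a + b)) (hne ▸ A.F_mem (a - b)) (by abel) with h3 | h3
      · have : b + b = a + b - (a - b) := by abel
        rw [this, ← h3, sub_self]
      · rcases A.disj' (a - g) (A.F_mem' (a + b)) (hne ▸ A.F_mem' (a - b)) (by abel) with h4 | h4
        · have : b + b = a + b - g - (a - b - g) := by abel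
          rw [this, ← h4, sub_self]
        · exfalso
          apply A.g_ne
          rw [eq_neg_iff_add_eq_zero] at h3 h4
          have : g + g = (a + b + (a - b)) - (a + b - g + (a - b - g)) := by abel
          rw [this, h3, h4, sub_zero]
    have e := M.mem_B hb h1.comm
    rw [← hne, e, M.dot_spec hb]
    ring
  · exact M.mul_eq_of_mem h1 h2 hne

/-- The second element of `x * F c`. -/
noncomputable def dbl (_ : Adjoin M π x h g) (F : G → T) (c : G) : T := M.other x (F c) (π c)

theorem dbl_spec (A : Adjoin M π x h g) (c : G) :
    2 * M x * M (A.F c) = M (π c) + M (A.dbl A.F c) := other_spec (A.F_mem c).rot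

theorem mem_F_F (A : Adjoin M π x h g) (a b : G) : M.Mem (π (a - b)) (A.F a) (A.F b) := by
  have := (A.mg a b).rot
  rwa [← neg_sub, A.dal.neg] at this

theorem F_mul_or (A : Adjoin M π x h g) {a b : G} {w : T}
    (hw : 2 * M (A.F a) * M (A.F b) = M (π (a - b)) + M w) :
    w = A.dbl A.F (a + b) ∨ w = A.dbl A.F (a - b) := by
  obtain ⟨w', h2⟩ := A.mem_F_F a (-b)
  rw [sub_neg_eq_add] at h2
  have h1 := A.good 0 b
  rw [zero_add, zero_sub, A.F_zero] at h1
  have h3 : M w + M w' = M (A.dbl A.F (a + b)) + M (A.dbl A.F (a - b)) := by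
    linear_combination A.dbl_spec (a + b) + A.dbl_spec (a - b) - hw - h2 + 2 * M x * A.good a b
      - 2 * M (A.F a) * h1
  rcases M.pair h3 with h | h
  · exact Or.inl h.1
  · exact Or.inr h.1

theorem F_mul_of_B (A : Adjoin M π x h g) {a : G} (ha : M.B (π a)) (b : G) :
    2 * M (A.F a) * M (A.F b) = M (π (a - b)) + M (A.dbl A.F (a + b)) := by
  have h1 := A.F_add ha 0
  rw [add_zero, A.F_zero] at h1
  have h2 := A.F_add ha b
  have h3 : π (a - b) = π (a + b) := by
    rw [sub_eq_add_neg, ← A.dal.dot_pi ha, ← A.dal.dot_pi ha, A.dal.neg]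
  rw [h3, ← A.dbl_spec, h1, h2, M.dot_spec ha, M.dot_spec ha]
  ring

/-- If `F a` has the same square as `x`, then `dbl` is even about `a`. -/
theorem dbl_eq_of_q_eq (A : Adjoin M π x h g) {a : G} (ha : ¬ M.B (π a))
    (hq : M.q (A.F a) = M.q x) :
    ∃ b₀, b₀ + b₀ = 0 ∧ ∀ b, A.dbl A.F (a + b) = π (b₀ + b) := by
  obtain ⟨β, hβ, hFa⟩ := A.ns.same_q hq.symm
  obtain ⟨b₀, rfl⟩ := A.B_range β hβ
  have hb₀ := (A.dal.B_iff A.ker).1 hβ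
  have hFb := A.F_add hβ 0
  rw [add_zero, A.F_zero] at hFb
  have h1 : 2 * M x * M (A.F a) = M (π b₀) + M (M.dot (π b₀) (M.q x)) := by
    rw [hFa, M.dot_spec hβ, M.dot_spec hβ]
    linear_combination M (π b₀) * M.q_spec x
  have h2 : π a = M.dot (π b₀) (M.q x) := by
    rcases (A.F_mem a).rot.eq h1 with h | h
    · rw [h] at ha; exact absurd hβ ha
    · exact h
  have h3 : M.q x = π (b₀ + a) := by
    rw [← A.dal.dot_pi hβ, h2, M.dot_dot_cancel hβ]
  have ha2 : a + a ≠ 0 := fun h => ha ((A.dal.B_iff A.ker).2 h)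
  have key : ∀ b c, (c = b ∨ c = -b) → π (b₀ + c) ≠ π (a + b) := by
    intro b c hc heq
    rcases A.dal.eq_or A.ker heq with h | h
    · rcases hc with rfl | rfl
      · rw [add_right_cancel h] at hb₀; exact ha2 hb₀
      · apply A.ns.q_ne A.dal A.B_range A.notMem b
        rw [h3, A.dal.q_eq, ← A.dal.neg]
        congr 1
        have e : b₀ + a + (b + b) = (a + b) - (b₀ + -b) + (b₀ + b₀) := by abel
        rw [neg_eq_iff_add_eq_zero, e, ← h, sub_self, hb₀, add_zero]
    · rcases hc with rfl | rfl
      · apply A.ns.q_ne A.dal A.B_range A.notMem c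
        rw [h3, A.dal.q_eq, ← A.dal.neg]
        congr 1
        rw [eq_neg_iff_add_eq_zero] at h
        rw [neg_eq_iff_add_eq_zero, ← h]
        abel
      · apply ha2
        rw [eq_neg_iff_add_eq_zero] at h
        have : a + a = (b₀ + -b + (a + b)) + (b₀ + -b + (a + b)) - (b₀ + b₀) := by abel
        rw [this, h, hb₀]; simp
  refine ⟨b₀, hb₀, fun b => ?_⟩
  have h4 := A.good a b
  rw [hFa, ← hFb, A.good b₀ b] at h4
  have h5 : ∃ c, (c = b ∨ c = -b) ∧ A.F (a + b) = A.F (b₀ + c) := by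
    rcases M.pair h4 with h | h
    · exact ⟨b, Or.inl rfl, h.1.symm⟩
    · exact ⟨-b, Or.inr rfl, by rw [← sub_eq_add_neg]; exact h.2.symm⟩
  obtain ⟨c, hc, h6⟩ := h5
  have h7 : π (b₀ + c) = π (b₀ + b) := by
    rcases hc with rfl | rfl
    · rfl
    · rw [← A.dal.dot_pi hβ, ← A.dal.dot_pi hβ, A.dal.neg]
  have h8 := (A.F_mem (b₀ + c)).rot
  rw [← h6] at h8
  rcases h8.eq (A.dbl_spec (a + b)) with h | h
  · exact absurd h (key b c hc)
  · rw [← h, h7]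

theorem F_mul (A : Adjoin M π x h g) (a b : G) :
    2 * M (A.F a) * M (A.F b) = M (π (a - b)) + M (A.dbl A.F (a + b)) := by
  by_cases ha : M.B (π a)
  · exact A.F_mul_of_B ha b
  by_cases hb : M.B (π b)
  · have := A.F_mul_of_B hb a
    rw [← A.dal.neg, neg_sub, add_comm a b, ← this]; ring
  obtain ⟨w, hw⟩ := A.mem_F_F a b
  rw [hw]
  congr 2
  rcases A.F_mul_or hw with h | h
  · exact h
  have h1 := (A.ns.squares hw).2
  have hw2 := A.dbl_spec (a - b)
  rw [← h] at hw2
  rw [(A.ns.squares hw2).2] at h1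
  have h2 : M.q (A.F a) = M.q x ∨ M.q (A.F b) = M.q x := by
    rcases M.pair h1 with h | h
    · exact Or.inl h.1.symm
    · exact Or.inr h.1.symm
  rcases h2 with h2 | h2
  · obtain ⟨b₀, hb₀, H⟩ := A.dbl_eq_of_q_eq ha h2
    have hB := (A.dal.B_iff A.ker).2 hb₀
    rw [h, H, sub_eq_add_neg, H, ← A.dal.dot_pi hB, ← A.dal.dot_pi hB, A.dal.neg]
  · obtain ⟨b₀, hb₀, H⟩ := A.dbl_eq_of_q_eq hb h2
    have hB := (A.dal.B_iff A.ker).2 hb₀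
    have hw' : 2 * M (A.F b) * M (A.F a) = M (π (b - a)) + M w := by
      rw [← A.dal.neg, neg_sub, ← hw]; ring
    rcases A.F_mul_or hw' with h | h
    · rw [h, add_comm]
    · rw [h, add_comm a b, H, sub_eq_add_neg, H, ← A.dal.dot_pi hB, ← A.dal.dot_pi hB, A.dal.neg]

end Adjoin

/-- Adjoining an element to a d'Alembert map whose domain has an element of order not
dividing `4`. -/
theorem NS.extend (hM : M.NS) (D : DAl M π) (hk : ∀ a, π a = M.e → a = 0)
    (hB : ∀ b, M.B b → ∃ a, π a = b) {x : T} (hx : ∀ a, π a ≠ x) {g : G}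
    (hg : g + g + (g + g) ≠ 0) :
    ∃ π' : G × ℤ → T, DAl M π' ∧ (∀ a, π' (a, 0) = π a) ∧ π' (0, 1) = x := by
  obtain ⟨h, w, hh⟩ := M.mul x (π g)
  have A : Adjoin M π x h g := ⟨hM, D, hk, hB, hx, hg, M.mem_left hh⟩
  obtain ⟨π', h1, h2, h3⟩ := D.extend_of A.F (A.dbl A.F) A.good A.F_mul
  exact ⟨π', h1, h2, by rw [h3, A.F_zero]⟩

end Model
end TwoValuedGroup

namespace TwoValuedGroup
namespace Model

variable {T : Type u} {R : Type v} [CommRing R] {M : Model T R}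

noncomputable instance boolAdd : Add {b // M.B b} :=
  ⟨fun a b => ⟨M.dot a.1 b.1, M.B_dot a.2 b.2⟩⟩

instance boolZero : Zero {b // M.B b} := ⟨⟨M.e, M.B_e⟩⟩

instance boolNeg : Neg {b // M.B b} := ⟨id⟩

/-- The elements squaring to the identity form a Boolean group. -/
noncomputable instance boolGroup : AddCommGroup {b // M.B b} where
  add_assoc a b c := Subtype.ext (M.dot_assoc a.2 b.2)
  zero_add a := Subtype.ext (M.dot_e _)
  add_zero a := Subtype.ext (M.dot_e' _)
  nsmul := nsmulRec
  zsmul := zsmulRec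
  neg_add_cancel a := Subtype.ext (M.dot_self a.2)
  add_comm a b := Subtype.ext (M.dot_comm _ _ a.2 b.2)

theorem boolGroup_val_add (a b : {b // M.B b}) : (a + b).1 = M.dot a.1 b.1 := rfl

theorem boolGroup_val_zero : (0 : {b // M.B b}).1 = M.e := rfl

theorem boolGroup_sub (a b : {b // M.B b}) : a - b = a + b := rfl

theorem boolGroup_dAl : DAl M (Subtype.val : {b // M.B b} → T) where
  zero := rfl
  mul a b := by
    rw [boolGroup_sub, boolGroup_val_add, M.dot_spec a.2]
    ring

/-- A d'Alembert map with trivial kernel whose image contains all elements squaring to the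
identity. -/
structure FullDAl (M : Model T R) {G : Type w} [AddCommGroup G] (π : G → T) : Prop
    extends DAl M π where
  ker_trivial : ∀ a, π a = M.e → a = 0
  B_range : ∀ b, M.B b → ∃ a, π a = b

theorem FullDAl.of_extension {G : Type u} [AddCommGroup G] {π : G → T} (F : FullDAl M π)
    {π' : G × ℤ → T} (D : DAl M π') (h : ∀ a, π' (a, 0) = π a) :
    ∃ (H : Type u) (_ : AddCommGroup H) (ρ : H → T), FullDAl M ρ ∧
      (∀ t, (∃ a, π' a = t) → ∃ a, ρ a = t) ∧
      ∀ g : G, g + g + (g + g) ≠ 0 → ∃ k : H, k + k + (k + k) ≠ 0 := by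
  obtain ⟨ρ, h1, h2, h3⟩ := D.exists_quotient
  refine ⟨_, inferInstance, ρ, ⟨h1, h2, fun b hb => ?_⟩, ?_, ?_⟩
  · obtain ⟨a, rfl⟩ := F.B_range b hb
    exact ⟨QuotientAddGroup.mk (a, 0), by rw [h3, h]⟩
  · rintro t ⟨a, rfl⟩
    exact ⟨QuotientAddGroup.mk a, h3 a⟩
  · intro g hg
    refine ⟨QuotientAddGroup.mk (g, 0), fun h0 => hg (F.ker_trivial _ ?_)⟩
    have h4 := h3 ((g, 0) + (g, 0) + ((g, 0) + (g, 0)))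
    rw [QuotientAddGroup.mk_add, QuotientAddGroup.mk_add, h0, h1.zero] at h4
    rw [h4, ← h]
    simp

theorem boolGroup_fullDAl : FullDAl M (Subtype.val : {b // M.B b} → T) :=
  ⟨boolGroup_dAl, fun _ h => Subtype.ext h, fun b hb => ⟨⟨b, hb⟩, rfl⟩⟩

/-- A model containing an element whose square has a nontrivial square is covered, on finite
sets, by d'Alembert maps. -/
theorem NS.exists_dAl (hM : M.NS) {x : T} (hx : ¬ M.B (M.q x)) {S : Set T} (hS : S.Finite) :
    ∃ (G : Type u) (_ : AddCommGroup G) (π : G → T), FullDAl M π ∧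
      (∃ g : G, g + g + (g + g) ≠ 0) ∧ ∀ s ∈ S, ∃ a, π a = s := by
  induction S, hS using Set.Finite.induction_on with
  | empty =>
    obtain ⟨π', h1, h2, h3⟩ := boolGroup_dAl.extend_of (M := M)
      (fun a => M.dot a.1 x) (fun a => M.dot a.1 (M.q x))
      (fun a b => by
        rw [boolGroup_sub, M.dot_spec (a + b).2, boolGroup_val_add, M.dot_spec a.2,
          M.dot_spec a.2]
        ring)
      (fun a b => by
        rw [M.dot_spec (a + b).2, boolGroup_sub, boolGroup_val_add, M.dot_spec a.2,
          M.dot_spec a.2, M.dot_spec b.2]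
        linear_combination M a.1 * M b.1 * M.q_spec x)
    obtain ⟨H, _, ρ, h4, h5, -⟩ := boolGroup_fullDAl.of_extension h1 h2
    refine ⟨H, _, ρ, h4, ?_, fun s hs => absurd hs (Set.notMem_empty s)⟩
    obtain ⟨g, hg⟩ := h5 x ⟨(0, 1), by rw [h3, boolGroup_val_zero, M.dot_e]⟩
    refine ⟨g, fun h0 => hx ?_⟩
    rw [← hg, h4.q_eq, B, h4.q_eq, h0, h4.zero]
  | @insert s S _ _ ih =>
    obtain ⟨G, _, π, h1, ⟨g, hg⟩, h2⟩ := ih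
    by_cases hs : ∃ a, π a = s
    · refine ⟨G, _, π, h1, ⟨g, hg⟩, fun t ht => ?_⟩
      rcases ht with rfl | ht
      exacts [hs, h2 t ht]
    · push Not at hs
      obtain ⟨π', h3, h4, h5⟩ := hM.extend h1.toDAl h1.ker_trivial h1.B_range hs hg
      obtain ⟨H, _, ρ, h6, h7, h8⟩ := h1.of_extension h3 h4
      refine ⟨H, _, ρ, h6, h8 g hg, fun t ht => h7 t ?_⟩
      rcases ht with rfl | ht
      · exact ⟨_, h5⟩
      · obtain ⟨a, rfl⟩ := h2 t ht
        exact ⟨_, h4 a⟩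

end Model
end TwoValuedGroup

namespace TwoValuedGroup

variable {T : Type u}

/-- The formal sum of a multiset. -/
noncomputable def formalSum (s : Multiset T) : T →₀ ℚ :=
  (s.map fun z => Finsupp.single z (1 : ℚ)).sum

theorem formalSum_bind {S : Type v} (s : Multiset S) (f : S → Multiset T) :
    formalSum (s.bind f) = (s.map fun t => formalSum (f t)).sum := by
  simp [formalSum, Multiset.map_bind, Multiset.sum_bind]

/-- Averaged multiplication by `x` on formal linear combinations. -/
noncomputable def mulOp (X : TwoValuedGroup T) (x : T) : Module.End ℚ (T →₀ ℚ) :=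
  Finsupp.linearCombination ℚ fun y => (1 / 2 : ℚ) • formalSum (X.mul x y)

variable {X : TwoValuedGroup T}

theorem mulOp_single (x y : T) :
    X.mulOp x (Finsupp.single y 1) = (1 / 2 : ℚ) • formalSum (X.mul x y) := by
  simp [mulOp]

theorem mulOp_formalSum (x : T) (s : Multiset T) :
    X.mulOp x (formalSum s) = (1 / 2 : ℚ) • formalSum (s.bind (X.mul x)) := by
  rw [formalSum_bind, formalSum, map_multiset_sum, Multiset.map_map, Multiset.smul_sum,
    Multiset.map_map]
  simp [mulOp_single]

theorem mulOp_mul (x y : T) {z w : T} (h : X.mul x y = {z, w}) :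
    2 * X.mulOp x * X.mulOp y = X.mulOp z + X.mulOp w := by
  refine Finsupp.lhom_ext' fun t => LinearMap.ext_ring ?_
  have h1 := X.assoc x y t
  have h2 : X.mulOp x (X.mulOp y (Finsupp.single t 1)) =
      (1 / 4 : ℚ) • formalSum ((X.mul y t).bind (X.mul x)) := by
    rw [mulOp_single, map_smul, mulOp_formalSum, smul_smul]; norm_num
  have h3 : formalSum ((X.mul y t).bind (X.mul x)) =
      formalSum (X.mul z t) + formalSum (X.mul w t) := by
    rw [← h1, h, formalSum_bind]; simp
  rw [mul_assoc, two_mul]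
  simp only [LinearMap.comp_apply, Finsupp.lsingle_apply, LinearMap.add_apply]
  rw [Module.End.mul_apply, h2, h3, mulOp_single, mulOp_single]
  module

theorem exists_mul (X : TwoValuedGroup T) (x y : T) : ∃ z w, X.mul x y = {z, w} :=
  Multiset.card_eq_two.1 (X.card_mul x y)

theorem mulOp_e : X.mulOp X.e = 1 := by
  refine Finsupp.lhom_ext' fun t => LinearMap.ext_ring ?_
  simp only [LinearMap.comp_apply, Finsupp.lsingle_apply, mulOp_single, X.e_mul,
    Module.End.one_apply]
  simp only [formalSum, Multiset.insert_eq_cons, Multiset.map_cons, Multiset.map_singleton,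
    Multiset.sum_cons, Multiset.sum_singleton]
  module

theorem mulOp_single_e (x : T) : X.mulOp x (Finsupp.single X.e 1) = Finsupp.single x 1 := by
  simp only [mulOp_single, X.mul_e]
  simp only [formalSum, Multiset.insert_eq_cons, Multiset.map_cons, Multiset.map_singleton,
    Multiset.sum_cons, Multiset.sum_singleton]
  module

theorem Commutative.mulOp_comm (hc : X.Commutative) :
    ∀ a ∈ Set.range X.mulOp, ∀ b ∈ Set.range X.mulOp, a * b = b * a := by
  rintro _ ⟨x, rfl⟩ _ ⟨y, rfl⟩
  obtain ⟨z, w, h⟩ := X.exists_mul x y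
  have h1 := mulOp_mul x y h
  rw [hc] at h
  rw [← mulOp_mul y x h, mul_assoc, mul_assoc] at h1
  have h2 : (2 : ℚ) • (X.mulOp x * X.mulOp y) = (2 : ℚ) • (X.mulOp y * X.mulOp x) := by
    rw [two_smul, two_smul, ← two_mul, ← two_mul, h1]
  exact smul_right_injective _ (by norm_num : (2 : ℚ) ≠ 0) h2

/-- Every involutive commutative two-valued group has a model. -/
theorem exists_model (hc : X.Commutative) (hi : X.Involutive) :
    ∃ (R : Type u) (_ : CommRing R) (M : Model T R), M.e = X.e ∧
      ∀ x y z w, X.mul x y = {z, w} ↔ 2 * M x * M y = M z + M w := by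
  let R := Algebra.adjoin ℚ (Set.range X.mulOp)
  have : IsMulCommutative R := Algebra.isMulCommutative_adjoin ℚ hc.mulOp_comm
  let : CommRing R := { (inferInstance : Ring R) with mul_comm := this.is_comm.comm }
  let ε : T → R := fun x => ⟨X.mulOp x, Algebra.subset_adjoin ⟨x, rfl⟩⟩
  let c : T → R →+ ℚ := fun t =>
    { toFun := fun r => r.1 (Finsupp.single X.e 1) t
      map_zero' := rfl
      map_add' := fun a b => rfl }
  have hcε : ∀ x t, c t (ε x) = Finsupp.single x (1 : ℚ) t := fun x t => by
    show X.mulOp x (Finsupp.single X.e 1) t = _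
    rw [mulOp_single_e]
  have hmul : ∀ x y z w, X.mul x y = {z, w} → 2 * ε x * ε y = ε z + ε w := fun x y z w h =>
    Subtype.ext (mulOp_mul x y h)
  have hone : ε X.e = 1 := Subtype.ext mulOp_e
  have hpair : ∀ a b c d, ε a + ε b = ε c + ε d → ({a, b} : Multiset T) = {c, d} := by
    intro a b c' d h
    have h1 := congrArg (c a) h
    have h2 := congrArg (c b) h
    classical
    simp only [map_add, hcε, Finsupp.single_apply] at h1 h2
    have h3 : (a = c' ∧ b = d) ∨ (a = d ∧ b = c') := by grind
    rcases h3 with ⟨rfl, rfl⟩ | ⟨rfl, rfl⟩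
    · rfl
    · exact Multiset.pair_comm _ _
  have hsq : ∀ x, ∃ y, X.mul x x = {X.e, y} := fun x => by
    have h1 := X.e_mem_mul_inv x
    rw [hi] at h1
    obtain ⟨z, w, h⟩ := X.exists_mul x x
    rw [h, Multiset.insert_eq_cons, Multiset.mem_cons, Multiset.mem_singleton] at h1
    rcases h1 with h1 | h1
    · exact ⟨w, by rw [h, h1]⟩
    · exact ⟨z, by rw [h, h1, Multiset.pair_comm]⟩
  let M : Model T R :=
    { ε := ε
      e := X.e
      one := hone
      c := c
      c_self := fun x => by rw [hcε]; simp
      c_ne := fun x y h => by rw [hcε]; exact Finsupp.single_eq_of_ne' h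
      cancel2 := fun a b h => by
        have h1 : (2 : ℚ) • a.1 = (2 : ℚ) • b.1 := by
          rw [two_smul, two_smul]
          have := congrArg Subtype.val h
          rw [two_mul, two_mul] at this
          exact this
        exact Subtype.ext (smul_right_injective _ (by norm_num : (2 : ℚ) ≠ 0) h1)
      mul := fun x y => by
        obtain ⟨z, w, h⟩ := X.exists_mul x y
        exact ⟨z, w, hmul x y z w h⟩
      sq := fun x => by
        obtain ⟨y, h⟩ := hsq x
        exact ⟨y, by rw [hmul x x _ _ h, hone]⟩
      eq_of := fun x y z h => by
        obtain ⟨a, b, h'⟩ := X.exists_mul x y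
        rw [hmul x y a b h', ← hone] at h
        rw [hpair _ _ _ _ h] at h'
        have := X.inv_unique x y (Or.inl (by rw [h']; simp))
        rw [this, hi] }
  refine ⟨R, _, M, rfl, fun x y z w => ⟨hmul x y z w, fun h => ?_⟩⟩
  obtain ⟨a, b, h'⟩ := X.exists_mul x y
  have h1 := hmul x y a b h'
  rw [h']
  exact hpair _ _ _ _ (h1.symm.trans h)

end TwoValuedGroup

namespace TwoValuedGroup

/-- The homomorphism from `ZMod n` sending `1` to `x`. -/
def zmodHom {A : Type*} [AddCommGroup A] (n : ℕ) (x : A) (h : (n : ℤ) • x = 0) : ZMod n →+ A :=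
  ZMod.lift n ⟨zmultiplesHom A x, by simpa using h⟩

theorem zmodHom_one {A : Type*} [AddCommGroup A] (n : ℕ) (x : A) (h : (n : ℤ) • x = 0) :
    zmodHom n x h 1 = x := by
  have := ZMod.lift_coe n ⟨zmultiplesHom A x, by simpa using h⟩ 1
  simpa [zmodHom] using this

theorem zmodHom_intCast {A : Type*} [AddCommGroup A] (n : ℕ) (x : A) (h : (n : ℤ) • x = 0)
    (k : ℤ) : zmodHom n x h k = k • x := by
  rw [← zsmul_one, map_zsmul, zmodHom_one]

/-- The elementary step of the invariant factor decomposition. -/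
theorem zmod_prod_equiv (a b : ℕ) :
    Nonempty (ZMod a × ZMod b ≃+ ZMod (a.gcd b) × ZMod (a.lcm b)) := by
  obtain ⟨a', ha⟩ := Nat.gcd_dvd_left a b
  obtain ⟨b', hb⟩ := Nat.gcd_dvd_right a b
  have hbez := Nat.gcd_eq_gcd_ab a b
  have hlcm := Nat.gcd_mul_lcm a b
  set g := a.gcd b with hg
  set l := a.lcm b with hl
  set p := Nat.gcdA a b
  set r := Nat.gcdB a b
  rcases Nat.eq_zero_or_pos g with h0 | h0
  · rw [h0] at ha hb
    rw [zero_mul] at ha hb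
    have hl0 : l = 0 := by rw [hl, ha, hb]; rfl
    rw [h0, hl0, ha, hb]
    exact ⟨AddEquiv.refl _⟩
  have h0' : (g : ℤ) ≠ 0 := by exact_mod_cast h0.ne'
  have haZ : (a : ℤ) = g * a' := by exact_mod_cast ha
  have hbZ : (b : ℤ) = g * b' := by exact_mod_cast hb
  have hdet : p * a' + r * b' = 1 := by
    apply mul_left_cancel₀ h0'
    linear_combination p * haZ.symm + r * hbZ.symm + hbez.symm
  have hlZ : (l : ℤ) = g * a' * b' := by
    apply mul_left_cancel₀ h0'
    have : (g : ℤ) * l = a * b := by exact_mod_cast hlcm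
    rw [this, haZ, hbZ]; ring
  have hz : ∀ (n : ℕ) (k m : ℤ), k = n * m → (k : ZMod n) = 0 := by
    rintro n k m rfl; simp
  let f : ZMod a × ZMod b →+ ZMod g × ZMod l :=
    (zmodHom a ((1 : ZMod g), ((-(r * b') : ℤ) : ZMod l)) (by
      ext
      · rw [Prod.smul_fst, Prod.fst_zero, zsmul_one]
        exact hz _ _ a' haZ
      · rw [Prod.smul_snd, Prod.snd_zero, zsmul_eq_mul, ← Int.cast_mul]
        exact hz _ _ (-r) (by rw [haZ, hlZ]; ring))).coprod
    (zmodHom b ((1 : ZMod g), ((p * a' : ℤ) : ZMod l)) (by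
      ext
      · rw [Prod.smul_fst, Prod.fst_zero, zsmul_one]
        exact hz _ _ b' hbZ
      · rw [Prod.smul_snd, Prod.snd_zero, zsmul_eq_mul, ← Int.cast_mul]
        exact hz _ _ p (by rw [hbZ, hlZ]; ring)))
  let f' : ZMod g × ZMod l →+ ZMod a × ZMod b :=
    (zmodHom g (((p * a' : ℤ) : ZMod a), ((r * b' : ℤ) : ZMod b)) (by
      ext
      · rw [Prod.smul_fst, Prod.fst_zero, zsmul_eq_mul, ← Int.cast_mul]
        exact hz _ _ p (by rw [haZ]; ring)
      · rw [Prod.smul_snd, Prod.snd_zero, zsmul_eq_mul, ← Int.cast_mul]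
        exact hz _ _ r (by rw [hbZ]; ring))).coprod
    (zmodHom l ((-1 : ZMod a), (1 : ZMod b)) (by
      ext
      · rw [Prod.smul_fst, Prod.fst_zero, zsmul_eq_mul, mul_neg_one, ← Int.cast_neg]
        exact hz _ _ (-b') (by rw [haZ, hlZ]; ring)
      · rw [Prod.smul_snd, Prod.snd_zero, zsmul_one]
        exact hz _ _ a' (by rw [hbZ, hlZ]; ring)))
  have hf : ∀ x y : ℤ, f (x, y) = (((x + y : ℤ) : ZMod g),
      ((-(r * b') * x + p * a' * y : ℤ) : ZMod l)) := fun x y => by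
    simp only [f, AddMonoidHom.coprod_apply, zmodHom_intCast]
    ext <;> simp [mul_comm]
  have hf' : ∀ x y : ℤ, f' (x, y) = (((p * a' * x - y : ℤ) : ZMod a),
      ((r * b' * x + y : ℤ) : ZMod b)) := fun x y => by
    simp only [f', AddMonoidHom.coprod_apply, zmodHom_intCast]
    ext <;> simp [mul_comm, sub_eq_add_neg]
  refine ⟨{ f with invFun := f', left_inv := ?_, right_inv := ?_ }⟩
  · rintro ⟨x, y⟩
    obtain ⟨x, rfl⟩ := ZMod.intCast_surjective x
    obtain ⟨y, rfl⟩ := ZMod.intCast_surjective y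
    show f' (f (x, y)) = _
    rw [hf, hf']
    ext
    · show ((_ : ℤ) : ZMod a) = _
      congr 1
      linear_combination x * hdet
    · show ((_ : ℤ) : ZMod b) = _
      congr 1
      linear_combination y * hdet
  · rintro ⟨x, y⟩
    obtain ⟨x, rfl⟩ := ZMod.intCast_surjective x
    obtain ⟨y, rfl⟩ := ZMod.intCast_surjective y
    show f (f' (x, y)) = _
    rw [hf', hf]
    ext
    · show ((_ : ℤ) : ZMod g) = _
      congr 1
      linear_combination x * hdet
    · show ((_ : ℤ) : ZMod l) = _
      congr 1
      linear_combination y * hdet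

theorem exists_cons_chain {k : ℕ} {d : Fin k → ℕ} (hd : ValidLabel (.princ k d)) {g : ℕ}
    (hg : ∀ i, g ∣ d i) : ∃ (k' : ℕ) (d' : Fin k' → ℕ), ValidLabel (.princ k' d') ∧
      (∀ n, n ∣ g → ∀ i, n ∣ d' i) ∧
      Nonempty ((ZMod g × ∀ i, ZMod (d i)) ≃+ ∀ i, ZMod (d' i)) := by
  by_cases h1 : g = 1
  · subst h1
    exact ⟨k, d, hd, fun n hn i => hn.trans (hg i), ⟨AddEquiv.uniqueProd⟩⟩
  · refine ⟨k + 1, Fin.cons g d, ⟨?_, ?_⟩, ?_,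
      ⟨(Fin.consLinearEquiv ℤ (fun i => ZMod ((Fin.cons g d : Fin (k + 1) → ℕ) i))).toAddEquiv⟩⟩
    · intro i
      cases i using Fin.cases with
      | zero => simpa using h1
      | succ i => simpa using hd.1 i
    · intro i j hij
      cases i using Fin.cases with
      | zero =>
        cases j using Fin.cases with
        | zero => exact dvd_rfl
        | succ j => simpa using hg j
      | succ i =>
        cases j using Fin.cases with
        | zero => exact absurd hij (by simp)
        | succ j => simpa using hd.2 i j (by simpa using hij)
    · intro n hn i
      cases i using Fin.cases with
      | zero => simpa using hn
      | succ i => simpa using hn.trans (hg i)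

theorem exists_insert_chain {k : ℕ} {d : Fin k → ℕ} (hd : ValidLabel (.princ k d)) (c : ℕ) :
    ∃ (k' : ℕ) (d' : Fin k' → ℕ), ValidLabel (.princ k' d') ∧
      (∀ n, n ∣ c → (∀ i, n ∣ d i) → ∀ i, n ∣ d' i) ∧
      Nonempty ((ZMod c × ∀ i, ZMod (d i)) ≃+ ∀ i, ZMod (d' i)) := by
  induction k generalizing c with
  | zero =>
    obtain ⟨k', d', h1, h2, h3⟩ := exists_cons_chain hd (g := c) (fun i => i.elim0)
    exact ⟨k', d', h1, fun n hn _ => h2 n hn, h3⟩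
  | succ k ih =>
    have hd' : ValidLabel (.princ k (fun i => d i.succ)) :=
      ⟨fun i => hd.1 _, fun i j hij => hd.2 _ _ (by simpa using hij)⟩
    obtain ⟨k₁, d₁, h1, h2, ⟨e1⟩⟩ := ih hd' (c.lcm (d 0))
    obtain ⟨k₂, d₂, h3, h4, ⟨e2⟩⟩ := exists_cons_chain h1 (g := c.gcd (d 0))
      (h2 _ ((Nat.gcd_dvd_left _ _).trans (Nat.dvd_lcm_left _ _))
        (fun i => (Nat.gcd_dvd_right _ _).trans (hd.2 _ _ (Fin.zero_le _))))
    obtain ⟨e3⟩ := zmod_prod_equiv c (d 0)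
    let e4 := (Fin.consLinearEquiv ℤ (fun i => ZMod (d i))).toAddEquiv
    refine ⟨k₂, d₂, h3, fun n hn hn' => h4 n (Nat.dvd_gcd hn (hn' 0)), ⟨?_⟩⟩
    exact ((AddEquiv.refl _).prodCongr e4.symm).trans <| AddEquiv.prodAssoc.symm.trans <|
      (e3.prodCongr (AddEquiv.refl _)).trans <| AddEquiv.prodAssoc.trans <|
      ((AddEquiv.refl _).prodCongr e1).trans e2

theorem exists_chain (ι : Type) [Fintype ι] (f : ι → ℕ) :
    ∃ (k : ℕ) (d : Fin k → ℕ), ValidLabel (.princ k d) ∧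
      Nonempty ((∀ i, ZMod (f i)) ≃+ ∀ i, ZMod (d i)) := by
  have H : ∀ (n : ℕ) (f : Fin n → ℕ), ∃ (k : ℕ) (d : Fin k → ℕ), ValidLabel (.princ k d) ∧
      Nonempty ((∀ i, ZMod (f i)) ≃+ ∀ i, ZMod (d i)) := by
    intro n
    induction n with
    | zero => exact fun f => ⟨0, f, ⟨fun i => i.elim0, fun i => i.elim0⟩, ⟨AddEquiv.refl _⟩⟩
    | succ n ih =>
      intro f
      obtain ⟨k, d, h1, ⟨e1⟩⟩ := ih (fun i => f i.succ)
      obtain ⟨k', d', h2, -, ⟨e2⟩⟩ := exists_insert_chain h1 (f 0)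
      exact ⟨k', d', h2, ⟨(Fin.consLinearEquiv ℤ (fun i => ZMod (f i))).toAddEquiv.symm.trans <|
        ((AddEquiv.refl _).prodCongr e1).trans e2⟩⟩
  obtain ⟨k, d, h1, ⟨e1⟩⟩ := H (Fintype.card ι) (fun i => f ((Fintype.equivFin ι).symm i))
  exact ⟨k, d, h1, ⟨(LinearEquiv.piCongrLeft ℤ (fun i => ZMod (f i))
    (Fintype.equivFin ι).symm).symm.toAddEquiv.trans e1⟩⟩

/-- The invariant factor decomposition of finitely generated abelian groups. -/
theorem exists_invariant_factors (G : Type*) [AddCommGroup G] [AddGroup.FG G] :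
    ∃ (k : ℕ) (d : Fin k → ℕ), ValidLabel (.princ k d) ∧
      Nonempty (G ≃+ ∀ i, ZMod (d i)) := by
  obtain ⟨n, ι, _, p, -, e, ⟨E⟩⟩ := AddCommGroup.equiv_free_prod_directSum_zmod G
  classical
  obtain ⟨k, d, h, ⟨E'⟩⟩ := exists_chain (Fin n ⊕ ι) (Sum.elim (fun _ => 0) (fun i => p i ^ e i))
  refine ⟨k, d, h, ⟨E.trans <| AddEquiv.trans ?_ E'⟩⟩
  let E1 : (Fin n →₀ ℤ) ≃+ (Fin n → ZMod 0) :=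
    (Finsupp.linearEquivFunOnFinite ℤ ℤ (Fin n)).toAddEquiv
  let E2 := DirectSum.addEquivProd (fun i => ZMod (p i ^ e i))
  exact (E1.prodCongr E2).trans (LinearEquiv.sumPiEquivProdPi ℤ (Fin n) ι (fun i =>
    ZMod ((Sum.elim (fun _ => 0) (fun i => p i ^ e i) : Fin n ⊕ ι → ℕ) i))).symm.toAddEquiv

end TwoValuedGroup

namespace TwoValuedGroup

variable {T : Type u} {R : Type v} [CommRing R]

/-- `M` is a model of the two-valued group `X`. -/
structure Models (M : Model T R) (X : TwoValuedGroup T) : Prop where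
  e_eq : M.e = X.e
  mul_iff : ∀ x y z w, X.mul x y = {z, w} ↔ 2 * M x * M y = M z + M w

namespace Model

/-- A subset closed under multiplication. -/
def Closed (M : Model T R) (Y : Set T) : Prop :=
  ∀ y₁ ∈ Y, ∀ y₂ ∈ Y, ∀ z, M.Mem z y₁ y₂ → z ∈ Y

/-- The set `S` generates the model. -/
def Gen (M : Model T R) (S : Set T) : Prop :=
  ∀ Y, M.Closed Y → S ⊆ Y → ∀ t, t ∈ Y

end Model

variable {M : Model T R} {X : TwoValuedGroup T}

theorem Models.mem_iff (h : Models M X) {x y z : T} : z ∈ X.mul x y ↔ M.Mem z x y := by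
  obtain ⟨u, v, huv⟩ := X.exists_mul x y
  have h1 := (h.mul_iff _ _ _ _).1 huv
  rw [huv, Multiset.insert_eq_cons, Multiset.mem_cons, Multiset.mem_singleton]
  constructor
  · rintro (rfl | rfl)
    exacts [M.mem_left h1, M.mem_right h1]
  · exact fun hz => hz.eq h1

theorem Models.gen (h : Models M X) {S : Set T} (hS : X.Generates S) : M.Gen S := by
  intro Y hY hSY t
  rw [hS Y (fun y₁ h₁ y₂ h₂ z hz => hY y₁ h₁ y₂ h₂ z (h.mem_iff.1 hz)) hSY]
  trivial

namespace Model

theorem DAl.closed_range {G : Type w} [AddCommGroup G] {π : G → T} (D : DAl M π)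
    (U : AddSubgroup G) : M.Closed (π '' U) := by
  rintro _ ⟨a, ha, rfl⟩ _ ⟨b, hb, rfl⟩ z hz
  rcases hz.eq (D.mul a b) with rfl | rfl
  · exact ⟨_, U.add_mem ha hb, rfl⟩
  · exact ⟨_, U.sub_mem ha hb, rfl⟩

theorem DAl.surjective {G : Type w} [AddCommGroup G] {π : G → T} (D : DAl M π) {S : Set T}
    (hS : M.Gen S) (h : ∀ s ∈ S, ∃ a, π a = s) : Function.Surjective π := fun t => by
  obtain ⟨a, -, ha⟩ := hS _ (D.closed_range ⊤) (fun s hs => by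
    obtain ⟨a, ha⟩ := h s hs
    exact ⟨a, trivial, ha⟩) t
  exact ⟨a, ha⟩

theorem DAl.fg {G : Type w} [AddCommGroup G] {π : G → T} (D : DAl M π)
    (hk : ∀ a, π a = M.e → a = 0) (hπ : Function.Surjective π) {S : Set T} (hf : S.Finite)
    (hS : M.Gen S) : AddGroup.FG G := by
  choose σ hσ using hπ
  rw [AddGroup.fg_iff]
  refine ⟨σ '' S, ?_, hf.image _⟩
  rw [AddSubgroup.eq_top_iff']
  intro a
  obtain ⟨b, hb, hab⟩ := hS _ (D.closed_range (AddSubgroup.closure (σ '' S))) (fun s hs =>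
    ⟨σ s, AddSubgroup.subset_closure ⟨s, hs, rfl⟩, hσ s⟩) (π a)
  rcases D.eq_or hk hab with rfl | rfl
  · exact hb
  · simpa using hb

end Model

theorem Models.princ_of_dAl (h : Models M X) (hi : X.Involutive) {G : Type w} [AddCommGroup G]
    {π : G → T} (D : Model.DAl M π) (hk : ∀ a, π a = M.e → a = 0) (hπ : Function.Surjective π)
    {S : Set T} (hf : S.Finite) (hS : M.Gen S) :
    ∃ lab, ValidLabel lab ∧ Realizes X lab := by
  have := D.fg hk hπ hf hS
  obtain ⟨k, d, hd, ⟨E⟩⟩ := exists_invariant_factors G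
  let φ : (∀ i, Multiplicative (ZMod (d i))) → G := fun a => E.symm (fun i => (a i).toAdd)
  have hφm : ∀ a b, φ (a * b) = φ a + φ b := fun a b => map_add E.symm _ _
  have hφi : ∀ a, φ a⁻¹ = -φ a := fun a => map_neg E.symm _
  have hφ : Function.Injective φ := fun a b hab => E.symm.injective hab
  refine ⟨.princ k d, hd, fun a => π (φ a), ?_, ?_, ?_, ?_, ?_, ?_⟩
  · intro t
    obtain ⟨g, rfl⟩ := hπ t
    exact ⟨fun i => .ofAdd (E g i), by
      show π (E.symm (E g)) = _
      rw [E.symm_apply_apply]⟩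
  · rw [← h.e_eq, ← D.zero]
    exact congrArg π (map_zero E.symm)
  · intro a
    beta_reduce
    rw [hφi, D.neg]
  · intro a b hab
    rcases D.eq_or hk hab.symm with h1 | h1
    · exact Or.inl (hφ h1)
    · exact Or.inr (hφ (by rw [h1, hφi]))
  · intro a b
    beta_reduce
    rw [h.mul_iff, D.mul, hφm, hφm, hφi, sub_eq_add_neg]
  · intro a
    beta_reduce
    rw [hi, hφi, D.neg]

end TwoValuedGroup

namespace TwoValuedGroup
namespace Model

variable {T : Type u} {R : Type v} [CommRing R] {M : Model T R}

/-- In a special pair all squares coincide and square to the identity. -/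
theorem special_q {x y z : T} (h : M x * M y = M z) (hx : ¬ M.B x) (hy : ¬ M.B y) :
    M.B (M.q x) ∧ M.q y = M.q x ∧ M.q z = M.q x := by
  obtain ⟨r, r', hr⟩ := M.mul (M.q x) (M.q y)
  have hk : 2 * M z * M z = M M.e + M (M.q z) := by rw [M.q_spec, M.one]
  have h2 : 2 * M x * M y = M z + M z := by linear_combination 2 * h
  have H := M.square_identity h2 hr hk
  have hx' : M.q x ≠ M.e := hx
  have hy' : M.q y ≠ M.e := hy
  have hre : r = M.e ∧ r' = M.e := by
    have h1 := congrArg (M.c M.e) H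
    simp only [map_add, c_eps, c_two] at h1
    grind
  obtain ⟨rfl, rfl⟩ := hre
  have hq := M.mul_one_of hr
  rw [← hq] at hr
  have hB : M.B (M.q x) := by
    rw [B_iff]; exact M.cancel2 _ _ (by rw [← mul_assoc, hr, M.one]; ring)
  refine ⟨hB, hq.symm, ?_⟩
  rw [← hq] at H
  have h1 := congrArg (M.c (M.q z)) H
  simp only [map_add, c_eps, c_two] at h1
  grind

/-- The data of an element `w` whose square is not `e` or the square `s` of an element `x` with
`s` squaring to the identity. -/
structure Exceptional (M : Model T R) (s w : T) : Prop where
  B_s : M.B s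
  s_ne : s ≠ M.e
  q_ne_e : M.q w ≠ M.e
  q_ne_s : M.q w ≠ s

namespace Exceptional

variable {s w x p : T}

theorem dot_ne_e (E : Exceptional M s w) : M.dot s (M.q w) ≠ M.e := fun h =>
  E.q_ne_s (M.dot_inj E.B_s (by rw [h, M.dot_self E.B_s]))

theorem dot_ne_s (E : Exceptional M s w) : M.dot s (M.q w) ≠ s := fun h =>
  E.q_ne_e (M.dot_inj E.B_s (by rw [h, M.dot_e']))

theorem cases (E : Exceptional M s w) (hx : M.q x = s) (hp : M.Mem p x w) :
    (M.q p = M.q w ∨ M.q p = M.dot s (M.q w)) ∧ 2 * M x * M w = M p + M s * M p := by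
  have hxB : ¬ M.B x := fun h => E.s_ne (hx.symm.trans h)
  have hwB : ¬ M.B w := E.q_ne_e
  obtain ⟨p', h⟩ := id hp
  have hpp : p ≠ p' := by
    rintro rfl
    have h' : M x * M w = M p := M.cancel2 _ _ (by linear_combination h)
    exact E.q_ne_s (hx ▸ (special_q h' hxB hwB).2.1)
  have hr : 2 * M (M.q x) * M (M.q w) = M (M.dot s (M.q w)) + M (M.dot s (M.q w)) := by
    rw [hx, M.dot_spec E.B_s]; ring
  obtain ⟨k, k', hk⟩ := M.mul p p'
  have H := M.square_identity h hr hk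
  have key : M.Mem s p p' → 2 * M x * M w = M p + M s * M p := fun hs => by
    rw [h, M.B_mem E.B_s hs, M.dot_spec E.B_s]
  rcases M.comb_cases H with ⟨h1, h2⟩ | ⟨-, h1, h2, ⟨h3, h4⟩ | ⟨h3, h4⟩⟩
  · refine ⟨Or.inr ?_, key ⟨M.q w, by rw [hk, h2, hx]⟩⟩
    rcases M.pair h1 with h1 | h1
    exacts [h1.1.symm, h1.2.symm]
  · exfalso
    obtain ⟨w', hw⟩ := hp.rot
    obtain ⟨m, m', hm⟩ := M.mul w w'
    have hr' : 2 * M (M.q x) * M (M.q p) = M M.e + M M.e := by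
      rw [h3, hx, M.one]; linear_combination 2 * M.B_iff.1 E.B_s
    have H' := M.square_identity hw hr' hm
    have h5 := congrArg (M.c (M.q w)) H'
    simp only [map_add, c_eps, c_two] at h5
    have e1 := E.q_ne_e
    have e2 := E.q_ne_s
    rw [h3, hx] at h5
    grind
  · exact ⟨Or.inl h3, key ⟨M.dot s (M.q w), by rw [hk, h4, hx]⟩⟩

/-- The square of `w` has square `s` as soon as a suitable product exists. -/
theorem q_q_of_mem (E : Exceptional M s w) {p r z : T}
    (hsq : 2 * M (M.q p) * M (M.q r) = 1 + M (M.q (M.q w))) (hpr : M.q p = M.q r)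
    (hpe : M.q p ≠ M.e) (hps : M.q p ≠ s) (hz : M.q z = s) (h : M.Mem z p r) :
    M.q (M.q w) = s := by
  obtain ⟨k, h⟩ := h
  have hzk : z ≠ k := by
    rintro rfl
    refine hps (hz ▸ (special_q (M.cancel2 _ _ (by linear_combination h)) hpe
      (hpr ▸ hpe : M.q r ≠ M.e)).2.2.symm)
  obtain ⟨m, m', hm⟩ := M.mul z k
  obtain ⟨hm1, hm2⟩ := M.ne_e_of_ne hm hzk
  have H := M.square_identity h (by rw [hsq, ← M.one]) hm
  have h1 := congrArg (M.c M.e) H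
  have h2 := congrArg (M.c s) H
  rw [← hpr, hz] at h1 h2
  have e1 := E.s_ne
  simp only [map_add, c_eps, c_two] at h1 h2
  grind

theorem exists_dot (E : Exceptional M s w) (hx : M.q x = s) (hq : M.q (M.q w) = s) :
    ∃ b, M.B b ∧ M.q w = M.dot b x := by
  obtain ⟨p, _, h0⟩ := M.mul x w
  have hp := M.mem_left h0
  have hxB : ¬ M.B x := fun h => E.s_ne (hx.symm.trans h)
  have hwB : ¬ M.B w := E.q_ne_e
  obtain ⟨x', h⟩ := hp.comm.rot
  have hpq := (E.cases hx hp).1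
  have hpB : M.q p ≠ M.e := by
    rcases hpq with h1 | h1 <;> rw [h1]
    exacts [E.q_ne_e, E.dot_ne_e]
  have hxx : x ≠ x' := by
    rintro rfl
    exact E.q_ne_s (hx ▸ (special_q (M.cancel2 _ _ (by linear_combination h)) hwB
      hpB).2.2.symm)
  obtain ⟨m, m', hm⟩ := M.mul x x'
  obtain ⟨hm1, hm2⟩ := M.ne_e_of_ne hm hxx
  have hq2 := M.q_spec (M.q w)
  have hr : ∃ r r', 2 * M (M.q w) * M (M.q p) = M r + M r' ∧ (r = M.e ∨ r' = M.e) := by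
    rcases hpq with h1 | h1 <;> rw [h1]
    · exact ⟨M.e, M.q (M.q w), by rw [hq2, M.one], Or.inl rfl⟩
    · refine ⟨s, M.e, ?_, Or.inr rfl⟩
      rw [M.dot_spec E.B_s, M.one]
      rw [hq] at hq2
      linear_combination M s * hq2 + M.B_iff.1 E.B_s
  obtain ⟨r, r', hr, hre⟩ := hr
  have H := M.square_identity h hr hm
  have hx' : M.B x' := by
    have h1 := congrArg (M.c M.e) H
    rw [hx] at h1
    have e1 := E.s_ne
    have e2 := E.q_ne_e
    simp only [map_add, c_eps, c_two] at h1
    show M.q x' = M.e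
    grind
  have hpw := M.B_mem hx' (M.mem_right h)
  refine ⟨x', hx', ?_⟩
  have h1 : M (M.q w) * M x' = M x := by
    have h2 := M.dot_spec hx' w
    rw [← hpw] at h2
    rw [h2] at h
    linear_combination h - M x' * M.q_spec w
  have h2 : M x = M (M.dot x' (M.q w)) := by rw [M.dot_spec hx', ← h1]; ring
  rw [M.inj h2, M.dot_dot_cancel hx']

end Exceptional

/-- A model with a special pair has exactly one nontrivial square. -/
theorem special_squares {x y z : T} (h : M x * M y = M z) (hx : ¬ M.B x) (hy : ¬ M.B y) (w : T) :
    M.q w = M.e ∨ M.q w = M.q x := by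
  obtain ⟨hs, hqy, hqz⟩ := special_q h hx hy
  by_contra hcon
  push Not at hcon
  have E : Exceptional M (M.q x) w := ⟨hs, hx, hcon.1, hcon.2⟩
  have hqq : M.q (M.q w) = M.q x := by
    obtain ⟨p, _, h0⟩ := M.mul x w
    have hp := M.mem_left h0
    obtain ⟨r, _, h0⟩ := M.mul y w
    have hr := M.mem_left h0
    obtain ⟨hpq, hpw⟩ := E.cases rfl hp
    obtain ⟨hrq, hrw⟩ := E.cases hqy hr
    rcases hpq with hpq | hpq
    · exact E.q_q_of_mem (p := w) (r := p) (z := x) (by rw [hpq, M.q_spec]) hpq.symm E.q_ne_e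
        E.q_ne_s rfl hp.comm.rot
    rcases hrq with hrq | hrq
    · exact E.q_q_of_mem (p := w) (r := r) (z := y) (by rw [hrq, M.q_spec]) hrq.symm E.q_ne_e
        E.q_ne_s hqy hr.comm.rot
    have hss := M.B_iff.1 hs
    refine E.q_q_of_mem (p := p) (r := r) (z := z) ?_ (hpq.trans hrq.symm)
      (by rw [hpq]; exact E.dot_ne_e) (by rw [hpq]; exact E.dot_ne_s) hqz ?_
    · rw [hpq, hrq, M.dot_spec hs]
      linear_combination M.q_spec (M.q w) + 2 * M (M.q w) * M (M.q w) * hss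
    · obtain ⟨k, k', hk⟩ := M.mul p r
      obtain ⟨l, l', hl⟩ := M.mul z (M.q w)
      have hsz : M (M.q x) * M z = M z := by
        rw [← M.dot_spec hs, ← hqz, M.q_dot_self (hqz ▸ hs)]
      have H : M z + M z + M l + M l' =
          M k + M k' + M (M.dot (M.q x) k) + M (M.dot (M.q x) k') := by
        rw [M.dot_spec hs, M.dot_spec hs]
        apply M.cancel2
        linear_combination (-2) * hl - 4 * M z * M.q_spec w - 8 * M w * M w * h
          + 4 * M y * M w * hpw + 2 * (M p + M (M.q x) * M p) * hrw + 2 * M p * M r * hss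
          + 2 * (1 + M (M.q x)) * hk
      have hz : M.dot (M.q x) z = z := M.inj (by rw [M.dot_spec hs, hsz])
      have hz' : ∀ t, z = M.dot (M.q x) t → z = t := fun t ht =>
        M.dot_inj hs (hz.trans ht)
      rcases M.mem4 H with h1 | h1 | h1 | h1
      · exact h1 ▸ M.mem_left hk
      · exact h1 ▸ M.mem_right hk
      · exact hz' _ h1 ▸ M.mem_left hk
      · exact hz' _ h1 ▸ M.mem_right hk
  obtain ⟨b, hb, h1⟩ := E.exists_dot rfl hqq
  obtain ⟨c, hc, h2⟩ := E.exists_dot hqy hqq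
  have h3 : M.dot (M.dot b c) x = y := by
    rw [M.dot_comm b c hb hc, M.dot_assoc hc hb, ← h1, h2, M.dot_dot_cancel hc]
  have hbc := M.B_dot hb hc
  apply hx
  have h4 : M z + M z = M (M.dot b c) + M (M.dot (M.dot b c) (M.q x)) := by
    rw [← h, ← h3, M.dot_spec hbc, M.dot_spec hbc]
    linear_combination M (M.dot b c) * M.q_spec x
  have h5 : z = M.dot b c := by rcases M.pair h4 with h | h <;> tauto
  rw [B, ← hqz, h5]
  exact hbc

end Model
end TwoValuedGroup

namespace TwoValuedGroup

/-- Coordinates on a complement of a subgroup of a finite Boolean group. -/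
theorem exists_complement {H : Type w} [AddCommGroup H] [Finite H] (hH : ∀ x : H, x + x = 0)
    (K : AddSubgroup H) : ∃ (n : ℕ) (φ : C2vec n → H), (∀ a b, φ (a * b) = φ a + φ b) ∧
      (∀ v, φ v ∈ K → v = 1) ∧ ∀ h, ∃ k ∈ K, ∃ v, h = k + φ v := by
  let _ : Module (ZMod 2) H := AddCommGroup.zmodModule (fun x => by rw [two_nsmul, hH])
  let K' : Submodule (ZMod 2) H := AddSubgroup.toZModSubmodule 2 K
  obtain ⟨V, hV⟩ := Submodule.exists_isCompl K'
  let n := Module.finrank (ZMod 2) V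
  have e : (Fin n → ZMod 2) ≃ₗ[ZMod 2] V := LinearEquiv.ofFinrankEq _ _ (by simp [n])
  let φ : C2vec n → H := fun a => (e (fun i => (a i).toAdd) : V)
  have hφ : ∀ a b, φ (a * b) = φ a + φ b := fun a b => by
    have h1 : e ((fun i => (a i).toAdd) + (fun i => (b i).toAdd)) = _ := map_add e _ _
    exact congrArg Subtype.val h1
  refine ⟨n, φ, hφ, fun v hv => ?_, fun h => ?_⟩
  · have h1 : e (fun i => (v i).toAdd) = 0 :=
      Subtype.ext (Submodule.disjoint_def.1 hV.disjoint _ hv (Subtype.mem _))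
    have h2 := (LinearEquiv.map_eq_zero_iff e).1 h1
    funext i
    exact congrFun h2 i
  · have h1 : h ∈ K' ⊔ V := by rw [hV.sup_eq_top]; trivial
    obtain ⟨k, hk, v, hv, rfl⟩ := Submodule.mem_sup.1 h1
    refine ⟨k, hk, fun i => .ofAdd (e.symm ⟨v, hv⟩ i), ?_⟩
    show k + v = k + (e (e.symm ⟨v, hv⟩) : V)
    rw [e.apply_symm_apply]

theorem c2vec_mul_self {n : ℕ} (a : C2vec n) : a * a = 1 := by
  funext i
  have : ∀ x : Multiplicative (ZMod 2), x * x = 1 := by decide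
  exact this _

theorem c2vec_mul_eq_one {n : ℕ} {a b : C2vec n} : a * b = 1 ↔ a = b := by
  constructor
  · intro h
    rw [← mul_one a, ← c2vec_mul_self b, ← mul_assoc, h, one_mul]
  · rintro rfl
    exact c2vec_mul_self a

theorem hom_one {n : ℕ} {H : Type w} [AddCommGroup H] {φ : C2vec n → H}
    (h : ∀ a b, φ (a * b) = φ a + φ b) : φ 1 = 0 := by
  have := h 1 1
  rw [mul_one] at this
  exact left_eq_add.1 this

theorem finite_of_fg_bool {H : Type w} [AddCommGroup H] (hH : ∀ x : H, x + x = 0)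
    (hf : AddGroup.FG H) : Finite H := by
  apply AddCommGroup.finite_of_fg_isAddTorsion
  intro x
  rw [isOfFinAddOrder_iff_nsmul_eq_zero]
  exact ⟨2, by norm_num, by rw [two_nsmul, hH]⟩

namespace Model

variable {T : Type u} {R : Type v} [CommRing R] {M : Model T R}

/-- All squares are trivial or equal to `s`. -/
structure OneSquare (M : Model T R) (s : T) : Prop where
  B_s : M.B s
  s_ne : s ≠ M.e
  q_eq : ∀ w, M.q w = M.e ∨ M.q w = s

namespace OneSquare

variable {s : T}

theorem dot_eq_self (O : OneSquare M s) {x : T} (hx : ¬ M.B x) : M.dot s x = x := by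
  have h1 : M.q x = s := (O.q_eq x).resolve_left hx
  have := M.q_dot_self (x := x) (by rw [h1]; exact O.B_s)
  rwa [h1] at this

theorem mul_eq (O : OneSquare M s) {x y z w : T} (h : 2 * M x * M y = M z + M w) :
    w = z ∨ (M.B z ∧ w = M.dot s z) := by
  by_cases hx : M.B x
  · left
    rw [M.mem_B hx (M.mem_left h), M.mem_B hx (M.mem_right h)]
  by_cases hy : M.B y
  · left
    rw [M.mem_B hy (M.mem_left h).comm, M.mem_B hy (M.mem_right h).comm]
  have hx' := (O.q_eq x).resolve_left hx
  have hy' := (O.q_eq y).resolve_left hy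
  by_cases hzw : z = w
  · exact Or.inl hzw.symm
  right
  obtain ⟨k, k', hk⟩ := M.mul z w
  obtain ⟨hk1, hk2⟩ := M.ne_e_of_ne hk hzw
  have hr : 2 * M (M.q x) * M (M.q y) = M M.e + M M.e := by
    rw [hx', hy', M.one]; linear_combination 2 * M.B_iff.1 O.B_s
  have H := M.square_identity h hr hk
  rw [hx', hy'] at H
  have h1 := congrArg (M.c M.e) H
  have e1 := O.s_ne
  simp only [map_add, c_eps, c_two] at h1
  have hz : M.q z = M.e := by grind
  have hw : M.q w = M.e := by grind
  refine ⟨hz, ?_⟩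
  have h2 := congrArg (M.c k) H
  rw [hz, hw] at h2
  simp only [map_add, c_eps, c_two] at h2
  have hks : s = k := by grind
  exact M.B_mem O.B_s ⟨k', by rw [hks, hk]⟩

/-- The multiple by `1 + s`. -/
def N (M : Model T R) (s x : T) : R := (1 + M s) * M x

theorem N_mul (O : OneSquare M s) {x y z : T} (h : M.Mem z x y) :
    N M s x * M y = N M s z := by
  obtain ⟨w, h⟩ := h
  apply M.cancel2
  rcases O.mul_eq h with rfl | ⟨-, rfl⟩
  · rw [N, N]; linear_combination (1 + M s) * h
  · rw [M.dot_spec O.B_s] at h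
    rw [N, N]; linear_combination (1 + M s) * h + M z * M.B_iff.1 O.B_s

theorem N_eq_iff (O : OneSquare M s) {x y : T} :
    N M s x = N M s y ↔ x = y ∨ x = M.dot s y := by
  have h : ∀ x, N M s x = M x + M (M.dot s x) := fun x => by
    rw [N, M.dot_spec O.B_s]; ring
  constructor
  · intro h1
    rw [h, h] at h1
    rcases M.pair h1 with h1 | h1
    exacts [Or.inl h1.1, Or.inr h1.1]
  · rintro (rfl | rfl)
    · rfl
    · rw [h, h, M.dot_dot_cancel O.B_s, add_comm]

/-- Identification of elements differing by `s`. -/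
def setoid (M : Model T R) (s : T) : Setoid T where
  r x y := N M s x = N M s y
  iseqv := ⟨fun _ => rfl, fun h => h.symm, fun h h' => h.trans h'⟩

/-- The quotient by `s`. -/
def Quo (_O : OneSquare M s) : Type u := Quotient (setoid M s)

/-- The class of an element. -/
def cl (O : OneSquare M s) (x : T) : O.Quo := Quotient.mk (setoid M s) x

theorem cl_eq (O : OneSquare M s) {x y : T} : O.cl x = O.cl y ↔ N M s x = N M s y :=
  Quotient.eq (r := setoid M s)

theorem cl_surj (O : OneSquare M s) (h : O.Quo) : ∃ x, O.cl x = h := Quotient.exists_rep h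

/-- Some element of the product. -/
noncomputable def pr (M : Model T R) (x y : T) : T := (M.mul x y).choose

theorem pr_mem (x y : T) : M.Mem (pr M x y) x y := (M.mul x y).choose_spec

theorem N_pr (O : OneSquare M s) (x y : T) : N M s (pr M x y) = (1 + M s) * M x * M y :=
  (O.N_mul (pr_mem x y)).symm

noncomputable instance quoAdd (O : OneSquare M s) : Add O.Quo :=
  ⟨Quotient.map₂ (pr M) (fun a b (h : N M s a = N M s b) c d (h' : N M s c = N M s d) => by
    show N M s _ = N M s _
    rw [O.N_pr, O.N_pr]
    rw [N, N] at h h'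
    linear_combination M c * h + M b * h')⟩

instance quoZero (O : OneSquare M s) : Zero O.Quo := ⟨O.cl M.e⟩

instance quoNeg (O : OneSquare M s) : Neg O.Quo := ⟨id⟩

theorem cl_zero (O : OneSquare M s) : O.cl M.e = 0 := rfl

theorem cl_pr (O : OneSquare M s) (x y : T) : O.cl x + O.cl y = O.cl (pr M x y) := rfl

theorem cl_add (O : OneSquare M s) {x y z : T} (h : M.Mem z x y) :
    O.cl x + O.cl y = O.cl z := by
  rw [cl_pr, cl_eq, O.N_pr]
  exact O.N_mul h

theorem cl_add_self (O : OneSquare M s) (x : T) : O.cl x + O.cl x = 0 :=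
  O.cl_add ⟨M.q x, by rw [M.q_spec, M.one]⟩

noncomputable instance quoGroup (O : OneSquare M s) : AddCommGroup O.Quo where
  add_assoc a b c := by
    obtain ⟨x, rfl⟩ := O.cl_surj a
    obtain ⟨y, rfl⟩ := O.cl_surj b
    obtain ⟨z, rfl⟩ := O.cl_surj c
    rw [cl_pr, cl_pr, cl_pr, cl_pr, cl_eq, N_pr O, N_pr O]
    have h1 := O.N_pr x y
    have h2 := O.N_pr y z
    rw [N] at h1 h2
    linear_combination M z * h1 - M x * h2
  zero_add a := by
    obtain ⟨x, rfl⟩ := O.cl_surj a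
    exact O.cl_add (M.mem_of_dot (by rw [M.one, one_mul]))
  add_zero a := by
    obtain ⟨x, rfl⟩ := O.cl_surj a
    exact O.cl_add (M.mem_of_dot (by rw [M.one, mul_one]))
  nsmul := nsmulRec
  zsmul := zsmulRec
  neg_add_cancel a := by
    obtain ⟨x, rfl⟩ := O.cl_surj a
    exact O.cl_add_self x
  add_comm a b := by
    obtain ⟨x, rfl⟩ := O.cl_surj a
    obtain ⟨y, rfl⟩ := O.cl_surj b
    rw [cl_pr, cl_pr, cl_eq, O.N_pr, O.N_pr]
    ring

theorem quo_add_self (O : OneSquare M s) (h : O.Quo) : h + h = 0 := by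
  obtain ⟨x, rfl⟩ := O.cl_surj h
  exact O.cl_add_self x

theorem finite_quo (O : OneSquare M s) {S : Set T} (hf : S.Finite) (hS : M.Gen S) :
    Finite O.Quo := by
  apply finite_of_fg_bool O.quo_add_self
  rw [AddGroup.fg_iff]
  refine ⟨O.cl '' S, ?_, hf.image _⟩
  rw [AddSubgroup.eq_top_iff']
  intro a
  obtain ⟨x, rfl⟩ := O.cl_surj a
  refine hS {x | O.cl x ∈ AddSubgroup.closure (O.cl '' S)} ?_ ?_ x
  · intro y₁ h₁ y₂ h₂ z hz
    show O.cl z ∈ AddSubgroup.closure (O.cl '' S)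
    rw [← O.cl_add hz]
    exact AddSubgroup.add_mem _ h₁ h₂
  · intro y hy
    exact AddSubgroup.subset_closure ⟨y, hy, rfl⟩

theorem finite (O : OneSquare M s) {S : Set T} (hf : S.Finite) (hS : M.Gen S) : Finite T := by
  have := O.finite_quo hf hS
  rw [← Set.finite_univ_iff, ← Set.preimage_univ (f := O.cl)]
  refine Set.Finite.preimage' Set.finite_univ (fun h _ => ?_)
  obtain ⟨y, rfl⟩ := O.cl_surj h
  refine Set.Finite.subset (Set.toFinite {y, M.dot s y}) ?_
  intro x hx
  exact O.N_eq_iff.1 (O.cl_eq.1 hx)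

theorem cl_dot (O : OneSquare M s) {b : T} (hb : M.B b) (x : T) :
    O.cl (M.dot b x) = O.cl b + O.cl x := (O.cl_add (M.mem_dot hb x)).symm

/-- The image of the Boolean elements. -/
def boolImage (O : OneSquare M s) : AddSubgroup O.Quo where
  carrier := O.cl '' {b | M.B b}
  zero_mem' := ⟨M.e, M.B_e, rfl⟩
  add_mem' := by
    rintro _ _ ⟨a, ha, rfl⟩ ⟨b, hb, rfl⟩
    exact ⟨_, M.B_dot ha hb, O.cl_dot ha b⟩
  neg_mem' := fun h => h

theorem mem_boolImage (O : OneSquare M s) {x : T} : O.cl x ∈ O.boolImage ↔ M.B x := by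
  constructor
  · rintro ⟨b, hb, h⟩
    rcases O.N_eq_iff.1 (O.cl_eq.1 h) with rfl | rfl
    · exact hb
    · exact (M.B_dot_iff O.B_s).1 hb
  · exact fun h => ⟨x, h, rfl⟩

theorem eq_of_cl (O : OneSquare M s) {x y : T} (hx : ¬ M.B x) (h : O.cl x = O.cl y) : x = y := by
  rcases O.N_eq_iff.1 (O.cl_eq.1 h) with h | h
  · exact h
  · have hy : ¬ M.B y := fun hy => hx (by rw [h]; exact M.B_dot O.B_s hy)
    rw [h, O.dot_eq_self hy]

end OneSquare

end Model
end TwoValuedGroup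

namespace TwoValuedGroup

variable {T : Type u} {R : Type v} [CommRing R] {M : Model T R} {X : TwoValuedGroup T}

/-- The subgroup generated by a Boolean element. -/
def Model.pairSubgroup (M : Model T R) (s : {b // M.B b}) : AddSubgroup {b // M.B b} where
  carrier := {0, s}
  zero_mem' := Or.inl rfl
  add_mem' := by
    rintro a b (rfl | rfl) (rfl | rfl)
    · exact Or.inl (add_zero _)
    · exact Or.inr (zero_add _)
    · exact Or.inr (add_zero _)
    · exact Or.inl (neg_add_cancel _)
  neg_mem' := fun h => h

theorem Models.spec_of_oneSquare (h : Models M X) (hi : X.Involutive) {s : T}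
    (O : Model.OneSquare M s) (hx : ∃ x, ¬ M.B x) {S : Set T} (hf : S.Finite) (hS : M.Gen S) :
    ∃ lab, ValidLabel lab ∧ Realizes X lab := by
  have := O.finite_quo hf hS
  have := O.finite hf hS
  obtain ⟨n, α, hα, hαK, hαs⟩ := exists_complement O.quo_add_self O.boolImage
  obtain ⟨m, β, hβ, hβK, hβs⟩ := exists_complement (H := {b // M.B b})
    (fun x => neg_add_cancel x) (M.pairSubgroup ⟨s, O.B_s⟩)
  have hn : 1 ≤ n := by
    rw [Nat.one_le_iff_ne_zero]
    rintro rfl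
    obtain ⟨x, hx⟩ := hx
    obtain ⟨k, hk, v, hv⟩ := hαs (O.cl x)
    rw [Subsingleton.elim v 1, hom_one hα, add_zero] at hv
    exact hx (O.mem_boolImage.1 (hv ▸ hk))
  choose rep hrep using O.cl_surj
  classical
  let g : Option (C2vec n) → T := fun u => match u with
    | none => s
    | some v => if v = 1 then M.e else rep (α v)
  have gnone : g none = s := rfl
  have gone : g (some 1) = M.e := if_pos rfl
  have gne : ∀ v, v ≠ 1 → g (some v) = rep (α v) := fun v hv => if_neg hv
  have repB : ∀ v, v ≠ 1 → ¬ M.B (rep (α v)) := fun v hv hB =>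
    hv (hαK v (hrep (α v) ▸ O.mem_boolImage.2 hB))
  have hss := M.B_iff.1 O.B_s
  have hsx : ∀ x, ¬ M.B x → M s * M x = M x := fun x hx => by
    rw [← M.dot_spec O.B_s, O.dot_eq_self hx]
  have hg : ∀ u v, ∃ a b, mulY u v = {a, b} ∧ 2 * M (g u) * M (g v) = M (g a) + M (g b) := by
    intro u v
    rcases u with _ | u <;> rcases v with _ | v
    · refine ⟨_, _, rfl, ?_⟩
      rw [gnone, gone, M.one]; linear_combination 2 * hss
    · by_cases hv : v = 1
      · refine ⟨_, _, if_pos hv, ?_⟩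
        rw [gnone, hv, gone, M.one]; ring
      · refine ⟨_, _, if_neg hv, ?_⟩
        rw [gnone, gne v hv]; linear_combination 2 * hsx _ (repB v hv)
    · by_cases hv : u = 1
      · refine ⟨_, _, if_pos hv, ?_⟩
        rw [gnone, hv, gone, M.one]; ring
      · refine ⟨_, _, if_neg hv, ?_⟩
        rw [gnone, gne u hv]; linear_combination 2 * hsx _ (repB u hv)
    · by_cases huv : u = v
      · subst huv
        by_cases hv : u = 1
        · refine ⟨_, _, (if_pos rfl).trans (if_pos hv), ?_⟩
          rw [hv, gone, M.one]; ring
        · refine ⟨_, _, (if_pos rfl).trans (if_neg hv), ?_⟩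
          rw [gone, gnone, gne u hv, M.q_spec, M.one,
            (O.q_eq _).resolve_left (repB u hv)]
      · refine ⟨_, _, if_neg huv, ?_⟩
        by_cases hu : u = 1
        · rw [hu, gone, one_mul, M.one]; ring
        by_cases hv : v = 1
        · rw [hv, gone, mul_one, M.one]; ring
        have huv1 : u * v ≠ 1 := fun h => huv (c2vec_mul_eq_one.1 h)
        rw [gne u hu, gne v hv, gne _ huv1]
        obtain ⟨z, w, hzw⟩ := M.mul (rep (α u)) (rep (α v))
        have hz : O.cl (rep (α (u * v))) = O.cl z := by
          rw [hrep, ← O.cl_add (M.mem_left hzw), hrep, hrep, hα]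
        have hz' := O.eq_of_cl (repB _ huv1) hz
        rcases O.mul_eq hzw with hw | ⟨hB, -⟩
        · rw [hzw, hw, hz']
        · exact absurd (hz' ▸ hB) (repB _ huv1)
  have hclg : ∀ u w, O.cl (M.dot (β w).1 (g u)) = O.cl (β w).1 + α (u.getD 1) := by
    intro u w
    rw [O.cl_dot (β w).2]
    congr 1
    rcases u with _ | u
    · rw [gnone, Option.getD_none, hom_one hα, ← O.cl_zero, O.cl_eq, O.N_eq_iff, M.dot_e']
      exact Or.inr rfl
    · rw [Option.getD_some]
      by_cases hu : u = 1
      · rw [hu, gone, hom_one hα, O.cl_zero]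
      · rw [gne u hu, hrep]
  have hneg : ∀ x : O.Quo, -x = x := fun _ => rfl
  refine ⟨.spec n m, hn, fun p => M.dot (β p.2).1 (g p.1), ⟨?_, ?_⟩, ?_, ?_, fun _ => hi _⟩
  · rintro ⟨u, w⟩ ⟨u', w'⟩ (heq : M.dot (β w).1 (g u) = M.dot (β w').1 (g u'))
    have h1 := congrArg O.cl heq
    rw [hclg, hclg] at h1
    have h2 : u.getD 1 = u'.getD 1 := by
      rw [← c2vec_mul_eq_one]
      apply hαK
      have h3 : α (u.getD 1) + α (u'.getD 1) = O.cl (β w).1 + O.cl (β w').1 := by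
        rw [← sub_eq_zero]
        have := sub_eq_zero.2 h1
        simp only [sub_eq_add_neg, hneg] at this ⊢
        rw [← this]; abel
      rw [hα, h3]
      exact O.boolImage.add_mem (O.mem_boolImage.2 (β w).2) (O.mem_boolImage.2 (β w').2)
    have hw : w = w' := by
      rw [h2] at h1
      have h3 := O.N_eq_iff.1 (O.cl_eq.1 (add_right_cancel h1))
      rw [← c2vec_mul_eq_one]
      apply hβK
      rw [hβ]
      rcases h3 with h3 | h3
      · left
        rw [Subtype.ext h3]
        exact neg_add_cancel (β w')
      · right
        apply Subtype.ext
        rw [Model.boolGroup_val_add, h3, M.dot_comm s _ O.B_s (β w').2,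
          M.dot_comm _ _ (M.B_dot (β w').2 O.B_s) (β w').2, M.dot_dot_cancel (β w').2]
    subst hw
    have h4 := M.dot_inj (β w).2 heq
    congr 1
    have hcase : ∀ v, g none = g (some v) → v = 1 → False := fun v hv h1 => by
      rw [gnone, h1, gone] at hv
      exact O.s_ne hv
    rcases u with _ | u <;> rcases u' with _ | u'
    · rfl
    · exact (hcase u' h4 h2.symm).elim
    · exact (hcase u h4.symm h2).elim
    · exact congrArg some h2
  · intro t
    obtain ⟨k, ⟨b, hb, rfl⟩, v, hv⟩ := hαs (O.cl t)
    obtain ⟨k, hk, w, hw⟩ := hβs ⟨b, hb⟩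
    have hbw : O.cl b = O.cl (β w).1 := by
      have hb' : b = (k + β w).1 := congrArg Subtype.val hw
      rw [hb', O.cl_eq, O.N_eq_iff]
      rcases hk with rfl | rfl
      · left; rw [zero_add]
      · right; rfl
    have ht : O.cl t = O.cl (M.dot (β w).1 (g (some v))) := by
      rw [hv, hbw]
      exact (hclg (some v) w).symm
    by_cases hv1 : v = 1
    · rcases O.N_eq_iff.1 (O.cl_eq.1 ht) with h1 | h1
      · exact ⟨(some v, w), h1.symm⟩
      · refine ⟨(none, w), ?_⟩
        show M.dot (β w).1 (g none) = t
        rw [h1, hv1, gone, gnone, M.dot_e', M.dot_comm _ _ O.B_s (β w).2]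
    · refine ⟨(some v, w), O.eq_of_cl ?_ ht.symm⟩
      rw [M.B_dot_iff (β w).2, gne v hv1]
      exact repB v hv1
  · show M.dot (β 1).1 (g (some 1)) = X.e
    rw [gone, hom_one hβ, Model.boolGroup_val_zero, M.dot_e, h.e_eq]
  · intro u v w w'
    obtain ⟨a, b, hab, h1⟩ := hg u v
    rw [hab]
    show _ = {M.dot _ _, M.dot _ _}
    rw [h.mul_iff, hβ, Model.boolGroup_val_add, M.dot_assoc (β w).2 (β w').2,
      M.dot_assoc (β w).2 (β w').2]
    simp only [M.dot_spec (β w).2, M.dot_spec (β w').2]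
    linear_combination M (β w).1 * M (β w').1 * h1

end TwoValuedGroup

namespace TwoValuedGroup

open Submodule

variable {B : Type u} [AddCommGroup B] [Module (ZMod 2) B]

/-- A symmetric function `β` on a Boolean group `Q ⊆ B` satisfying the cocycle identities modulo
the subspaces spanned by the arguments. -/
structure SpanCocycle (Q : Submodule (ZMod 2) B) (β : B → B → B) : Prop where
  zero : ∀ a ∈ Q, β a 0 ∈ span (ZMod 2) {a}
  symm : ∀ a ∈ Q, ∀ b ∈ Q, β a b + β b a ∈ span (ZMod 2) {a, b}
  line : ∀ a ∈ Q, ∀ b ∈ Q, β a b + β (a + b) b ∈ span (ZMod 2) {a, b}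
  assoc : ∀ a ∈ Q, ∀ b ∈ Q, ∀ c ∈ Q,
    β a b + β (a + b) c + β b c + β a (b + c) ∈ span (ZMod 2) {a, b, c}

theorem bool_add_self (a : B) : a + a = 0 := ZModModule.add_self a

theorem bool_add_cancel (a b : B) : a + (a + b) = b := by
  rw [← add_assoc, bool_add_self, zero_add]

theorem bool_add_cancel_right (a b : B) : a + b + b = a := by
  rw [add_assoc, bool_add_self, add_zero]

theorem bool_mem_of_add {W : Submodule (ZMod 2) B} {a b : B} (h : a + b ∈ W) (ha : a ∈ W) :
    b ∈ W := (W.add_mem_iff_right ha).1 h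

theorem zmod_two_cases (c : ZMod 2) : c = 0 ∨ c = 1 := by
  revert c; decide

theorem mem_span_two {a b d : B} :
    d ∈ span (ZMod 2) {a, b} ↔ d = 0 ∨ d = a ∨ d = b ∨ d = a + b := by
  rw [mem_span_pair]
  constructor
  · rintro ⟨i, j, rfl⟩
    rcases zmod_two_cases i with rfl | rfl <;> rcases zmod_two_cases j with rfl | rfl <;> simp
  · rintro (rfl | rfl | rfl | rfl)
    exacts [⟨0, 0, by simp⟩, ⟨1, 0, by simp⟩, ⟨0, 1, by simp⟩, ⟨1, 1, by simp⟩]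

theorem mem_span_one {a d : B} : d ∈ span (ZMod 2) {a} ↔ d = 0 ∨ d = a := by
  rw [mem_span_singleton]
  constructor
  · rintro ⟨i, rfl⟩
    rcases zmod_two_cases i with rfl | rfl <;> simp
  · rintro (rfl | rfl)
    exacts [⟨0, by simp⟩, ⟨1, by simp⟩]

theorem mem_span_three {a b c d : B} :
    d ∈ span (ZMod 2) {a, b, c} ↔ d ∈ span (ZMod 2) {b, c} ∨ a + d ∈ span (ZMod 2) {b, c} := by
  rw [mem_span_insert]
  constructor
  · rintro ⟨i, z, hz, rfl⟩
    rcases zmod_two_cases i with rfl | rfl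
    · left; simpa using hz
    · right; simpa [bool_add_cancel] using hz
  · rintro (h | h)
    · exact ⟨0, d, h, by simp⟩
    · exact ⟨1, _, h, by rw [one_smul, bool_add_cancel]⟩

theorem mem_sup_one {W : Submodule (ZMod 2) B} {x d : B} :
    d ∈ W ⊔ span (ZMod 2) {x} ↔ d ∈ W ∨ ∃ u ∈ W, d = x + u := by
  rw [mem_sup]
  constructor
  · rintro ⟨u, hu, v, hv, rfl⟩
    rcases mem_span_one.1 hv with rfl | rfl
    · left; simpa using hu
    · exact Or.inr ⟨u, hu, add_comm _ _⟩
  · rintro (h | ⟨u, hu, rfl⟩)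
    · exact ⟨d, h, 0, zero_mem _, add_zero _⟩
    · exact ⟨u, hu, x, mem_span_singleton_self x, add_comm _ _⟩

/-- Passing from `β` to the cohomologous function. -/
def gauge (β : B → B → B) (σ : B → B) : B → B → B := fun a b => β a b + σ a + σ b + σ (a + b)

theorem gauge_gauge (β : B → B → B) (σ τ : B → B) :
    gauge (gauge β σ) τ = gauge β (fun a => σ a + τ a) := by
  funext a b
  simp only [gauge]
  abel

/-- All values `β u v` with `u, v ∈ W` lie in the span of the arguments. -/
def SpanGood (β : B → B → B) (W : Submodule (ZMod 2) B) : Prop :=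
  ∀ u ∈ W, ∀ v ∈ W, β u v ∈ span (ZMod 2) {u, v}

/-- `β` is a coboundary on `W`. -/
def SpanTriv (β : B → B → B) (W : Submodule (ZMod 2) B) : Prop :=
  ∃ σ : B → B, σ 0 = 0 ∧ SpanGood (gauge β σ) W

theorem SpanTriv.of_gauge {β : B → B → B} {σ : B → B} {W : Submodule (ZMod 2) B} (hσ : σ 0 = 0)
    (h : SpanTriv (gauge β σ) W) : SpanTriv β W := by
  obtain ⟨τ, h0, h⟩ := h
  rw [gauge_gauge] at h
  exact ⟨_, by rw [hσ, h0, add_zero], h⟩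

theorem SpanGood.triv {β : B → B → B} {W : Submodule (ZMod 2) B} (h : SpanGood β W) :
    SpanTriv β W := ⟨fun _ => 0, rfl, fun u hu v hv => by simpa [gauge] using h u hu v hv⟩

namespace SpanCocycle

variable {Q W : Submodule (ZMod 2) B} {β : B → B → B}

theorem gauge (h : SpanCocycle Q β) {σ : B → B} (hσ : σ 0 = 0) :
    SpanCocycle Q (gauge β σ) where
  zero a ha := by
    have := h.zero a ha
    simpa [TwoValuedGroup.gauge, hσ, bool_add_cancel_right] using this
  symm a ha b hb := by
    convert h.symm a ha b hb using 1
    simp only [TwoValuedGroup.gauge]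
    rw [add_comm b a]
    have h1 := bool_add_self (σ a)
    have h2 := bool_add_self (σ b)
    have h3 := bool_add_self (σ (a + b))
    grind
  line a ha b hb := by
    convert h.line a ha b hb using 1
    simp only [TwoValuedGroup.gauge, bool_add_cancel_right]
    have h1 := bool_add_self (σ a)
    have h2 := bool_add_self (σ b)
    have h3 := bool_add_self (σ (a + b))
    grind
  assoc a ha b hb c hc := by
    convert h.assoc a ha b hb c hc using 1
    simp only [TwoValuedGroup.gauge, add_assoc a b c]
    have h1 := bool_add_self (σ a)
    have h2 := bool_add_self (σ b)
    have h3 := bool_add_self (σ c)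
    have h4 := bool_add_self (σ (a + b))
    have h5 := bool_add_self (σ (b + c))
    have h6 := bool_add_self (σ (a + (b + c)))
    grind

theorem add_bilin (h : SpanCocycle Q β) (ω : B →ₗ[ZMod 2] B →ₗ[ZMod 2] B)
    (hs : ∀ a b, ω a b = ω b a) (hω : ∀ a, ω a a = a) :
    SpanCocycle Q (fun a b => β a b + ω a b) where
  zero a ha := by simpa using h.zero a ha
  symm a ha b hb := by
    convert h.symm a ha b hb using 1
    rw [hs b a]
    have h1 := bool_add_self (ω a b)
    grind
  line a ha b hb := by
    have h1 := add_mem (h.line a ha b hb) (subset_span (by simp : b ∈ ({a, b} : Set B)))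
    convert h1 using 1
    rw [map_add, LinearMap.add_apply, hω]
    have h1 := bool_add_self (ω a b)
    grind
  assoc a ha b hb c hc := by
    convert h.assoc a ha b hb c hc using 1
    rw [map_add, map_add, LinearMap.add_apply]
    have h1 := bool_add_self (ω a b)
    have h2 := bool_add_self (ω a c)
    have h3 := bool_add_self (ω b c)
    grind

end SpanCocycle

end TwoValuedGroup

namespace TwoValuedGroup

open Submodule

variable {B : Type u} [AddCommGroup B] [Module (ZMod 2) B]
variable {Q W : Submodule (ZMod 2) B} {β : B → B → B}

theorem span_add_cases {x u v d : B} (h : d ∈ span (ZMod 2) {x, u, v}) :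
    d ∈ span (ZMod 2) {x + u, v} ∨ d + x ∈ span (ZMod 2) {x + u, v} := by
  have hx := bool_add_self x
  have hu := bool_add_self u
  have hv := bool_add_self v
  rw [mem_span_three, mem_span_two, mem_span_two] at h
  rw [mem_span_two, mem_span_two]
  rcases h with (h | h | h | h) | (h | h | h | h)
  · left; grind
  · right; grind
  · left; grind
  · right; grind
  · right; grind
  · left; grind
  · right; grind
  · left; grind

/-- `β` is trivial on `W`, on lines through `x` and `W`, and on lines through `x + g`. -/
structure NormalAt (β : B → B → B) (W : Submodule (ZMod 2) B) (x g : B) : Prop where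
  good : SpanGood β W
  base : ∀ u ∈ W, β x u ∈ span (ZMod 2) {x, u}
  ref : ∀ u ∈ W, β (x + g) (g + u) ∈ span (ZMod 2) {x + g, g + u}

namespace SpanCocycle

theorem line_mem (h : SpanCocycle Q β) {a b : B} (ha : a ∈ Q) (hb : b ∈ Q)
    (hab : β a b ∈ span (ZMod 2) {a, b}) : β (a + b) b ∈ span (ZMod 2) {a + b, b} := by
  have h1 := bool_mem_of_add (h.line a ha b hb) hab
  refine (span_le.2 ?_ : span (ZMod 2) {a, b} ≤ span (ZMod 2) {a + b, b}) h1
  rintro y (rfl | rfl)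
  · exact mem_span_two.2 (Or.inr (Or.inr (Or.inr (bool_add_cancel_right _ _).symm)))
  · exact subset_span (by simp)

theorem symm_mem (h : SpanCocycle Q β) {a b : B} (ha : a ∈ Q) (hb : b ∈ Q)
    (hab : β a b ∈ span (ZMod 2) {a, b}) : β b a ∈ span (ZMod 2) {b, a} := by
  rw [Set.pair_comm]
  exact bool_mem_of_add (h.symm a ha b hb) hab

theorem mem_three (h : SpanCocycle Q β) (hWQ : W ≤ Q) {x : B} (hx : x ∈ Q)
    (hW : SpanGood β W) (hb : ∀ u ∈ W, β x u ∈ span (ZMod 2) {x, u}) {u v : B} (hu : u ∈ W)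
    (hv : v ∈ W) : β (x + u) v ∈ span (ZMod 2) {x, u, v} := by
  have h1 := h.assoc x hx u (hWQ hu) v (hWQ hv)
  have h2 : β x u ∈ span (ZMod 2) {x, u, v} :=
    span_mono (by intro y; simp; tauto) (hb u hu)
  have h3 : β u v ∈ span (ZMod 2) {x, u, v} :=
    span_mono (by intro y; simp; tauto) (hW u hu v hv)
  have h4 : β x (u + v) ∈ span (ZMod 2) {x, u, v} := by
    refine (span_le.2 ?_ : span (ZMod 2) {x, u + v} ≤ _) (hb _ (W.add_mem hu hv))
    rintro y (rfl | rfl)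
    · exact subset_span (by simp)
    · exact add_mem (subset_span (by simp)) (subset_span (by simp))
  have h5 := add_mem (add_mem h2 h3) h4
  refine bool_mem_of_add ?_ h5
  convert h1 using 1
  abel

theorem exists_base (h : SpanCocycle Q β) {x : B} (hx : x ∈ Q) (hxW : x ∉ W)
    (hW : SpanGood β W) : ∃ σ : B → B, σ 0 = 0 ∧ SpanGood (TwoValuedGroup.gauge β σ) W ∧
      ∀ u ∈ W, TwoValuedGroup.gauge β σ x u ∈ span (ZMod 2) {x, u} := by
  classical
  let σ : B → B := fun y => if x + y ∈ W then β x (x + y) else 0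
  have h1 : ∀ u ∈ W, σ u = 0 := fun u hu =>
    if_neg fun h2 => hxW (bool_mem_of_add (by rwa [add_comm] at h2) hu)
  have h2 : ∀ u ∈ W, σ (x + u) = β x u := fun u hu => by
    simp only [σ, bool_add_cancel, if_pos hu]
  have h3 : σ x = β x 0 := by simpa using h2 0 W.zero_mem
  refine ⟨σ, h1 0 W.zero_mem, fun u hu v hv => ?_, fun u hu => ?_⟩
  · simpa [TwoValuedGroup.gauge, h1 u hu, h1 v hv, h1 _ (W.add_mem hu hv)] using hW u hu v hv
  · have h4 := h.zero x hx
    have : TwoValuedGroup.gauge β σ x u = β x 0 := by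
      simp only [TwoValuedGroup.gauge, h1 u hu, h2 u hu, h3]
      have := bool_add_self (β x u)
      grind
    rw [this]
    exact span_mono (by simp) h4

theorem exists_normal (h : SpanCocycle Q β) (hWQ : W ≤ Q) {x g : B} (hx : x ∈ Q) (hxW : x ∉ W)
    (hg : g ∈ W) (hW : SpanTriv β W) :
    ∃ σ : B → B, σ 0 = 0 ∧ NormalAt (TwoValuedGroup.gauge β σ) W x g := by
  classical
  obtain ⟨σ₀, hσ₀, hW⟩ := hW
  obtain ⟨σ₁, hσ₁, hW, hb⟩ := (h.gauge hσ₀).exists_base hx hxW hW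
  have h' := (h.gauge hσ₀).gauge hσ₁
  suffices H : ∃ σ : B → B, σ 0 = 0 ∧
      NormalAt (TwoValuedGroup.gauge (TwoValuedGroup.gauge (TwoValuedGroup.gauge β σ₀) σ₁) σ) W x g by
    obtain ⟨σ, h0, H⟩ := H
    rw [gauge_gauge, gauge_gauge] at H
    exact ⟨_, by simp [hσ₀, hσ₁, h0], H⟩
  generalize TwoValuedGroup.gauge (TwoValuedGroup.gauge β σ₀) σ₁ = γ at *
  let good : B → Prop := fun u => γ (x + g) (g + u) ∈ span (ZMod 2) {x + g, g + u}
  let σ : B → B := fun y => if x + y ∈ W ∧ ¬ good (x + y) then x else 0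
  have h1 : ∀ u ∈ W, σ u = 0 := fun u hu =>
    if_neg fun h2 => hxW (bool_mem_of_add (by rw [add_comm]; exact h2.1) hu)
  have h2 : ∀ u ∈ W, σ (x + u) = if good u then 0 else x := fun u hu => by
    simp only [σ, bool_add_cancel, hu, true_and, ite_not]
  have h3 : ∀ y, σ y = 0 ∨ σ y = x := fun y => by
    simp only [σ]
    split_ifs <;> simp
  have hxg : x + g ∈ Q := Q.add_mem hx (hWQ hg)
  have h4 : σ (x + g) = 0 := by
    rw [h2 g hg, if_pos]
    show γ (x + g) (g + g) ∈ _
    rw [bool_add_self]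
    exact span_mono (by simp) (h'.zero _ hxg)
  refine ⟨σ, h1 0 W.zero_mem, fun u hu v hv => ?_, fun u hu => ?_, fun u hu => ?_⟩
  · simpa [TwoValuedGroup.gauge, h1 u hu, h1 v hv, h1 _ (W.add_mem hu hv)] using hW u hu v hv
  · have h5 : ∀ y, σ y ∈ span (ZMod 2) {x, u} := fun y => by
      rcases h3 y with h | h <;> rw [h]
      · exact zero_mem _
      · exact subset_span (by simp)
    exact add_mem (add_mem (add_mem (hb u hu) (h5 _)) (h5 _)) (h5 _)
  · have h5 : x + g + (g + u) = x + u := by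
      rw [add_assoc, bool_add_cancel]
    have hgu := W.add_mem hg hu
    simp only [TwoValuedGroup.gauge, h5, h4, h1 _ hgu, add_zero, h2 u hu]
    split_ifs with h6
    · simpa using h6
    · exact (span_add_cases (h'.mem_three hWQ hx hW hb hg hgu)).resolve_left h6

end SpanCocycle

namespace NormalAt

variable {x g : B}

theorem triangle (N : NormalAt β W x g) (h : SpanCocycle Q β) (hWQ : W ≤ Q) (hx : x ∈ Q)
    (hxW : x ∉ W) {u v w : B} (hu : u ∈ W) (hv : v ∈ W) (hw : w ∈ W)
    (huvw : u ∉ span (ZMod 2) {u + v, u + w})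
    (h1 : β (x + v) (v + u) ∈ span (ZMod 2) {x + v, v + u})
    (h2 : β (x + v) (v + w) ∈ span (ZMod 2) {x + v, v + w}) :
    β (x + u) (u + w) ∈ span (ZMod 2) {x + u, u + w} := by
  have huw := W.add_mem hu hw
  have hvw := W.add_mem hv hw
  have hvu := W.add_mem hv hu
  have hxu := Q.add_mem hx (hWQ hu)
  have hxv := Q.add_mem hx (hWQ hv)
  have e1 : x + v + (v + u) = x + u := by rw [add_assoc, bool_add_cancel]
  have e2 : v + u + (u + w) = v + w := by rw [add_assoc, bool_add_cancel]
  -- the cocycle identity for `x + v`, `v + u`, `u + w`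
  have h3 := h.assoc (x + v) hxv (v + u) (hWQ hvu) (u + w) (hWQ huw)
  rw [e1, e2] at h3
  have h4 : β (x + u) (u + w) ∈ span (ZMod 2) {x + v, v + u, u + w} := by
    have h5 : β (x + v) (v + u) ∈ span (ZMod 2) {x + v, v + u, u + w} :=
      span_mono (by intro y; simp; tauto) h1
    have h6 : β (v + u) (u + w) ∈ span (ZMod 2) {x + v, v + u, u + w} :=
      span_mono (by intro y; simp; tauto) (N.good _ hvu _ huw)
    have h7 : β (x + v) (v + w) ∈ span (ZMod 2) {x + v, v + u, u + w} := by
      refine (span_le.2 ?_ : span (ZMod 2) {x + v, v + w} ≤ _) h2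
      rintro y (rfl | rfl)
      · exact subset_span (by simp)
      · rw [← e2]
        exact add_mem (subset_span (by simp)) (subset_span (by simp))
    refine bool_mem_of_add ?_ (add_mem (add_mem h5 h6) h7)
    convert h3 using 1
    abel
  rcases span_add_cases (h.mem_three hWQ hx N.good N.base hu huw) with h5 | h5
  · exact h5
  · exfalso
    have h6 : span (ZMod 2) {x + u, u + w} ≤ span (ZMod 2) {x + v, v + u, u + w} := by
      rw [span_le]
      rintro y (rfl | rfl)
      · rw [← e1]
        exact add_mem (subset_span (by simp)) (subset_span (by simp))
      · exact subset_span (by simp)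
    have h7 := bool_mem_of_add (h6 h5) h4
    have hle : span (ZMod 2) {v + u, u + w} ≤ W := by
      rw [span_le]
      rintro y (rfl | rfl)
      exacts [hvu, huw]
    rcases mem_span_three.1 h7 with h8 | h8
    · exact hxW (hle h8)
    · apply huvw
      have e3 : x + v + x = v := by
        rw [add_comm x v, bool_add_cancel_right]
      rw [e3] at h8
      have h9 := add_mem h8 (subset_span (by simp : v + u ∈ ({v + u, u + w} : Set B)))
      rw [bool_add_cancel] at h9
      rwa [add_comm u v]

theorem swap (h : SpanCocycle Q β) (hWQ : W ≤ Q) (hx : x ∈ Q) {u v : B} (hu : u ∈ W) (hv : v ∈ W)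
    (h1 : β (x + u) (u + v) ∈ span (ZMod 2) {x + u, u + v}) :
    β (x + v) (v + u) ∈ span (ZMod 2) {x + v, v + u} := by
  have := h.line_mem (Q.add_mem hx (hWQ hu)) (hWQ (W.add_mem hu hv)) h1
  rwa [add_assoc, bool_add_cancel, add_comm u v] at this

theorem good_sup (N : NormalAt β W x g) (h : SpanCocycle Q β) (hWQ : W ≤ Q) (hx : x ∈ Q)
    (hxW : x ∉ W) (hg : g ∈ W) (hg0 : g ≠ 0)
    (H : ∀ u ∈ W, u ∉ span (ZMod 2) {g} → (∃ w ∈ W, w ∉ span (ZMod 2) {g, u}) ∨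
      β (x + u) (u + (u + g)) ∈ span (ZMod 2) {x + u, u + (u + g)}) :
    SpanGood β (W ⊔ span (ZMod 2) {x}) := by
  have zero_left : ∀ v ∈ W, β (x + 0) (0 + v) ∈ span (ZMod 2) {x + 0, 0 + v} := fun v hv => by
    simpa using N.base v hv
  have generic : ∀ u ∈ W, ∀ v ∈ W, u ≠ g + v →
      β (x + u) (u + v) ∈ span (ZMod 2) {x + u, u + v} := by
    intro u hu v hv huv
    by_cases hu0 : u = 0
    · subst hu0; exact zero_left v hv
    by_cases hv0 : v = 0
    · subst hv0; exact swap h hWQ hx W.zero_mem hu (zero_left u hu)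
    refine N.triangle h hWQ hx hxW hu hg hv ?_ (N.ref u hu) (N.ref v hv)
    rw [mem_span_two]
    have := bool_add_self u
    rintro (h1 | h1 | h1 | h1)
    · exact hu0 h1
    · exact hg0 (left_eq_add.1 h1)
    · exact hv0 (left_eq_add.1 h1)
    · apply huv
      grind
  have all : ∀ u ∈ W, ∀ v ∈ W, β (x + u) (u + v) ∈ span (ZMod 2) {x + u, u + v} := by
    intro u hu v hv
    by_cases huv : u = g + v
    swap
    · exact generic u hu v hv huv
    obtain rfl : v = u + g := by rw [huv, add_comm (g + v), bool_add_cancel]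
    by_cases hug : u ∈ span (ZMod 2) {g}
    · rcases mem_span_one.1 hug with rfl | rfl
      · exact zero_left _ hv
      · rw [bool_add_self]
        exact swap h hWQ hx W.zero_mem hg (zero_left u hg)
    rcases H u hu hug with ⟨w, hw, hwg⟩ | h1
    swap
    · exact h1
    rw [mem_span_two] at hwg
    push Not at hwg
    obtain ⟨w0, w1, w2, w3⟩ := hwg
    have hw' := bool_add_self w
    have hg' := bool_add_self g
    have hu' := bool_add_self u
    refine N.triangle h hWQ hx hxW hu hw hv ?_ (generic w hw u hu w3) (generic w hw _ hv ?_)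
    · rw [bool_add_cancel, mem_span_two]
      rw [mem_span_one] at hug
      rintro (h1 | h1 | h1 | h1)
      · exact hug (Or.inl h1)
      · exact w0 (left_eq_add.1 h1)
      · exact hug (Or.inr h1)
      · exact w1 (by grind)
    · intro h1; exact w2 (by grind)
  have all' : ∀ u ∈ W, ∀ v ∈ W, β (x + u) v ∈ span (ZMod 2) {x + u, v} := fun u hu v hv => by
    have := all u hu (u + v) (W.add_mem hu hv)
    rwa [bool_add_cancel] at this
  intro a ha b hb
  rcases mem_sup_one.1 ha with ha | ⟨u, hu, rfl⟩ <;> rcases mem_sup_one.1 hb with hb | ⟨v, hv, rfl⟩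
  · exact N.good a ha b hb
  · exact h.symm_mem (Q.add_mem hx (hWQ hv)) (hWQ ha) (all' v hv a ha)
  · exact all' u hu b hb
  · have huv := W.add_mem hu hv
    have h1 := h.symm_mem (Q.add_mem hx (hWQ hu)) (hWQ huv) (all' u hu _ huv)
    have h2 := h.line_mem (hWQ huv) (Q.add_mem hx (hWQ hu)) h1
    have e : u + v + (x + u) = x + v := by
      have := bool_add_self u
      grind
    rw [e] at h2
    exact h.symm_mem (Q.add_mem hx (hWQ hv)) (Q.add_mem hx (hWQ hu)) h2

end NormalAt

end TwoValuedGroup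

namespace TwoValuedGroup

open Submodule

variable {B : Type u} [AddCommGroup B] [Module (ZMod 2) B]
variable {Q W : Submodule (ZMod 2) B} {β : B → B → B}

/-- A diagonal bilinear form which is orthogonal for a linearly independent triple. -/
theorem exists_diagonal {v : Fin 3 → B} (hv : LinearIndependent (ZMod 2) v) :
    ∃ ω : B →ₗ[ZMod 2] B →ₗ[ZMod 2] B, (∀ a b, ω a b = ω b a) ∧ (∀ a, ω a a = a) ∧
      ∀ i j, i ≠ j → ω (v i) (v j) = 0 := by
  let b := Module.Basis.extend hv.linearIndepOn_id
  let ω : B →ₗ[ZMod 2] B →ₗ[ZMod 2] B :=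
    b.constr ℕ (fun i => (b.coord i).smulRight (b i))
  have h1 : ∀ i, ω (b i) (b i) = b i := fun i => by
    simp [ω, Module.Basis.constr_basis]
  have h2 : ∀ i j, i ≠ j → ω (b i) (b j) = 0 := fun i j hij => by
    simp [ω, Module.Basis.constr_basis, hij.symm]
  have hs : ∀ a b, ω a b = ω b a := by
    have : ω = ω.flip := by
      refine b.ext fun i => b.ext fun j => ?_
      rw [LinearMap.flip_apply]
      by_cases hij : i = j
      · rw [hij]
      · rw [h2 i j hij, h2 j i (Ne.symm hij)]
    intro a b
    conv_lhs => rw [this]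
    rfl
  refine ⟨ω, hs, fun a => ?_, fun i j hij => ?_⟩
  · have ha : a ∈ span (ZMod 2) (Set.range b) := by rw [b.span_eq]; trivial
    induction ha using span_induction with
    | mem x hx => obtain ⟨i, rfl⟩ := hx; exact h1 i
    | zero => simp
    | add x y _ _ hx hy =>
      rw [map_add, map_add, LinearMap.add_apply, LinearMap.add_apply, hx, hy, hs y x]
      have := bool_add_self (ω x y)
      grind
    | smul c x _ hx => rcases zmod_two_cases c with rfl | rfl <;> simp [hx]
  · have hr : ∀ i, ∃ k, b k = v i := fun i =>
      ⟨⟨v i, hv.linearIndepOn_id.subset_extend _ ⟨i, rfl⟩⟩, by simp [b]⟩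
    obtain ⟨k, hk⟩ := hr i
    obtain ⟨l, hl⟩ := hr j
    rw [← hk, ← hl]
    refine h2 k l fun h => hij (hv.injective ?_)
    rw [← hk, ← hl, h]

namespace SpanCocycle

theorem triv_bot (h : SpanCocycle Q β) : SpanTriv β (⊥ : Submodule (ZMod 2) B) := by
  apply SpanGood.triv
  intro u hu v hv
  rw [mem_bot] at hu hv
  subst hu hv
  exact span_mono (by simp) (h.zero 0 Q.zero_mem)

theorem triv_one (h : SpanCocycle Q β) {g : B} (hg : g ∈ Q) : SpanTriv β (span (ZMod 2) {g}) := by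
  have h0 := h.zero g hg
  have h00 := h.zero 0 Q.zero_mem
  have h1 : β g 0 ∈ span (ZMod 2) {g, 0} := span_mono (by simp) h0
  have h2 := h.symm_mem hg Q.zero_mem h1
  have h3 := h.line_mem Q.zero_mem hg h2
  rw [zero_add] at h3
  apply SpanGood.triv
  intro u hu v hv
  rcases mem_span_one.1 hu with rfl | rfl <;> rcases mem_span_one.1 hv with rfl | rfl
  · exact span_mono (by simp) h00
  · exact h2
  · exact h1
  · exact h3

theorem triv_sup (h : SpanCocycle Q β) (hWQ : W ≤ Q) (hW : SpanTriv β W) {x g : B} (hx : x ∈ Q)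
    (hg : g ∈ W) (hg0 : g ≠ 0)
    (H : ∀ u ∈ W, u ∉ span (ZMod 2) {g} → ∃ w ∈ W, w ∉ span (ZMod 2) {g, u}) :
    SpanTriv β (W ⊔ span (ZMod 2) {x}) := by
  by_cases hxW : x ∈ W
  · rwa [sup_eq_left.2 (span_le.2 (by simpa using hxW))]
  obtain ⟨σ, hσ, N⟩ := h.exists_normal hWQ hx hxW hg hW
  exact (N.good_sup (h.gauge hσ) hWQ hx hxW hg hg0
    (fun u hu hug => Or.inl (H u hu hug))).triv.of_gauge hσ

theorem triv_two (h : SpanCocycle Q β) {g k : B} (hg : g ∈ Q) (hg0 : g ≠ 0) (hk : k ∈ Q) :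
    SpanTriv β (span (ZMod 2) {g} ⊔ span (ZMod 2) {k}) :=
  h.triv_sup (span_le.2 (by simpa using hg)) (h.triv_one hg) hk (mem_span_singleton_self g) hg0
    (fun _ hu hug => absurd hu hug)

theorem triv_of_three (h : SpanCocycle Q β) (hWQ : W ≤ Q) (hW : SpanTriv β W)
    (H : ∀ u v : B, ∃ w ∈ W, w ∉ span (ZMod 2) {u, v}) {F : Set B} (hF : F.Finite)
    (hFQ : F ⊆ Q) : SpanTriv β (W ⊔ span (ZMod 2) F) := by
  induction F, hF using Set.Finite.induction_on with
  | empty => simpa using hW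
  | @insert x F _ _ ih =>
    have hF' : F ⊆ Q := fun y hy => hFQ (Or.inr hy)
    have e : W ⊔ span (ZMod 2) (insert x F) = W ⊔ span (ZMod 2) F ⊔ span (ZMod 2) {x} := by
      rw [span_insert, sup_comm (span (ZMod 2) {x}), sup_assoc]
    rw [e]
    obtain ⟨g, hg, hg0⟩ := H 0 0
    refine h.triv_sup (sup_le hWQ (span_le.2 hF')) (ih hF') (hFQ (Or.inl rfl)) (mem_sup_left hg)
      (by rintro rfl; exact hg0 (zero_mem _)) fun u _ _ => ?_
    obtain ⟨w, hw, hwu⟩ := H g u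
    exact ⟨w, mem_sup_left hw, hwu⟩

/-- On a three-dimensional space either `β` or its diagonal twist is a coboundary. -/
theorem triv_or_twist (h : SpanCocycle Q β) {g k x : B} (hg : g ∈ Q) (hk : k ∈ Q) (hx : x ∈ Q)
    (hg0 : g ≠ 0) (hxW : x ∉ span (ZMod 2) {g} ⊔ span (ZMod 2) {k})
    (ω : B →ₗ[ZMod 2] B →ₗ[ZMod 2] B) (hs : ∀ a b, ω a b = ω b a) (hω : ∀ a, ω a a = a)
    (hgk : ω g k = 0) (hxg : ω x g = 0) (hxk : ω x k = 0) :
    SpanTriv β (span (ZMod 2) {g} ⊔ span (ZMod 2) {k} ⊔ span (ZMod 2) {x}) ∨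
    SpanTriv (fun a b => β a b + ω a b)
      (span (ZMod 2) {g} ⊔ span (ZMod 2) {k} ⊔ span (ZMod 2) {x}) := by
  classical
  set W := span (ZMod 2) {g} ⊔ span (ZMod 2) {k} with hW
  have hWQ : W ≤ Q := sup_le (span_le.2 (by simpa using hg)) (span_le.2 (by simpa using hk))
  have hgW : g ∈ W := mem_sup_left (mem_span_singleton_self g)
  have hkW : k ∈ W := mem_sup_right (mem_span_singleton_self k)
  have hmem : ∀ u ∈ W, u = 0 ∨ u = g ∨ u = k ∨ u = g + k := fun u hu => by
    rwa [hW, ← span_union, Set.singleton_union, mem_span_two] at hu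
  obtain ⟨σ, hσ, N⟩ := h.exists_normal hWQ hx hxW hgW (h.triv_two hg hg0 hk)
  have hγ := h.gauge hσ
  have ek : k + (k + g) = g := bool_add_cancel _ _
  have egkg : g + k + g = k := by rw [add_comm g k, bool_add_cancel_right]
  by_cases hgood : TwoValuedGroup.gauge β σ (x + k) (k + (k + g)) ∈
      span (ZMod 2) {x + k, k + (k + g)}
  · left
    refine (N.good_sup hγ hWQ hx hxW hgW hg0 fun u hu hug => Or.inr ?_).triv.of_gauge hσ
    rw [mem_span_one] at hug
    rcases hmem u hu with rfl | rfl | rfl | rfl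
    · exact absurd (Or.inl rfl) hug
    · exact absurd (Or.inr rfl) hug
    · exact hgood
    · rw [egkg, add_comm g k] at *
      exact NormalAt.swap hγ hWQ hx hkW (W.add_mem hkW hgW) hgood
  · right
    have hγω := hγ.add_bilin ω hs hω
    let τ : B → B := fun y => if y = x + k then x else 0
    have τW : ∀ u ∈ W, τ u = 0 := fun u hu => if_neg fun h1 => hxW (by
      have := W.add_mem hu hkW
      rwa [h1, bool_add_cancel_right] at this)
    have τk : τ (x + k) = x := if_pos rfl
    have τne : ∀ u, u ≠ k → τ (x + u) = 0 := fun u hu => if_neg fun h1 => hu (add_left_cancel h1)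
    have τcase : ∀ y, τ y = 0 ∨ τ y = x := fun y => by
      simp only [τ]; split_ifs <;> simp
    have hk0 : k ≠ 0 := by
      rintro rfl
      apply hgood
      simpa using N.base g hgW
    have hne : g ≠ k := by
      rintro rfl
      apply hgood
      simpa [bool_add_self] using NormalAt.swap hγ hWQ hx W.zero_mem hgW
        (by simpa using N.base g hgW)
    have hω0 : ∀ u ∈ W, ∀ v ∈ W, ω u v ∈ span (ZMod 2) {u, v} := by
      have hkg : ω k g = 0 := by rw [hs, hgk]
      intro u hu v hv
      rw [mem_span_two]
      rcases hmem u hu with rfl | rfl | rfl | rfl <;> rcases hmem v hv with rfl | rfl | rfl | rfl <;>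
        simp [hω, hgk, hkg]
    have hωx : ∀ u ∈ W, ω x u = 0 := fun u hu => by
      rcases hmem u hu with rfl | rfl | rfl | rfl <;> simp [hxg, hxk]
    have N' : NormalAt (TwoValuedGroup.gauge (fun a b => TwoValuedGroup.gauge β σ a b + ω a b) τ)
        W x g := by
      refine ⟨fun u hu v hv => ?_, fun u hu => ?_, fun u hu => ?_⟩
      · show TwoValuedGroup.gauge β σ u v + ω u v + τ u + τ v + τ (u + v) ∈ _
        rw [τW u hu, τW v hv, τW _ (W.add_mem hu hv), add_zero, add_zero, add_zero]
        exact add_mem (N.good u hu v hv) (hω0 u hu v hv)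
      · show TwoValuedGroup.gauge β σ x u + ω x u + τ x + τ u + τ (x + u) ∈ _
        have h5 : ∀ y, τ y ∈ span (ZMod 2) {x, u} := fun y => by
          rcases τcase y with h | h <;> rw [h]
          · exact zero_mem _
          · exact subset_span (by simp)
        rw [hωx u hu, add_zero]
        exact add_mem (add_mem (add_mem (N.base u hu) (h5 _)) (h5 _)) (h5 _)
      · show TwoValuedGroup.gauge β σ (x + g) (g + u) + ω (x + g) (g + u) + τ (x + g) + τ (g + u) +
          τ (x + g + (g + u)) ∈ _
        have h5 : x + g + (g + u) = x + u := by rw [add_assoc, bool_add_cancel]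
        rw [h5, τne g hne, τW _ (W.add_mem hgW hu), map_add ω x g, LinearMap.add_apply,
          hωx _ (W.add_mem hgW hu), zero_add, add_zero, add_zero, add_assoc]
        refine add_mem (N.ref u hu) ?_
        rcases hmem u hu with rfl | rfl | rfl | rfl
        · rw [τne 0 hk0.symm, add_zero, add_zero, hω]
          exact subset_span (by simp)
        · rw [τne _ hne, bool_add_self, map_zero, add_zero]
          exact zero_mem _
        · rw [τk, map_add, hω, hgk, add_zero, add_comm g x]
          exact subset_span (by simp)
        · rw [bool_add_cancel, hgk, τne _ (fun h1 => hg0 (add_eq_right.1 h1)), add_zero]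
          exact zero_mem _
    have hτ0 : τ 0 = 0 := τW 0 W.zero_mem
    have hgood' : TwoValuedGroup.gauge (fun a b => TwoValuedGroup.gauge β σ a b + ω a b) τ (x + k)
        (k + (k + g)) ∈ span (ZMod 2) {x + k, k + (k + g)} := by
      rw [ek] at hgood ⊢
      show TwoValuedGroup.gauge β σ (x + k) g + ω (x + k) g + τ (x + k) + τ g +
          τ (x + k + g) ∈ _
      rw [τk, τW g hgW, add_assoc x k g, τne _ (fun h1 => hg0 (add_eq_left.1 h1)), map_add,
        LinearMap.add_apply, hxg, hs k g, hgk, add_zero, add_zero, add_zero, add_zero]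
      exact (span_add_cases (hγ.mem_three hWQ hx N.good N.base hkW hgW)).resolve_left hgood
    have hN := hγω.gauge hτ0
    have key := (N'.good_sup hN hWQ hx hxW hgW hg0 fun u hu hug => Or.inr (by
      rw [mem_span_one] at hug
      rcases hmem u hu with rfl | rfl | rfl | rfl
      · exact absurd (Or.inl rfl) hug
      · exact absurd (Or.inr rfl) hug
      · exact hgood'
      · rw [egkg, add_comm g k]
        exact NormalAt.swap hN hWQ hx hkW (W.add_mem hkW hgW) hgood')).triv.of_gauge hτ0
    refine SpanTriv.of_gauge hσ ?_
    convert key using 1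
    funext a b
    simp only [TwoValuedGroup.gauge]
    abel

/-- A cocycle on a finite-dimensional space is a coboundary, possibly after a diagonal twist. -/
theorem classify (h : SpanCocycle Q β) {F : Set B} (hF : F.Finite)
    (hQ : Q = span (ZMod 2) F) : SpanTriv β Q ∨
      ∃ ω : B →ₗ[ZMod 2] B →ₗ[ZMod 2] B, (∀ a b, ω a b = ω b a) ∧ (∀ a, ω a a = a) ∧
        SpanTriv (fun a b => β a b + ω a b) Q := by
  by_cases h0 : Q = ⊥
  · left; rw [h0]; exact h.triv_bot
  obtain ⟨g, hg, hg0⟩ := Q.exists_mem_ne_zero_of_ne_bot h0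
  have hgle : span (ZMod 2) {g} ≤ Q := span_le.2 (by simpa using hg)
  by_cases h1 : Q ≤ span (ZMod 2) {g}
  · left; rw [le_antisymm h1 hgle]; exact h.triv_one hg
  obtain ⟨k, hk, hkg⟩ := SetLike.not_le_iff_exists.1 h1
  have hkle : span (ZMod 2) {k} ≤ Q := span_le.2 (by simpa using hk)
  by_cases h2 : Q ≤ span (ZMod 2) {g} ⊔ span (ZMod 2) {k}
  · left; rw [le_antisymm h2 (sup_le hgle hkle)]; exact h.triv_two hg hg0 hk
  obtain ⟨x, hx, hxW⟩ := SetLike.not_le_iff_exists.1 h2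
  have hxle : span (ZMod 2) {x} ≤ Q := span_le.2 (by simpa using hx)
  have hli : LinearIndependent (ZMod 2) ![x, k, g] := by
    simp only [Matrix.vecCons]
    rw [linearIndependent_finCons, linearIndependent_finCons]
    refine ⟨⟨?_, ?_⟩, ?_⟩
    · simpa [linearIndependent_unique_iff] using hg0
    · simpa using hkg
    · rw [← span_union, Set.singleton_union] at hxW
      simpa [Set.pair_comm] using hxW
  obtain ⟨ω, hs, hω, ho⟩ := exists_diagonal hli
  have hWQ : span (ZMod 2) {g} ⊔ span (ZMod 2) {k} ⊔ span (ZMod 2) {x} ≤ Q :=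
    sup_le (sup_le hgle hkle) hxle
  have H : ∀ u v : B, ∃ w ∈ span (ZMod 2) {g} ⊔ span (ZMod 2) {k} ⊔ span (ZMod 2) {x},
      w ∉ span (ZMod 2) {u, v} := by
    intro u v
    by_contra! hcon
    have hle : span (ZMod 2) (Set.range ![x, k, g]) ≤ span (ZMod 2) {u, v} := by
      rw [span_le]
      rintro _ ⟨i, rfl⟩
      apply hcon
      fin_cases i
      · exact mem_sup_right (mem_span_singleton_self x)
      · exact mem_sup_left (mem_sup_right (mem_span_singleton_self k))
      · exact mem_sup_left (mem_sup_left (mem_span_singleton_self g))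
    have hr := finrank_span_eq_card hli
    have hfin : Module.Finite (ZMod 2) (span (ZMod 2) {u, v}) :=
      Module.Finite.span_of_finite _ (by simp)
    have h3 := Submodule.finrank_mono hle
    classical
    have h4 := finrank_span_finset_le_card (R := ZMod 2) ({u, v} : Finset B)
    have h5 := Finset.card_le_two (a := u) (b := v)
    rw [Finset.coe_pair, Set.finrank] at h4
    rw [hr, Fintype.card_fin] at h3
    omega
  have fin : ∀ γ, SpanCocycle Q γ →
      SpanTriv γ (span (ZMod 2) {g} ⊔ span (ZMod 2) {k} ⊔ span (ZMod 2) {x}) → SpanTriv γ Q := by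
    intro γ hγ h3
    have h4 := hγ.triv_of_three hWQ h3 H hF (hQ ▸ subset_span)
    rwa [← hQ, sup_eq_right.2 hWQ] at h4
  rcases h.triv_or_twist hg hk hx hg0 hxW ω hs hω (ho 2 1 (by decide)) (ho 0 2 (by decide))
    (ho 0 1 (by decide)) with h3 | h3
  · exact Or.inl (fin _ h h3)
  · exact Or.inr ⟨ω, hs, hω, fin _ (h.add_bilin ω hs hω) h3⟩

end SpanCocycle

end TwoValuedGroup

namespace TwoValuedGroup
namespace Model

open Submodule

variable {T : Type u} {R : Type v} [CommRing R] {M : Model T R}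

noncomputable instance boolModule : Module (ZMod 2) {b // M.B b} :=
  AddCommGroup.zmodModule (n := 2) fun x => by
    rw [two_nsmul]
    exact Subtype.ext (M.dot_self x.2)

/-- The action of the Boolean part. -/
noncomputable def act (b : {b // M.B b}) (x : T) : T := M.dot b.1 x

theorem act_zero (x : T) : act (0 : {b // M.B b}) x = x := M.dot_e x

theorem act_add (b c : {b // M.B b}) (x : T) : act (b + c) x = act b (act c x) :=
  M.dot_assoc b.2 c.2

theorem act_act (b : {b // M.B b}) (x : T) : act b (act b x) = x := M.dot_dot_cancel b.2

theorem Mem.act_left {z x y : T} (h : M.Mem z x y) (b : {b // M.B b}) :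
    M.Mem (act b z) (act b x) y := M.mem_dot_dot b.2 h

theorem Mem.act_right {z x y : T} (h : M.Mem z x y) (b : {b // M.B b}) :
    M.Mem (act b z) x (act b y) := (h.comm.act_left b).comm

/-- All squares lie in the Boolean part, and there are no special pairs. -/
structure Quartic (M : Model T R) : Prop where
  ns : M.NS
  B_q : ∀ x, M.B (M.q x)

namespace Quartic

/-- The square as an element of the Boolean part. -/
noncomputable def sq (h : Quartic M) (x : T) : {b // M.B b} := ⟨M.q x, h.B_q x⟩

variable (h : Quartic M)

theorem sq_e : h.sq M.e = 0 := Subtype.ext M.q_e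

theorem sq_act (b : {b // M.B b}) (x : T) : h.sq (act b x) = h.sq x :=
  Subtype.ext (M.q_dot b.2 x)

theorem sq_eq_zero {x : T} : h.sq x = 0 ↔ M.B x := by
  rw [Subtype.ext_iff]; rfl

theorem act_sq (x : T) : act (h.sq x) x = x := M.q_dot_self (h.B_q x)

theorem act_eq_self {b : {b // M.B b}} {x : T} : act b x = x ↔ b = 0 ∨ b = h.sq x := by
  constructor
  · intro h1
    rcases M.dot_eq_self b.2 h1 with h2 | h2
    · exact Or.inl (Subtype.ext h2)
    · exact Or.inr (Subtype.ext h2)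
  · rintro (rfl | rfl)
    · exact act_zero x
    · exact h.act_sq x

theorem exists_act {x y : T} (hxy : h.sq x = h.sq y) : ∃ b : {b // M.B b}, y = act b x := by
  have e : M.q x = M.q y := congrArg Subtype.val hxy
  obtain ⟨b, hb, h1⟩ := h.ns.same_q e
  exact ⟨⟨b, hb⟩, h1⟩

theorem mul_eq {x y z : T} (hz : M.Mem z x y) : 2 * M x * M y = M z + M (act (h.sq y) z) := by
  obtain ⟨w, hw⟩ := hz
  rw [hw, M.B_mem (h.B_q y) (M.mem_right (h.ns.squares hw).2)]
  rfl

theorem sq_mem {x y z : T} (hz : M.Mem z x y) : h.sq z = h.sq x + h.sq y := by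
  have h1 := (h.ns.squares (h.mul_eq hz)).1
  have h2 := M.q_dot (h.B_q y) z
  have h3 : M (M.q x) * M (M.q y) = M (M.q z) := M.cancel2 _ _ (by
    have : M.q (act (h.sq y) z) = M.q z := h2
    rw [this] at h1
    linear_combination h1)
  exact Subtype.ext (M.dot_eq h3).symm

theorem mem_act_iff {x y z : T} (hz : M.Mem z x y) {d : {b // M.B b}} :
    M.Mem (act d z) x y ↔ d ∈ span (ZMod 2) {h.sq x, h.sq y} := by
  have h1 := h.mul_eq hz
  have hs := h.sq_mem hz
  have hxx := bool_add_self (h.sq x)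
  have hyy := bool_add_self (h.sq y)
  rw [mem_span_two]
  constructor
  · intro h2
    rcases h2.eq h1 with h3 | h3
    · rw [h.act_eq_self, hs] at h3
      tauto
    · have h4 : act (h.sq y + d) z = z := by rw [act_add, h3, act_act]
      rw [h.act_eq_self, hs] at h4
      rcases h4 with h4 | h4
      · right; right; left
        grind
      · right; left
        grind
  · have hy : M.Mem (act (h.sq y) z) x y := M.mem_right h1
    have hz' := h.act_sq z
    rw [hs, act_add] at hz'
    rintro (rfl | rfl | rfl | rfl)
    · rwa [act_zero]
    · rwa [← hz', act_act]
    · exact hy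
    · rwa [act_add, hz']

/-- The squares form a subgroup of the Boolean part. -/
def squares : Submodule (ZMod 2) {b // M.B b} where
  carrier := Set.range h.sq
  zero_mem' := ⟨M.e, h.sq_e⟩
  add_mem' := by
    rintro _ _ ⟨x, rfl⟩ ⟨y, rfl⟩
    obtain ⟨z, w, hz⟩ := M.mul x y
    exact ⟨z, h.sq_mem (M.mem_left hz)⟩
  smul_mem' := by
    rintro c _ ⟨x, rfl⟩
    rcases zmod_two_cases c with rfl | rfl
    · exact ⟨M.e, by rw [zero_smul, h.sq_e]⟩
    · exact ⟨x, by rw [one_smul]⟩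

theorem sq_mem_squares (x : T) : h.sq x ∈ h.squares := ⟨x, rfl⟩

theorem exists_section : ∃ s : {b // M.B b} → T, s 0 = M.e ∧ ∀ u ∈ h.squares, h.sq (s u) = u := by
  classical
  have : ∀ u : {b // M.B b}, ∃ x : T, (u = 0 → x = M.e) ∧ (u ∈ h.squares → h.sq x = u) := by
    intro u
    by_cases h0 : u = 0
    · exact ⟨M.e, fun _ => rfl, fun _ => by rw [h0, h.sq_e]⟩
    by_cases hu : u ∈ h.squares
    · obtain ⟨x, hx⟩ := hu
      exact ⟨x, fun h1 => absurd h1 h0, fun _ => hx⟩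
    · exact ⟨M.e, fun _ => rfl, fun h1 => absurd h1 hu⟩
  choose s hs using this
  exact ⟨s, (hs 0).1 rfl, fun u hu => (hs u).2 hu⟩

theorem exists_cocycle {s : {b // M.B b} → T} (hs : ∀ u ∈ h.squares, h.sq (s u) = u) :
    ∃ β : {b // M.B b} → {b // M.B b} → {b // M.B b},
      ∀ u ∈ h.squares, ∀ v ∈ h.squares, M.Mem (act (β u v) (s (u + v))) (s u) (s v) := by
  have : ∀ u v : {b // M.B b}, ∃ d : {b // M.B b}, u ∈ h.squares → v ∈ h.squares →
      M.Mem (act d (s (u + v))) (s u) (s v) := by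
    intro u v
    by_cases huv : u ∈ h.squares ∧ v ∈ h.squares
    · obtain ⟨z, w, hz⟩ := M.mul (s u) (s v)
      have hz := M.mem_left hz
      have h1 : h.sq (s (u + v)) = h.sq z := by
        rw [h.sq_mem hz, hs _ (add_mem huv.1 huv.2), hs _ huv.1, hs _ huv.2]
      obtain ⟨b, rfl⟩ := h.exists_act h1
      exact ⟨b, fun _ _ => hz⟩
    · exact ⟨0, fun h1 h2 => absurd ⟨h1, h2⟩ huv⟩
  choose β hβ using this
  exact ⟨β, fun u hu v hv => hβ u v hu hv⟩

theorem add_mem_span {x y t : T} {d d' : {b // M.B b}} (h1 : M.Mem (act d t) x y)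
    (h2 : M.Mem (act d' t) x y) : d + d' ∈ span (ZMod 2) {h.sq x, h.sq y} := by
  rw [← h.mem_act_iff h2, act_add, act_act]
  exact h1

theorem spanCocycle {s : {b // M.B b} → T} (h0 : s 0 = M.e)
    (hs : ∀ u ∈ h.squares, h.sq (s u) = u) {β : {b // M.B b} → {b // M.B b} → {b // M.B b}}
    (hβ : ∀ u ∈ h.squares, ∀ v ∈ h.squares, M.Mem (act (β u v) (s (u + v))) (s u) (s v)) :
    SpanCocycle h.squares β where
  zero a ha := by
    have h1 := hβ a ha 0 (zero_mem _)
    rw [add_zero, h0] at h1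
    have h2 : M.Mem (s a) (s a) M.e := M.mem_of_dot (by rw [M.one, mul_one])
    rw [h.mem_act_iff h2, hs a ha, h.sq_e] at h1
    rw [mem_span_two] at h1
    rw [mem_span_one]
    simp only [add_zero] at h1
    tauto
  symm a ha b hb := by
    have h1 := hβ a ha b hb
    have h2 := (hβ b hb a ha).comm
    rw [add_comm b a] at h2
    have := h.add_mem_span h1 h2
    rwa [hs a ha, hs b hb] at this
  line a ha b hb := by
    have h1 := hβ a ha b hb
    have h2 := hβ _ (add_mem ha hb) b hb
    rw [bool_add_cancel_right] at h2
    have h3 := (h1.recip.comm).act_left (β a b)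
    rw [act_act] at h3
    have := h.add_mem_span h3 h2
    rw [hs _ (add_mem ha hb), hs b hb] at this
    refine (span_le.2 ?_ : span (ZMod 2) {a + b, b} ≤ _) this
    rintro y (rfl | rfl)
    · exact add_mem (subset_span (by simp)) (subset_span (by simp))
    · exact subset_span (by simp)
  assoc a ha b hb c hc := by
    have hbc := add_mem hb hc
    have h1 := hβ a ha b hb
    have h2 := (hβ _ (add_mem ha hb) c hc).act_left (β a b)
    have h3 := hβ b hb c hc
    have h4 := hβ a ha _ hbc
    obtain ⟨w, h5⟩ := h3
    have h6 : ∃ c', M.Mem c' (s b) (s c) ∧ M.Mem (act (β a b) (act (β (a + b) c) (s (a + b + c))))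
        (s a) c' := by
      rcases Mem.assoc h1 h2 h5 with h7 | h7
      exacts [⟨_, M.mem_left h5, h7⟩, ⟨_, M.mem_right h5, h7⟩]
    obtain ⟨c', hc', h7⟩ := h6
    have h3 := hβ b hb c hc
    obtain ⟨d, rfl⟩ := h.exists_act (x := s (b + c)) (y := c') (by
      rw [h.sq_mem hc', hs _ hbc, hs _ hb, hs _ hc])
    have hd := h.add_mem_span hc' h3
    rw [hs b hb, hs c hc] at hd
    have h8 := h7.act_right d
    rw [act_act, ← act_add, ← act_add] at h8
    rw [← add_assoc] at h4
    have h9 := h.add_mem_span h8 h4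
    rw [hs a ha, hs _ hbc] at h9
    have h10 : span (ZMod 2) {b, c} ≤ span (ZMod 2) {a, b, c} :=
      span_mono (by intro y; simp; tauto)
    have h11 : span (ZMod 2) {a, b + c} ≤ span (ZMod 2) {a, b, c} := by
      rw [span_le]
      rintro y (rfl | rfl)
      · exact subset_span (by simp)
      · exact add_mem (subset_span (by simp)) (subset_span (by simp))
    have h12 := add_mem (h10 hd) (h11 h9)
    convert h12 using 1
    have := bool_add_self d
    grind

/-- A twisted homomorphic section of the squaring map. -/
structure Section (S : {b // M.B b} → T) (ω : {b // M.B b} → {b // M.B b} → {b // M.B b}) :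
    Prop where
  zero : S 0 = M.e
  sq : ∀ u ∈ h.squares, h.sq (S u) = u
  mem : ∀ u ∈ h.squares, ∀ v ∈ h.squares, M.Mem (act (ω u v) (S (u + v))) (S u) (S v)

theorem exists_section_of_triv {s : {b // M.B b} → T} (h0 : s 0 = M.e)
    (hs : ∀ u ∈ h.squares, h.sq (s u) = u) {β ω : {b // M.B b} → {b // M.B b} → {b // M.B b}}
    (hβ : ∀ u ∈ h.squares, ∀ v ∈ h.squares, M.Mem (act (β u v) (s (u + v))) (s u) (s v))
    (ht : SpanTriv (fun a b => β a b + ω a b) h.squares) : ∃ S, h.Section S ω := by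
  obtain ⟨σ, hσ, ht⟩ := ht
  refine ⟨fun u => act (σ u) (s u), ?_, fun u hu => ?_, fun u hu v hv => ?_⟩
  · rw [hσ, act_zero, h0]
  · rw [h.sq_act, hs u hu]
  · have h1 := ht u hu v hv
    have h2 : M.Mem (act (σ v) (act (σ u) (act (β u v) (s (u + v))))) (act (σ u) (s u))
      (act (σ v) (s v)) := ((hβ u hu v hv).act_left (σ u)).act_right (σ v)
    have h3 := h.sq_act (σ u) (s u)
    have h4 := h.sq_act (σ v) (s v)
    rw [hs u hu] at h3
    rw [hs v hv] at h4
    have h5 := (h.mem_act_iff h2).2 (by rw [h3, h4]; exact h1)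
    convert h5 using 1
    simp only [← act_add]
    congr 1
    simp only [gauge]
    have e1 := bool_add_self (σ u)
    have e2 := bool_add_self (σ v)
    have e3 := bool_add_self (β u v)
    grind

theorem classify {F : Set {b // M.B b}} (hF : F.Finite) (hQ : h.squares = span (ZMod 2) F) :
    (∃ S, h.Section S (fun _ _ => 0)) ∨
      ∃ ω : {b // M.B b} →ₗ[ZMod 2] {b // M.B b} →ₗ[ZMod 2] {b // M.B b},
        (∀ a b, ω a b = ω b a) ∧ (∀ a, ω a a = a) ∧ ∃ S, h.Section S (fun a b => ω a b) := by
  obtain ⟨s, h0, hs⟩ := h.exists_section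
  obtain ⟨β, hβ⟩ := h.exists_cocycle hs
  rcases (h.spanCocycle h0 hs hβ).classify hF hQ with ht | ⟨ω, h1, h2, ht⟩
  · left
    exact h.exists_section_of_triv h0 hs hβ (by simpa using ht)
  · exact Or.inr ⟨ω, h1, h2, h.exists_section_of_triv h0 hs hβ ht⟩

end Quartic
end Model
end TwoValuedGroup

namespace TwoValuedGroup
namespace Model

open Submodule

variable {T : Type u} {R : Type v} [CommRing R] {M : Model T R}

namespace Quartic

variable (h : Quartic M)

theorem exists_span {S : Set T} (hf : S.Finite) (hS : M.Gen S) :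
    ∃ F : Set {b // M.B b}, F.Finite ∧ h.squares = span (ZMod 2) F := by
  refine ⟨h.sq '' S, hf.image _, le_antisymm ?_ ?_⟩
  · rintro _ ⟨x, rfl⟩
    refine hS {t | h.sq t ∈ span (ZMod 2) (h.sq '' S)} ?_ ?_ x
    · intro y₁ h₁ y₂ h₂ z hz
      show h.sq z ∈ span (ZMod 2) (h.sq '' S)
      rw [h.sq_mem hz]
      exact add_mem h₁ h₂
    · exact fun s hs => subset_span ⟨s, hs, rfl⟩
  · rw [span_le]
    rintro _ ⟨x, -, rfl⟩
    exact h.sq_mem_squares x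

namespace Section

variable {h} {S : {b // M.B b} → T} {ω : {b // M.B b} → {b // M.B b} → {b // M.B b}}

theorem mul_act (σ : h.Section S ω) (b c : {b // M.B b}) {u v : {b // M.B b}}
    (hu : u ∈ h.squares) (hv : v ∈ h.squares) :
    2 * M (act b (S u)) * M (act c (S v)) =
      M (act (b + c + ω u v) (S (u + v))) + M (act (v + (b + c + ω u v)) (S (u + v))) := by
  have h1 := h.mul_eq (((σ.mem u hu v hv).act_right c).act_left b)
  rw [h.sq_act, σ.sq v hv] at h1
  simpa only [← act_add, ← add_assoc] using h1

theorem act_inj (σ : h.Section S ω) {b c : {b // M.B b}} {u v : {b // M.B b}}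
    (hu : u ∈ h.squares) (hv : v ∈ h.squares) (hbc : act b (S u) = act c (S v)) :
    u = v ∧ (c = b ∨ c = b + u) := by
  have h1 := congrArg h.sq hbc
  rw [h.sq_act, h.sq_act, σ.sq u hu, σ.sq v hv] at h1
  subst h1
  refine ⟨rfl, ?_⟩
  have h2 : act (b + c) (S u) = S u := by
    rw [act_add, ← hbc, act_act]
  rw [h.act_eq_self, σ.sq u hu] at h2
  have := bool_add_cancel b c
  rcases h2 with h2 | h2
  · left; rw [← this, h2, add_zero]
  · right; rw [← this, h2]

theorem exists_rep (σ : h.Section S ω) (t : T) : ∃ b : {b // M.B b}, t = act b (S (h.sq t)) :=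
  h.exists_act (σ.sq _ (h.sq_mem_squares t))

theorem finite (σ : h.Section S (fun _ _ => 0)) {F : Set T} (hf : F.Finite) (hF : M.Gen F) :
    Finite {b // M.B b} := by
  obtain ⟨Q, hQf, hQ⟩ := h.exists_span hf hF
  choose β hβ using σ.exists_rep
  let U := span (ZMod 2) (β '' F ∪ Q)
  have hU : ∀ t, ∃ b ∈ U, ∃ u ∈ h.squares, act b (S u) = t := by
    refine hF {t | ∃ b ∈ U, ∃ u ∈ h.squares, act b (S u) = t} ?_ ?_
    · rintro _ ⟨b, hb, u, hu, rfl⟩ _ ⟨c, hc, v, hv, rfl⟩ z hz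
      have hvU : v ∈ U := by
        rw [hQ] at hv
        exact span_mono Set.subset_union_right hv
      rcases hz.eq (σ.mul_act b c hu hv) with rfl | rfl
      · exact ⟨_, by simpa using add_mem hb hc, _, add_mem hu hv, rfl⟩
      · exact ⟨_, by simpa using add_mem hvU (add_mem hb hc), _, add_mem hu hv, rfl⟩
    · intro s hs
      exact ⟨β s, subset_span (Or.inl ⟨s, hs, rfl⟩), _, h.sq_mem_squares s, (hβ s).symm⟩
  have htop : U = ⊤ := by
    rw [eq_top_iff]
    rintro b -
    obtain ⟨c, hc, u, hu, hcu⟩ := hU (act b (S 0))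
    rcases (σ.act_inj hu (zero_mem _) hcu) with ⟨rfl, rfl | rfl⟩
    · exact hc
    · rwa [add_zero]
  have : Module.Finite (ZMod 2) {b // M.B b} :=
    ⟨by rw [← htop]; exact fg_span ((hf.image _).union hQf)⟩
  exact Module.finite_of_finite (ZMod 2)

end Section

/-- The central extension of the squares by the Boolean part defined by a bilinear form. -/
structure Ext (ω : {b // M.B b} →ₗ[ZMod 2] {b // M.B b} →ₗ[ZMod 2] {b // M.B b}) where
  fst : {b // M.B b}
  snd : h.squares

variable {h} {ω : {b // M.B b} →ₗ[ZMod 2] {b // M.B b} →ₗ[ZMod 2] {b // M.B b}}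

noncomputable instance : Add (Ext h ω) := ⟨fun p q => ⟨p.fst + q.fst + ω p.snd q.snd, p.snd + q.snd⟩⟩

noncomputable instance : Zero (Ext h ω) := ⟨⟨0, 0⟩⟩

noncomputable instance : Neg (Ext h ω) := ⟨fun p => ⟨p.fst + p.snd, p.snd⟩⟩

theorem Ext.add_def (p q : Ext h ω) :
    p + q = ⟨p.fst + q.fst + ω p.snd q.snd, p.snd + q.snd⟩ := rfl

theorem Ext.zero_def : (0 : Ext h ω) = ⟨0, 0⟩ := rfl

theorem Ext.neg_def (p : Ext h ω) : -p = ⟨p.fst + p.snd, p.snd⟩ := rfl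

/-- The group structure on the extension. -/
@[reducible]
noncomputable def extGroup (hs : ∀ a b, ω a b = ω b a) (ha : ∀ a, ω a a = a) :
    AddCommGroup (Ext h ω) where
  add_assoc p q r := by
    simp only [Ext.add_def, Ext.mk.injEq, coe_add, map_add, LinearMap.add_apply]
    exact ⟨by abel, add_assoc _ _ _⟩
  zero_add p := by
    simp [Ext.add_def, Ext.zero_def]
  add_zero p := by
    simp [Ext.add_def, Ext.zero_def]
  nsmul := nsmulRec
  zsmul := zsmulRec
  neg_add_cancel p := by
    simp only [Ext.add_def, Ext.zero_def, Ext.neg_def, Ext.mk.injEq, ha]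
    refine ⟨?_, Subtype.ext (bool_add_self _)⟩
    have e1 := bool_add_self p.fst
    have e2 := bool_add_self (p.snd : {b // M.B b})
    grind
  add_comm p q := by
    simp only [Ext.add_def, Ext.mk.injEq]
    exact ⟨by rw [hs, add_comm p.fst], add_comm _ _⟩

theorem B_all_of_squares_eq_bot (hQ : h.squares = ⊥) (x : T) : M.B x := by
  rw [← h.sq_eq_zero, ← mem_bot (ZMod 2), ← hQ]
  exact h.sq_mem_squares x

end Quartic
end Model

open Model Quartic

variable {T : Type u} {R : Type v} [CommRing R] {M : Model T R} {X : TwoValuedGroup T}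

theorem Models.princ_of_twisted (hX : Models M X) (hi : X.Involutive) {h : Quartic M}
    {ω : {b // M.B b} →ₗ[ZMod 2] {b // M.B b} →ₗ[ZMod 2] {b // M.B b}}
    (hs : ∀ a b, ω a b = ω b a) (ha : ∀ a, ω a a = a) {S : {b // M.B b} → T}
    (σ : h.Section S (fun a b => ω a b)) {F : Set T} (hf : F.Finite) (hF : M.Gen F) :
    ∃ lab, ValidLabel lab ∧ Realizes X lab := by
  let _ : AddCommGroup (Ext h ω) := extGroup hs ha
  have D : DAl M (fun p : Ext h ω => act p.fst (S p.snd)) := by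
    refine ⟨?_, fun p q => ?_⟩
    · show act 0 (S 0) = M.e
      rw [act_zero, σ.zero]
    · rw [σ.mul_act _ _ p.snd.2 q.snd.2]
      have : p - q = ⟨p.fst + (q.fst + q.snd) + ω p.snd q.snd, p.snd + q.snd⟩ :=
        sub_eq_add_neg p q
      have h2 : p + q = ⟨p.fst + q.fst + ω p.snd q.snd, p.snd + q.snd⟩ := rfl
      rw [this, h2]
      simp only [Submodule.coe_add]
      congr 3
      abel
  refine hX.princ_of_dAl hi D (fun p hp => ?_) (fun t => ?_) hf hF
  · have h1 : act p.fst (S p.snd) = act (0 : {b // M.B b}) (S 0) := by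
      rw [act_zero, σ.zero]; exact hp
    obtain ⟨h2, h3⟩ := σ.act_inj p.snd.2 (zero_mem _) h1
    rw [h2, add_zero, or_self] at h3
    show p = Ext.mk 0 0
    obtain ⟨a, b⟩ := p
    rw [Ext.mk.injEq]
    exact ⟨h3.symm, Subtype.ext h2⟩
  · obtain ⟨b, hb⟩ := σ.exists_rep t
    exact ⟨⟨b, ⟨_, h.sq_mem_squares t⟩⟩, hb.symm⟩

theorem Models.label_of_untwisted (hX : Models M X) (hi : X.Involutive) {h : Quartic M}
    {S : {b // M.B b} → T} (σ : h.Section S (fun _ _ => 0)) {F : Set T} (hf : F.Finite)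
    (hF : M.Gen F) : ∃ lab, ValidLabel lab ∧ Realizes X lab := by
  by_cases hQ : h.squares = ⊥
  · refine hX.princ_of_dAl hi boolGroup_dAl (fun a ha => Subtype.ext ha)
      (fun t => ⟨⟨t, B_all_of_squares_eq_bot hQ t⟩, rfl⟩) hf hF
  have := σ.finite hf hF
  obtain ⟨n, ψ, hψ, hψ1, hψs⟩ := exists_complement (H := h.squares)
    (fun x => Subtype.ext (bool_add_self _)) ⊥
  obtain ⟨m, φ, hφ, hφ1, hφs⟩ := exists_complement (H := {b // M.B b}) bool_add_self
    h.squares.toAddSubgroup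
  have hψi : ∀ a b, ψ a = ψ b → a = b := fun a b hab => by
    rw [← c2vec_mul_eq_one]
    apply hψ1
    rw [hψ, hab, AddSubgroup.mem_bot]
    exact Subtype.ext (bool_add_self _)
  have hψs' : ∀ x : h.squares, ∃ v, ψ v = x := fun x => by
    obtain ⟨k, hk, v, hv⟩ := hψs x
    rw [AddSubgroup.mem_bot] at hk
    exact ⟨v, by rw [hv, hk, zero_add]⟩
  have hψc : ∀ a b, (ψ (a * b) : {b // M.B b}) = ψ a + ψ b := fun a b => by rw [hψ]; rfl
  refine ⟨.unip n m, ?_, fun p => act (ψ p.1.2 + φ p.2 : {b // M.B b}) (S (ψ p.1.1)),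
    ?_, ?_, ?_, ?_, ?_, ?_⟩
  · show 1 ≤ n
    by_contra hn
    obtain rfl : n = 0 := by omega
    apply hQ
    rw [eq_bot_iff]
    intro x hx
    obtain ⟨v, hv⟩ := hψs' ⟨x, hx⟩
    rw [Subsingleton.elim v 1, hom_one hψ] at hv
    exact (congrArg Subtype.val hv).symm
  · intro t
    obtain ⟨b, hb⟩ := σ.exists_rep t
    obtain ⟨k, hk, w, rfl⟩ := hφs b
    obtain ⟨v, hv⟩ := hψs' ⟨k, hk⟩
    obtain ⟨v', hv'⟩ := hψs' ⟨_, h.sq_mem_squares t⟩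
    exact ⟨((v', v), w), by
      beta_reduce
      rw [hv, hv']
      exact hb.symm⟩
  · beta_reduce
    rw [hom_one hψ, hom_one hφ, ← hX.e_eq, ← σ.zero]
    show act (0 + 0) _ = _
    rw [add_zero, act_zero]
    rfl
  · intro a b w
    have := h.act_eq_self.2 (Or.inr (σ.sq _ (ψ a).2).symm)
    beta_reduce
    rw [hψc, add_assoc, add_comm, act_add, this]
  · rintro ⟨⟨a, b⟩, w⟩ ⟨⟨a', b'⟩, w'⟩ hpq
    obtain ⟨h1, h2⟩ := σ.act_inj (ψ a).2 (ψ a').2 hpq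
    obtain rfl := hψi _ _ (Subtype.ext h1)
    have hw : w' = w := by
      rw [← c2vec_mul_eq_one]
      apply hφ1
      rw [hφ]
      have e1 := bool_add_self (φ w)
      have e2 := bool_add_self (ψ b' : {b // M.B b})
      dsimp only at h2
      rcases h2 with h2 | h2
      · have : φ w' + φ w = ψ b + ψ b' := by grind
        rw [this]
        exact add_mem (ψ b).2 (ψ b').2
      · have : φ w' + φ w = ψ b + ψ b' + ψ a := by grind
        rw [this]
        exact add_mem (add_mem (ψ b).2 (ψ b').2) (ψ a).2
    subst hw
    refine ⟨rfl, ?_⟩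
    dsimp only at h2
    rcases h2 with h2 | h2
    · left
      rw [hψi b' b (Subtype.ext (add_right_cancel h2))]
    · right
      have : (ψ b' : {b // M.B b}) = ψ (a * b) := by
        rw [hψc]
        exact add_right_cancel (b := φ w') (by rw [h2]; abel)
      rw [hψi _ _ (Subtype.ext this)]
  · intro a₁ b₁ a₂ b₂ w₁ w₂
    beta_reduce
    rw [hX.mul_iff, σ.mul_act _ _ (ψ a₁).2 (ψ a₂).2]
    simp only [hψc, hφ, add_zero]
    congr 3
    · abel
    · abel
  · intro p
    exact hi _

theorem exists_label {T : Type u} (X : TwoValuedGroup T) (hc : X.Commutative)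
    (hi : X.Involutive) (hfg : X.FinitelyGenerated) :
    ∃ lab : ListedLabel, ValidLabel lab ∧ Realizes X lab := by
  obtain ⟨F, hf, hF⟩ := hfg
  obtain ⟨R, _, M, he, hm⟩ := exists_model hc hi
  have hX : Models M X := ⟨he, hm⟩
  have hF := hX.gen hF
  by_cases hns : M.NS
  · by_cases hq : ∀ x, M.B (M.q x)
    · have h : Quartic M := ⟨hns, hq⟩
      obtain ⟨Q, hQf, hQ⟩ := h.exists_span hf hF
      rcases h.classify hQf hQ with ⟨S, σ⟩ | ⟨ω, hs, ha, S, σ⟩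
      · exact hX.label_of_untwisted hi σ hf hF
      · exact hX.princ_of_twisted hi hs ha σ hf hF
    · push Not at hq
      obtain ⟨x, hx⟩ := hq
      obtain ⟨G, _, π, D, -, hπ⟩ := hns.exists_dAl hx hf
      exact hX.princ_of_dAl hi D.toDAl D.ker_trivial (D.toDAl.surjective hF hπ) hf hF
  · simp only [NS, not_forall, not_or] at hns
    obtain ⟨x, y, z, hz, hx, hy⟩ := hns
    refine hX.spec_of_oneSquare hi (s := M.q x) ⟨(special_q hz hx hy).1, hx, fun w => ?_⟩
      ⟨x, hx⟩ hf hF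
    exact special_squares hz hx hy w

end TwoValuedGroup

namespace TwoValuedGroup

theorem pair_eq_pair_iff {T : Type u} {a b c d : T} :
    ({a, b} : Multiset T) = {c, d} ↔ (a = c ∧ b = d) ∨ (a = d ∧ b = c) := by
  rw [Multiset.insert_eq_cons, Multiset.insert_eq_cons, Multiset.cons_eq_cons]
  constructor
  · rintro (⟨rfl, h⟩ | ⟨-, s, h1, h2⟩)
    · exact Or.inl ⟨rfl, Multiset.singleton_inj.1 h⟩
    · rw [Multiset.singleton_eq_cons_iff] at h1 h2
      exact Or.inr ⟨h2.1.symm, h1.1⟩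
  · rintro (⟨rfl, rfl⟩ | ⟨rfl, rfl⟩)
    · exact Or.inl ⟨rfl, rfl⟩
    · by_cases h : a = b
      · exact Or.inl ⟨h, by rw [h]⟩
      · exact Or.inr ⟨h, 0, rfl, rfl⟩

theorem map_pair {T : Type u} {S : Type v} (f : T → S) (a b : T) :
    Multiset.map f {a, b} = {f a, f b} := by
  simp [Multiset.insert_eq_cons]

variable {S₁ : Type v} {S₂ : Type w} {Y₁ : TwoValuedGroup S₁} {Y₂ : TwoValuedGroup S₂}

theorem IsHom.map_inv {f : S₁ → S₂} (h : IsHom Y₁ Y₂ f) (x : S₁) : f (Y₁.inv x) = Y₂.inv (f x) := by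
  apply Y₂.inv_unique
  left
  rw [← h.1, ← h.2]
  exact Multiset.mem_map_of_mem f (Y₁.e_mem_mul_inv x)

theorem Isomorphic.realizes (h : Isomorphic Y₁ Y₂) {lab : ListedLabel} (h₁ : Realizes Y₁ lab) :
    Realizes Y₂ lab := by
  obtain ⟨f, hf, hh⟩ := h
  cases lab with
  | princ k d =>
    obtain ⟨π, hs, h1, hn, hfib, hm, hi⟩ := h₁
    refine ⟨f ∘ π, hf.2.comp hs, ?_, fun a => congrArg f (hn a), fun a b hab => hfib a b (hf.1 hab),
      fun a b => ?_, fun a => ?_⟩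
    · rw [Function.comp_apply, h1, hh.1]
    · simp only [Function.comp_apply]
      rw [← hh.2, hm, map_pair]
    · simp only [Function.comp_apply]
      rw [← hh.map_inv, hi]
  | unip n m =>
    obtain ⟨π, hs, h1, hn, hfib, hm, hi⟩ := h₁
    refine ⟨f ∘ π, hf.2.comp hs, ?_, fun a b w => congrArg f (hn a b w),
      fun a b hab => hfib a b (hf.1 hab), fun a₁ b₁ a₂ b₂ w₁ w₂ => ?_, fun a => ?_⟩
    · rw [Function.comp_apply, h1, hh.1]
    · simp only [Function.comp_apply]
      rw [← hh.2, hm, map_pair]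
    · simp only [Function.comp_apply]
      rw [← hh.map_inv, hi]
  | spec n m =>
    obtain ⟨π, hs, h1, hm, hi⟩ := h₁
    refine ⟨f ∘ π, hf.comp hs, ?_, fun a b w₁ w₂ => ?_, fun a => ?_⟩
    · rw [Function.comp_apply, h1, hh.1]
    · simp only [Function.comp_apply]
      rw [← hh.2, hm, Multiset.map_map]
      rfl
    · simp only [Function.comp_apply]
      rw [← hh.map_inv, hi]

theorem isomorphic_of_common {G : Type u} {π₁ : G → S₁} {π₂ : G → S₂}
    (hs₁ : Function.Surjective π₁) (hs₂ : Function.Surjective π₂)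
    (hk : ∀ a b, π₁ a = π₁ b ↔ π₂ a = π₂ b) {e : G} (he₁ : π₁ e = Y₁.e) (he₂ : π₂ e = Y₂.e)
    (hm : ∀ a b, ∃ s : Multiset G, Y₁.mul (π₁ a) (π₁ b) = s.map π₁ ∧
      Y₂.mul (π₂ a) (π₂ b) = s.map π₂) : Isomorphic Y₁ Y₂ := by
  have hσ := Function.surjInv_eq hs₁
  have hf : ∀ a, π₂ (Function.surjInv hs₁ (π₁ a)) = π₂ a := fun a => (hk _ _).1 (hσ (π₁ a))
  refine ⟨fun x => π₂ (Function.surjInv hs₁ x), ⟨fun x y hxy => ?_, fun y => ?_⟩, ?_,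
    fun x y => ?_⟩
  · have := (hk _ _).2 hxy
    rwa [hσ, hσ] at this
  · obtain ⟨a, rfl⟩ := hs₂ y
    exact ⟨π₁ a, hf a⟩
  · beta_reduce
    rw [← he₁, hf, he₂]
  · obtain ⟨a, rfl⟩ := hs₁ x
    obtain ⟨b, rfl⟩ := hs₁ y
    obtain ⟨s, h1, h2⟩ := hm a b
    simp only [hf]
    rw [h1, h2, Multiset.map_map]
    exact Multiset.map_congr rfl fun a _ => hf a

theorem isomorphic_of_realizes {lab : ListedLabel} (h₁ : Realizes Y₁ lab) (h₂ : Realizes Y₂ lab) :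
    Isomorphic Y₁ Y₂ := by
  cases lab with
  | princ k d =>
    obtain ⟨π, hs, h1, hn, hf, hm, -⟩ := h₁
    obtain ⟨π', hs', h1', hn', hf', hm', -⟩ := h₂
    refine isomorphic_of_common hs hs' (fun a b => ⟨fun h => ?_, fun h => ?_⟩) h1 h1'
      fun a b => ⟨{a * b, a * b⁻¹}, by rw [hm, map_pair], by rw [hm', map_pair]⟩
    · rcases hf _ _ h with rfl | rfl
      exacts [rfl, (hn' _).symm]
    · rcases hf' _ _ h with rfl | rfl
      exacts [rfl, (hn _).symm]
  | unip n m =>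
    obtain ⟨π, hs, h1, hn, hf, hm, -⟩ := h₁
    obtain ⟨π', hs', h1', hn', hf', hm', -⟩ := h₂
    refine isomorphic_of_common hs hs' ?_ h1 h1' ?_
    · rintro ⟨⟨a, b⟩, w⟩ ⟨⟨a', b'⟩, w'⟩
      constructor
      · intro h
        obtain ⟨h2, h3⟩ := hf _ _ h
        dsimp only at h2 h3
        rcases h3 with h3 | h3
        · rw [h2, h3]
        · rw [h2, h3, hn']
      · intro h
        obtain ⟨h2, h3⟩ := hf' _ _ h
        dsimp only at h2 h3
        rcases h3 with h3 | h3
        · rw [h2, h3]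
        · rw [h2, h3, hn]
    · rintro ⟨⟨a₁, b₁⟩, w₁⟩ ⟨⟨a₂, b₂⟩, w₂⟩
      exact ⟨{((a₁ * a₂, b₁ * b₂), w₁ * w₂), ((a₁ * a₂, a₂ * b₁ * b₂), w₁ * w₂)},
        by rw [hm, map_pair], by rw [hm', map_pair]⟩
  | spec n m =>
    obtain ⟨π, hs, h1, hm, -⟩ := h₁
    obtain ⟨π', hs', h1', hm', -⟩ := h₂
    refine isomorphic_of_common hs.2 hs'.2 (fun a b => ?_) h1 h1' ?_
    · rw [hs.1.eq_iff, hs'.1.eq_iff]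
    · rintro ⟨x, w₁⟩ ⟨y, w₂⟩
      refine ⟨(mulY x y).map fun z => (z, w₁ * w₂), ?_, ?_⟩
      · rw [hm, Multiset.map_map]; rfl
      · rw [hm', Multiset.map_map]; rfl

/-- A distinguished representative of each class of coinciding labels. -/
def canon : ListedLabel → ListedLabel
  | .princ k d => .princ k d
  | .unip 1 m => .princ (m + 1) (dSeqA m)
  | .unip 2 m => .princ (m + 2) (dSeqB m)
  | .unip n m => .unip n m
  | .spec 1 m => .princ (m + 1) (dSeqA m)
  | .spec n m => .spec n m

theorem dSeqA_ne_dSeqB {m m' : ℕ} :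
    ListedLabel.princ (m + 1) (dSeqA m) ≠ .princ (m' + 2) (dSeqB m') := by
  intro h
  rw [ListedLabel.princ.injEq] at h
  obtain ⟨h1, h2⟩ := h
  obtain rfl : m = m' + 1 := by omega
  have := congrFun (eq_of_heq h2) ⟨m', by omega⟩
  simp [dSeqA, dSeqB] at this

theorem canon_eq_cases (l : ListedLabel) : canon l = l ∨
    (∃ m, canon l = .princ (m + 1) (dSeqA m) ∧ (l = .unip 1 m ∨ l = .spec 1 m)) ∨
    ∃ m, canon l = .princ (m + 2) (dSeqB m) ∧ l = .unip 2 m := by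
  unfold canon
  split <;> simp

theorem sameClass_iff_canon {l₁ l₂ : ListedLabel} : SameClass l₁ l₂ ↔ canon l₁ = canon l₂ := by
  constructor
  · rintro (rfl | ⟨m, h₁, h₂⟩ | ⟨m, h₁, h₂⟩)
    · rfl
    · rcases h₁ with rfl | rfl | rfl <;> rcases h₂ with rfl | rfl | rfl <;> rfl
    · rcases h₁ with rfl | rfl <;> rcases h₂ with rfl | rfl <;> rfl
  · intro h
    have hA : ∀ m m', ListedLabel.princ (m + 1) (dSeqA m) = .princ (m' + 1) (dSeqA m') → m = m' :=
      fun m m' h => by injection h with h1 h2; omega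
    have hB : ∀ m m', ListedLabel.princ (m + 2) (dSeqB m) = .princ (m' + 2) (dSeqB m') → m = m' :=
      fun m m' h => by injection h with h1 h2; omega
    rcases canon_eq_cases l₁ with h1 | ⟨m, h1, h1'⟩ | ⟨m, h1, h1'⟩ <;>
    rcases canon_eq_cases l₂ with h2 | ⟨m', h2, h2'⟩ | ⟨m', h2, h2'⟩ <;>
    rw [h1, h2] at h
    · exact Or.inl h
    · exact Or.inr (Or.inl ⟨m', Or.inl h, Or.inr h2'⟩)
    · exact Or.inr (Or.inr ⟨m', Or.inl h, Or.inr h2'⟩)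
    · exact Or.inr (Or.inl ⟨m, Or.inr h1', Or.inl h.symm⟩)
    · obtain rfl := hA _ _ h
      exact Or.inr (Or.inl ⟨m, Or.inr h1', Or.inr h2'⟩)
    · exact absurd h dSeqA_ne_dSeqB
    · exact Or.inr (Or.inr ⟨m, Or.inr h1', Or.inl h.symm⟩)
    · exact absurd h.symm dSeqA_ne_dSeqB
    · obtain rfl := hB _ _ h
      exact Or.inr (Or.inr ⟨m, Or.inr h1', Or.inr h2'⟩)

theorem validLabel_canon {l : ListedLabel} (h : ValidLabel l) : ValidLabel (canon l) := by
  have key : ∀ (k m : ℕ), ValidLabel (.princ k fun i => if i.1 < m then 2 else 4) := by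
    refine fun k m => ⟨fun i => ?_, fun i j hij => ?_⟩
    · beta_reduce
      split <;> decide
    · have : i.1 ≤ j.1 := hij
      beta_reduce
      split <;> split <;> omega
  rcases canon_eq_cases l with h1 | ⟨m, h1, -⟩ | ⟨m, h1, -⟩
  · rwa [h1]
  · rw [h1]; exact key _ m
  · rw [h1]; exact key _ m

end TwoValuedGroup

namespace TwoValuedGroup

variable {S : Type v} {Y : TwoValuedGroup S}

theorem exists_mulEquiv_of_two_four (m r : ℕ) (d : Fin (m + r) → ℕ)
    (hd : ∀ i, d i = if i.1 < m then 2 else 4) :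
    Nonempty ((∀ i, Multiplicative (ZMod (d i))) ≃* C2vec m × C4vec r) := by
  have h2 : ∀ j : Fin m, d (Fin.castAdd r j) = 2 := fun j => by simp [hd]
  have h4 : ∀ j : Fin r, d (Fin.natAdd m j) = 4 := fun j => by simp [hd]
  let c : ∀ {a b : ℕ}, a = b → Multiplicative (ZMod a) ≃* Multiplicative (ZMod b) :=
    fun h => (ZMod.ringEquivCongr h).toAddEquiv.toMultiplicative
  let θ : (∀ i, Multiplicative (ZMod (d i))) →* C2vec m × C4vec r :=
    { toFun := fun x => (fun j => c (h2 j) (x _), fun j => c (h4 j) (x _))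
      map_one' := by simp only [Pi.one_apply, map_one]; rfl
      map_mul' := fun x y => by simp only [Pi.mul_apply, map_mul]; rfl }
  refine ⟨MulEquiv.ofBijective θ ⟨fun x y hxy => ?_, fun y => ?_⟩⟩
  · funext i
    have h1 := congrArg Prod.fst hxy
    have h2 := congrArg Prod.snd hxy
    refine Fin.addCases (fun j => ?_) (fun j => ?_) i
    · exact (c _).injective (congrFun h1 j)
    · exact (c _).injective (congrFun h2 j)
  · refine ⟨Fin.addCases (fun j => (c (h2 j)).symm (y.1 j)) (fun j => (c (h4 j)).symm (y.2 j)), ?_⟩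
    refine Prod.ext (funext fun j => ?_) (funext fun j => ?_)
    · exact (congrArg (c (h2 j)) (Fin.addCases_left j)).trans ((c (h2 j)).apply_symm_apply _)
    · exact (congrArg (c (h4 j)) (Fin.addCases_right j)).trans ((c (h4 j)).apply_symm_apply _)

theorem IsAntipodalCosetOf.congr {A : Type u} {B : Type w} [CommGroup A] [CommGroup B]
    (h : IsAntipodalCosetOf Y A) (θ : B ≃* A) : IsAntipodalCosetOf Y B := by
  obtain ⟨π, hs, h1, hn, hf, hm, hi⟩ := h
  refine ⟨fun b => π (θ b), hs.comp θ.surjective, by simp [h1], by simp [hn], fun a b hab => ?_,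
    by simp [hm], by simp [hi]⟩
  rcases hf _ _ hab with h | h
  · exact Or.inl (θ.injective h)
  · exact Or.inr (θ.injective (by rw [h, map_inv]))

/-- The reduction modulo two. -/
def lowBit {n : ℕ} (a : C4vec n) : C2vec n :=
  fun i => .ofAdd (if a i = .ofAdd 1 ∨ a i = .ofAdd 3 then 1 else 0)

/-- The second binary digit. -/
def highBit {n : ℕ} (a : C4vec n) : C2vec n :=
  fun i => .ofAdd (if a i = .ofAdd 2 ∨ a i = .ofAdd 3 then 1 else 0)

/-- The carry in the addition of binary digits. -/
def carry {n : ℕ} (u v : C2vec n) : C2vec n :=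
  fun i => .ofAdd ((u i).toAdd * (v i).toAdd)

theorem lowBit_mul {n : ℕ} (a b : C4vec n) : lowBit (a * b) = lowBit a * lowBit b := by
  have : ∀ x y : Multiplicative (ZMod 4),
      (.ofAdd (if x * y = .ofAdd 1 ∨ x * y = .ofAdd 3 then 1 else 0) : Multiplicative (ZMod 2)) =
      .ofAdd (if x = .ofAdd 1 ∨ x = .ofAdd 3 then 1 else 0) *
      .ofAdd (if y = .ofAdd 1 ∨ y = .ofAdd 3 then 1 else 0) := by decide
  exact funext fun i => this _ _

theorem highBit_mul {n : ℕ} (a b : C4vec n) :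
    highBit (a * b) = carry (lowBit a) (lowBit b) * (highBit a * highBit b) := by
  have : ∀ x y : Multiplicative (ZMod 4),
      (.ofAdd (if x * y = .ofAdd 2 ∨ x * y = .ofAdd 3 then 1 else 0) : Multiplicative (ZMod 2)) =
      .ofAdd ((if x = .ofAdd 1 ∨ x = .ofAdd 3 then 1 else 0) *
        (if y = .ofAdd 1 ∨ y = .ofAdd 3 then 1 else 0)) *
      (.ofAdd (if x = .ofAdd 2 ∨ x = .ofAdd 3 then 1 else 0) *
      .ofAdd (if y = .ofAdd 2 ∨ y = .ofAdd 3 then 1 else 0)) := by decide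
  exact funext fun i => this _ _

theorem lowBit_inv {n : ℕ} (a : C4vec n) : lowBit a⁻¹ = lowBit a := by
  have : ∀ x : Multiplicative (ZMod 4),
      (.ofAdd (if x⁻¹ = .ofAdd 1 ∨ x⁻¹ = .ofAdd 3 then 1 else 0) : Multiplicative (ZMod 2)) =
      .ofAdd (if x = .ofAdd 1 ∨ x = .ofAdd 3 then 1 else 0) := by decide
  exact funext fun i => this _

theorem highBit_inv {n : ℕ} (a : C4vec n) : highBit a⁻¹ = lowBit a * highBit a := by
  have : ∀ x : Multiplicative (ZMod 4),
      (.ofAdd (if x⁻¹ = .ofAdd 2 ∨ x⁻¹ = .ofAdd 3 then 1 else 0) : Multiplicative (ZMod 2)) =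
      .ofAdd (if x = .ofAdd 1 ∨ x = .ofAdd 3 then 1 else 0) *
      .ofAdd (if x = .ofAdd 2 ∨ x = .ofAdd 3 then 1 else 0) := by decide
  exact funext fun i => this _

theorem bits_injective {n : ℕ} {a b : C4vec n} (h₁ : lowBit a = lowBit b)
    (h₂ : highBit a = highBit b) : a = b := by
  have : ∀ x y : Multiplicative (ZMod 4),
      (.ofAdd (if x = .ofAdd 1 ∨ x = .ofAdd 3 then 1 else 0) : Multiplicative (ZMod 2)) =
      .ofAdd (if y = .ofAdd 1 ∨ y = .ofAdd 3 then 1 else 0) →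
      (.ofAdd (if x = .ofAdd 2 ∨ x = .ofAdd 3 then 1 else 0) : Multiplicative (ZMod 2)) =
      .ofAdd (if y = .ofAdd 2 ∨ y = .ofAdd 3 then 1 else 0) → x = y := by decide
  exact funext fun i => this _ _ (congrFun h₁ i) (congrFun h₂ i)

theorem bits_surjective {n : ℕ} (u v : C2vec n) : ∃ a : C4vec n, lowBit a = u ∧ highBit a = v := by
  have : ∀ x y : Multiplicative (ZMod 2), ∃ a : Multiplicative (ZMod 4),
      .ofAdd (if a = .ofAdd 1 ∨ a = .ofAdd 3 then 1 else 0) = x ∧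
      .ofAdd (if a = .ofAdd 2 ∨ a = .ofAdd 3 then 1 else 0) = y := by decide
  choose f hf using this
  exact ⟨fun i => f (u i) (v i), funext fun i => (hf _ _).1, funext fun i => (hf _ _).2⟩

theorem carry_cases {n : ℕ} (hn : n = 1 ∨ n = 2) (u v : C2vec n) :
    carry u v = 1 ∨ carry u v = u ∨ carry u v = v ∨ carry u v = u * v := by
  rcases hn with rfl | rfl <;> revert u v <;> decide

theorem IsUnipotentCosetProdOf.antipodal {n m : ℕ} (hn : n = 1 ∨ n = 2)
    (h : IsUnipotentCosetProdOf Y (C2vec n) (C2vec m)) :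
    IsAntipodalCosetOf Y (C2vec m × C4vec n) := by
  obtain ⟨f, hs, h1, hinv, hf, hm, hi⟩ := h
  have hw : ∀ w : C2vec m, w⁻¹ = w := fun w => inv_eq_of_mul_eq_one_left (c2vec_mul_self w)
  have hneg : ∀ a : C2vec m × C4vec n, f ((lowBit a⁻¹.2, highBit a⁻¹.2), a⁻¹.1) =
      f ((lowBit a.2, highBit a.2), a.1) := fun a => by
    rw [Prod.snd_inv, Prod.fst_inv, lowBit_inv, highBit_inv, hw, hinv]
  refine ⟨fun a => f ((lowBit a.2, highBit a.2), a.1), ?_, ?_, hneg, ?_, ?_, fun a => ?_⟩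
  · intro t
    obtain ⟨⟨⟨u, v⟩, w⟩, rfl⟩ := hs t
    obtain ⟨a, rfl, rfl⟩ := bits_surjective u v
    exact ⟨(w, a), rfl⟩
  · rw [← h1]
    rfl
  · rintro ⟨w, a⟩ ⟨w', a'⟩ h
    obtain ⟨h2, h3⟩ := hf _ _ h
    dsimp only at h2 h3
    subst h2
    rcases h3 with h3 | h3 <;> rw [Prod.mk.injEq] at h3
    · left
      rw [bits_injective h3.1 h3.2]
    · right
      have : a' = a⁻¹ := bits_injective (by rw [lowBit_inv, h3.1]) (by rw [highBit_inv, h3.2])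
      rw [this, Prod.inv_mk, hw]
  · rintro ⟨w, a⟩ ⟨w', a'⟩
    dsimp only
    rw [hm, Prod.inv_mk, Prod.mk_mul_mk, Prod.mk_mul_mk, hw, lowBit_mul, lowBit_mul, highBit_mul,
      highBit_mul, lowBit_inv, highBit_inv]
    have hc := carry_cases hn (lowBit a) (lowBit a')
    generalize lowBit a = u at *
    generalize lowBit a' = u' at *
    generalize highBit a = x at *
    generalize highBit a' = x' at *
    have e := c2vec_mul_self u'
    have key := hinv (u * u')
    rcases hc with hc | hc | hc | hc <;> rw [hc, pair_eq_pair_iff]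
    · left
      exact ⟨by rw [one_mul], by rw [one_mul]; congr 3; ac_rfl⟩
    · right
      constructor
      · rw [← key]; congr 3; ac_rfl
      · rw [← key]; congr 3
        calc _ = u * (u' * u') * (x * x') := by ac_rfl
          _ = _ := by rw [e, mul_one]
    · right
      constructor
      · congr 3
        calc _ = (u' * u') * (x * x') := by rw [e, one_mul]
          _ = _ := by ac_rfl
      · congr 3; ac_rfl
    · left
      constructor
      · exact (key _ _).symm
      · rw [← key]; congr 3; ac_rfl
  · exact (hi _).trans (hneg a).symm

theorem c2vec_one_cases : ∃ g : C2vec 1, g ≠ 1 ∧ ∀ a : C2vec 1, a = 1 ∨ a = g :=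
  ⟨fun _ => .ofAdd 1, by decide, by decide⟩

theorem IsYProdOf.unipotent {m : ℕ} (h : IsYProdOf Y (C2vec 1) (C2vec m)) :
    IsUnipotentCosetProdOf Y (C2vec 1) (C2vec m) := by
  classical
  obtain ⟨f, hb, h1, hm, hi⟩ := h
  obtain ⟨g, hg, hg'⟩ := c2vec_one_cases
  have hgg := c2vec_mul_self g
  let o : C2vec 1 → C2vec 1 → Option (C2vec 1) := fun a b =>
    if a = 1 then (if b = 1 then some 1 else none) else some g
  have o1 : o 1 1 = some 1 := by simp [o]
  have o2 : o 1 g = none := by simp [o, hg]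
  have o3 : o g 1 = some g := by simp [o, hg]
  have o4 : o g g = some g := by simp [o, hg]
  refine ⟨fun p => f (o p.1.1 p.1.2, p.2), ?_, ?_, ?_, ?_, ?_, fun p => hi _⟩
  · intro t
    obtain ⟨⟨x, w⟩, rfl⟩ := hb.2 t
    rcases x with _ | x
    · exact ⟨((1, g), w), by simp only [o2]⟩
    · rcases hg' x with rfl | rfl
      · exact ⟨((1, 1), w), by simp only [o1]⟩
      · exact ⟨((x, 1), w), by simp only [o3]⟩
  · simp only [o1, h1]
  · intro a b w
    rcases hg' a with rfl | rfl <;> rcases hg' b with rfl | rfl <;> simp [o3, o4, hgg]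
  · rintro ⟨⟨a, b⟩, w⟩ ⟨⟨a', b'⟩, w'⟩ h
    have h2 := hb.1 h
    rw [Prod.mk.injEq] at h2
    dsimp only at h2
    refine ⟨h2.2.symm, ?_⟩
    replace h2 := h2.1
    rcases hg' a with rfl | rfl <;> rcases hg' b with rfl | rfl <;> rcases hg' a' with rfl | rfl <;>
      rcases hg' b' with rfl | rfl <;> simp_all
  · intro a₁ b₁ a₂ b₂ w₁ w₂
    dsimp only
    rw [hm]
    rcases hg' a₁ with rfl | rfl <;> rcases hg' b₁ with rfl | rfl <;> rcases hg' a₂ with rfl | rfl <;>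
      rcases hg' b₂ with rfl | rfl <;> simp [o1, o2, o3, o4, mulY, hg, hg.symm, hgg] <;>
      exact Multiset.cons_swap _ _ 0

theorem Realizes.canon {l : ListedLabel} (h : Realizes Y l) : Realizes Y (canon l) := by
  have key : ∀ n m, (n = 1 ∨ n = 2) → Realizes Y (.unip n m) →
      Realizes Y (.princ (m + n) fun i => if i.1 < m then 2 else 4) := by
    intro n m hn h
    obtain ⟨θ⟩ := exists_mulEquiv_of_two_four m n _ (fun _ => rfl)
    exact (IsUnipotentCosetProdOf.antipodal hn h).congr θ
  rcases canon_eq_cases l with h1 | ⟨m, h1, rfl | rfl⟩ | ⟨m, h1, rfl⟩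
  · rwa [h1]
  · exact key 1 m (Or.inl rfl) h
  · exact key 1 m (Or.inl rfl) (IsYProdOf.unipotent h)
  · exact key 2 m (Or.inr rfl) h

end TwoValuedGroup

namespace TwoValuedGroup

variable {S : Type u} {Y : TwoValuedGroup S}

/-- A two-valued group presented as an antipodal coset group of an additive group. -/
structure Antipodal (Y : TwoValuedGroup S) {G : Type v} [AddCommGroup G] (π : G → S) : Prop where
  surj : Function.Surjective π
  zero : π 0 = Y.e
  neg : ∀ a, π (-a) = π a
  fib : ∀ {a b}, π a = π b → b = a ∨ b = -a
  mul : ∀ a b, Y.mul (π a) (π b) = {π (a + b), π (a - b)}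

theorem Realizes.antipodal {k : ℕ} {d : Fin k → ℕ} (h : Realizes Y (.princ k d)) :
    ∃ π : (∀ i, ZMod (d i)) → S, Antipodal Y π := by
  obtain ⟨π, hs, h1, hn, hf, hm, -⟩ := h
  refine ⟨fun a => π (fun i => .ofAdd (a i)), ?_, h1, fun a => hn _, fun {a b} hab => ?_,
    fun a b => ?_⟩
  · intro t
    obtain ⟨a, rfl⟩ := hs t
    exact ⟨fun i => (a i).toAdd, rfl⟩
  · rcases hf _ _ hab with h | h
    · exact Or.inl (funext fun i => congrFun h i)
    · exact Or.inr (funext fun i => congrFun h i)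
  · rw [hm, sub_eq_add_neg]
    rfl

namespace Antipodal

variable {G : Type v} [AddCommGroup G] {π : G → S} {G' : Type w} [AddCommGroup G'] {π' : G' → S}

theorem nsmul_eq (h : Antipodal Y π) (h' : Antipodal Y π') {a : G} {a' : G'} (haa : π a = π' a')
    (n : ℕ) : π (n • a) = π' (n • a') ∧ π ((n + 1) • a) = π' ((n + 1) • a') := by
  induction n with
  | zero => simp [h.zero, h'.zero, haa]
  | succ n ih =>
    refine ⟨ih.2, ?_⟩
    have h1 := h.mul ((n + 1) • a) a
    rw [ih.2, haa, h'.mul, ← succ_nsmul, ← succ_nsmul, succ_nsmul _ n, succ_nsmul _ n,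
      add_sub_cancel_right, add_sub_cancel_right, ih.1, pair_eq_pair_iff] at h1
    rcases h1 with h1 | h1
    · exact h1.1.symm
    · rw [h1.1.symm] at *
      exact h1.2.symm ▸ rfl

theorem exists_nsmul_of (h : Antipodal Y π) (h' : Antipodal Y π') {a : G} {a' : G'}
    (haa : π a = π' a') {n : ℕ} (ha : ∃ b, a = n • b) : ∃ b, a' = n • b := by
  obtain ⟨b, rfl⟩ := ha
  obtain ⟨b', hb'⟩ := h'.surj (π b)
  rw [(h.nsmul_eq h' hb'.symm n).1] at haa
  rcases h'.fib haa with rfl | rfl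
  · exact ⟨b', rfl⟩
  · exact ⟨-b', (neg_nsmul _ _).symm⟩

/-- A surjection whose kernel consists of the multiples of `n`. -/
structure Reduction (n : ℕ) {G : Type v} [AddCommGroup G] {P : Type w} [AddCommGroup P]
    (ρ : G →+ P) : Prop where
  surj : Function.Surjective ρ
  ker : ∀ g, ρ g = 0 ↔ ∃ b, g = n • b

variable {n : ℕ} {P : Type u'} [AddCommGroup P] {ρ : G →+ P} {P' : Type v'} [AddCommGroup P']
  {ρ' : G' →+ P'}

theorem reduction_zero (h : Antipodal Y π) (h' : Antipodal Y π') (r : Reduction n ρ)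
    (r' : Reduction n ρ') {a : G} {a' : G'} (haa : π a = π' a') (ha : ρ a = 0) : ρ' a' = 0 :=
  (r'.ker _).2 (h.exists_nsmul_of h' haa ((r.ker _).1 ha))

theorem image_subset (h : Antipodal Y π) (h' : Antipodal Y π') (r : Reduction n ρ)
    (r' : Reduction n ρ') {a : G} {a' : G'} (haa : π a = π' a') :
    Set.image π {x | ρ x = ρ a} ⊆ Set.image π' {x | ρ' x = ρ' a'} := by
  rintro _ ⟨b, hb, rfl⟩
  obtain ⟨b', hb'⟩ := h'.surj (π b)
  have h1 := h.mul b a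
  rw [← hb', haa, h'.mul, pair_eq_pair_iff] at h1
  have h2 : ρ (b - a) = 0 := by rw [map_sub, sub_eq_zero]; exact hb
  rcases h1 with h1 | h1
  · have h3 := h.reduction_zero h' r r' h1.2.symm h2
    rw [map_sub, sub_eq_zero] at h3
    exact ⟨b', h3, hb'⟩
  · have h3 := h.reduction_zero h' r r' h1.1.symm h2
    refine ⟨-b', ?_, by rw [h'.neg, hb']⟩
    show ρ' (-b') = _
    rw [map_neg, neg_eq_iff_add_eq_zero, ← map_add, h3]

theorem image_eq_iff (h : Antipodal Y π) (r : Reduction n ρ) {q p : P} :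
    Set.image π {x | ρ x = q} = Set.image π {x | ρ x = p} ↔ q = p ∨ q = -p := by
  constructor
  · intro h1
    obtain ⟨a, rfl⟩ := r.surj q
    have h2 : π a ∈ Set.image π {x | ρ x = p} := by rw [← h1]; exact ⟨a, rfl, rfl⟩
    obtain ⟨b, rfl, hb⟩ := h2
    rcases h.fib hb with rfl | rfl
    · exact Or.inl rfl
    · exact Or.inr (map_neg _ _)
  · have key : ∀ p, Set.image π {x | ρ x = -p} ⊆ Set.image π {x | ρ x = p} := by
      rintro p _ ⟨a, ha, rfl⟩
      exact ⟨-a, by rw [Set.mem_ofPred_eq, map_neg, ha, neg_neg], h.neg a⟩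
    rintro (rfl | rfl)
    · rfl
    · refine (key p).antisymm ?_
      have := key (-p)
      rwa [neg_neg] at this

theorem reduction_self (h : Antipodal Y π) (h' : Antipodal Y π') (r : Reduction n ρ)
    (r' : Reduction n ρ') {a : G} {a' : G'} (haa : π a = π' a') (ha : ρ a = -ρ a) :
    ρ' a' = -ρ' a' := by
  have h1 : ρ (2 • a) = 0 := by rw [two_nsmul, map_add, ← eq_neg_iff_add_eq_zero]; exact ha
  have h2 := h.reduction_zero h' r r' (h.nsmul_eq h' haa 2).1 h1
  rwa [two_nsmul, map_add, ← eq_neg_iff_add_eq_zero] at h2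

theorem card_reduction (h : Antipodal Y π) (h' : Antipodal Y π') (r : Reduction n ρ)
    (r' : Reduction n ρ') : Nat.card P = Nat.card P' := by
  classical
  let p : P → Set S := fun q => Set.image π {x | ρ x = q}
  let p' : P' → Set S := fun q => Set.image π' {x | ρ' x = q}
  have key : ∀ o, Nonempty ({q // p q = o} ≃ {q // p' q = o}) := by
    intro o
    have hoo : ∀ {a a'}, π a = π' a' → p (ρ a) = p' (ρ' a') := fun haa =>
      (h.image_subset h' r r' haa).antisymm (h'.image_subset h r' r haa.symm)
    by_cases ho : ∃ a a', π a = π' a' ∧ p (ρ a) = o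
    · obtain ⟨a, a', haa, rfl⟩ := ho
      have e1 : {q | p q = p (ρ a)} = {ρ a, -ρ a} := Set.ext fun q => h.image_eq_iff r
      have e2 : {q | p' q = p (ρ a)} = {ρ' a', -ρ' a'} := by
        rw [hoo haa]
        exact Set.ext fun q => h'.image_eq_iff r'
      have f1 : Finite {q // p q = p (ρ a)} := by
        show ({q | p q = p (ρ a)} : Set P).Finite
        rw [e1]; exact Set.toFinite _
      have f2 : Finite {q // p' q = p (ρ a)} := by
        show ({q | p' q = p (ρ a)} : Set P').Finite
        rw [e2]; exact Set.toFinite _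
      refine Finite.card_eq.1 ?_
      show Set.ncard {q | p q = p (ρ a)} = Set.ncard {q | p' q = p (ρ a)}
      rw [e1, e2]
      by_cases hs : ρ a = -ρ a
      · have hs' := h.reduction_self h' r r' haa hs
        rw [← hs, ← hs', Set.pair_eq_singleton, Set.pair_eq_singleton, Set.ncard_singleton,
          Set.ncard_singleton]
      · have hs' := fun H => hs (h'.reduction_self h r' r haa.symm H)
        rw [Set.ncard_pair hs, Set.ncard_pair hs']
    · have i1 : IsEmpty {q // p q = o} := ⟨fun ⟨q, hq⟩ => by
        obtain ⟨a, rfl⟩ := r.surj q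
        obtain ⟨a', ha'⟩ := h'.surj (π a)
        exact ho ⟨a, a', ha'.symm, hq⟩⟩
      have i2 : IsEmpty {q // p' q = o} := ⟨fun ⟨q, hq⟩ => by
        obtain ⟨a', rfl⟩ := r'.surj q
        obtain ⟨a, ha⟩ := h.surj (π' a')
        exact ho ⟨a, a', ha, (hoo ha).trans hq⟩⟩
      exact ⟨Equiv.equivOfIsEmpty _ _⟩
  exact Nat.card_congr ((Equiv.sigmaFiberEquiv p).symm.trans
    ((Equiv.sigmaCongrRight fun o => (key o).some).trans (Equiv.sigmaFiberEquiv p')))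

end Antipodal

/-- Reduction of a finite product of cyclic groups. -/
theorem exists_reduction {k : ℕ} (d : Fin k → ℕ) (n : ℕ) :
    ∃ ρ : (∀ i, ZMod (d i)) →+ ∀ i, ZMod (Nat.gcd (d i) n), Antipodal.Reduction n ρ := by
  let c : ∀ i, ZMod (d i) →+ ZMod (Nat.gcd (d i) n) := fun i =>
    (ZMod.castHom (Nat.gcd_dvd_left (d i) n) (ZMod (Nat.gcd (d i) n))).toAddMonoidHom
  have hz : ∀ i (z : ℤ), c i z = z := fun i z => 
    map_intCast (ZMod.castHom (Nat.gcd_dvd_left (d i) n) _) z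
  refine ⟨AddMonoidHom.piMap c, ?_, ?_⟩
  · intro y
    refine ⟨fun i => ((y i).cast : ℤ), funext fun i => ?_⟩
    show c i ((y i).cast : ℤ) = _
    rw [hz, ZMod.intCast_zmod_cast]
  · intro g
    constructor
    · intro hg
      have : ∀ i, ∃ b, g i = n • b := by
        intro i
        have h1 : c i (g i) = 0 := congrFun hg i
        obtain ⟨z, hz'⟩ := ZMod.intCast_surjective (g i)
        rw [← hz', hz, ZMod.intCast_zmod_eq_zero_iff_dvd] at h1
        obtain ⟨w, rfl⟩ := h1
        rw [Nat.gcd_eq_gcd_ab] at hz'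
        refine ⟨((Nat.gcdB (d i) n * w : ℤ) : ZMod (d i)), ?_⟩
        rw [← hz']
        push_cast
        rw [ZMod.natCast_self, nsmul_eq_mul]
        ring
      choose b hb using this
      exact ⟨b, funext hb⟩
    · rintro ⟨b, rfl⟩
      funext i
      show c i (n • b i) = 0
      rw [map_nsmul, nsmul_eq_mul, (ZMod.natCast_eq_zero_iff _ _).2 (Nat.gcd_dvd_right _ _),
        zero_mul]

theorem Realizes.prod_gcd {k k' : ℕ} {d : Fin k → ℕ} {d' : Fin k' → ℕ}
    (h : Realizes Y (.princ k d)) (h' : Realizes Y (.princ k' d')) (n : ℕ) :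
    ∏ i, Nat.gcd (d i) n = ∏ i, Nat.gcd (d' i) n := by
  obtain ⟨π, h⟩ := h.antipodal
  obtain ⟨π', h'⟩ := h'.antipodal
  obtain ⟨ρ, r⟩ := exists_reduction d n
  obtain ⟨ρ', r'⟩ := exists_reduction d' n
  simpa [Nat.card_pi] using h.card_reduction h' r r'

end TwoValuedGroup

namespace TwoValuedGroup

open Finset in
theorem prod_gcd_prime_pow_succ {k : ℕ} (d : Fin k → ℕ) {p : ℕ} (hp : p.Prime) (e : ℕ) :
    ∏ i, Nat.gcd (d i) (p ^ (e + 1)) =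
      (∏ i, Nat.gcd (d i) (p ^ e)) * p ^ #{i | p ^ (e + 1) ∣ d i} := by
  have key : ∀ a, Nat.gcd a (p ^ (e + 1)) =
      Nat.gcd a (p ^ e) * (if p ^ (e + 1) ∣ a then p else 1) := by
    intro a
    split_ifs with h
    · rw [Nat.gcd_eq_right h, Nat.gcd_eq_right ((pow_dvd_pow p e.le_succ).trans h), pow_succ]
    · rw [mul_one]
      refine Nat.dvd_antisymm (Nat.dvd_gcd (Nat.gcd_dvd_left _ _) ?_)
        (Nat.gcd_dvd_gcd_of_dvd_right _ (pow_dvd_pow p e.le_succ))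
      obtain ⟨j, hj, hj'⟩ := (Nat.dvd_prime_pow hp).1 (Nat.gcd_dvd_right a (p ^ (e + 1)))
      have : j ≠ e + 1 := fun hje => h (by rw [← hje, ← hj']; exact Nat.gcd_dvd_left _ _)
      rw [hj']
      exact pow_dvd_pow p (by omega)
  simp_rw [key, Finset.prod_mul_distrib, Finset.prod_ite, Finset.prod_const, one_pow, mul_one]

open Finset in
theorem card_prime_pow_dvd_eq {k k' : ℕ} {d : Fin k → ℕ} {d' : Fin k' → ℕ}
    (h : ∀ n, ∏ i, Nat.gcd (d i) n = ∏ i, Nat.gcd (d' i) n) {p : ℕ} (hp : p.Prime) (e : ℕ) :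
    #{i | p ^ (e + 1) ∣ d i} = #{i | p ^ (e + 1) ∣ d' i} := by
  have h1 := h (p ^ (e + 1))
  rw [prod_gcd_prime_pow_succ d hp, prod_gcd_prime_pow_succ d' hp, h (p ^ e)] at h1
  have h0 : 0 < ∏ i, Nat.gcd (d' i) (p ^ e) :=
    Finset.prod_pos fun i _ => Nat.gcd_pos_of_pos_right _ (pow_pos hp.pos _)
  exact Nat.pow_right_injective hp.two_le (Nat.eq_of_mul_eq_mul_left h0 h1)

theorem length_le_of_prod_gcd_eq {k k' : ℕ} {d : Fin k → ℕ} {d' : Fin k' → ℕ}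
    (hd : ValidLabel (.princ k d))
    (h : ∀ n, ∏ i, Nat.gcd (d i) n = ∏ i, Nat.gcd (d' i) n) : k ≤ k' := by
  rcases k with _ | k
  · exact Nat.zero_le _
  obtain ⟨p, hp, hpd⟩ := Nat.exists_prime_and_dvd (hd.1 0)
  have h1 := card_prime_pow_dvd_eq h hp 0
  have h2 : ∀ i, p ∣ d i := fun i => hpd.trans (hd.2 0 i (Fin.zero_le i))
  simp only [zero_add, pow_one, h2, Finset.filter_true, Finset.card_univ, Fintype.card_fin] at h1
  rw [h1]
  exact (Finset.card_le_univ _).trans_eq (Fintype.card_fin k')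

theorem dvd_of_prod_gcd_eq {k : ℕ} {d d' : Fin k → ℕ}
    (hd : ∀ i j : Fin k, i ≤ j → d i ∣ d j) (hd' : ∀ i j : Fin k, i ≤ j → d' i ∣ d' j)
    (h : ∀ n, ∏ i, Nat.gcd (d i) n = ∏ i, Nat.gcd (d' i) n) (i : Fin k) : d i ∣ d' i := by
  rw [Nat.dvd_iff_prime_pow_dvd_dvd]
  intro p e hp hpe
  rcases e with _ | e
  · simp
  by_contra hn
  have h1 := card_prime_pow_dvd_eq h hp e
  refine h1.not_gt (Finset.card_lt_card ⟨fun j hj => ?_, fun hs => hn ?_⟩)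
  · rw [Finset.mem_filter_univ] at hj ⊢
    rcases le_total i j with hij | hij
    · exact hpe.trans (hd _ _ hij)
    · exact absurd (hj.trans (hd' _ _ hij)) hn
  · simpa using hs ((Finset.mem_filter_univ i).2 hpe)

variable {S : Type u} {Y : TwoValuedGroup S}

theorem Realizes.princ_unique {k k' : ℕ} {d : Fin k → ℕ} {d' : Fin k' → ℕ}
    (h : Realizes Y (.princ k d)) (h' : Realizes Y (.princ k' d'))
    (hd : ValidLabel (.princ k d)) (hd' : ValidLabel (.princ k' d')) :
    ListedLabel.princ k d = .princ k' d' := by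
  have hg := h.prod_gcd h'
  obtain rfl := (length_le_of_prod_gcd_eq hd hg).antisymm
    (length_le_of_prod_gcd_eq hd' fun n => (hg n).symm)
  congr 1
  exact funext fun i => Nat.dvd_antisymm (dvd_of_prod_gcd_eq hd.2 hd'.2 hg i)
    (dvd_of_prod_gcd_eq hd'.2 hd.2 (fun n => (hg n).symm) i)

end TwoValuedGroup

namespace TwoValuedGroup

variable {S : Type u} {Y : TwoValuedGroup S}

/-- There are two elements that are not of order two and whose product is a double point. -/
def HasSpecialPair (Y : TwoValuedGroup S) : Prop :=
  ∃ x y z, Y.mul x x ≠ {Y.e, Y.e} ∧ Y.mul y y ≠ {Y.e, Y.e} ∧ Y.mul x y = {z, z}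

theorem pair_eq_diag_iff {T : Type u} {a b c : T} :
    ({a, b} : Multiset T) = {c, c} ↔ a = c ∧ b = c := by
  rw [pair_eq_pair_iff, or_self]

theorem card_c2vec (n : ℕ) : Nat.card (C2vec n) = 2 ^ n := by
  rw [Nat.card_pi]
  simp

theorem exists_c2vec_pair {n : ℕ} (hn : 2 ≤ n) : ∃ a b : C2vec n, a ≠ 1 ∧ b ≠ 1 ∧ a ≠ b := by
  let g : Fin n → C2vec n := fun i => Pi.mulSingle i (.ofAdd 1)
  refine ⟨g ⟨0, by omega⟩, g ⟨1, by omega⟩, by simp [g], by simp [g], ?_⟩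
  intro h
  have := congrFun h ⟨0, by omega⟩
  simp [g] at this

theorem Antipodal.not_hasSpecialPair {G : Type v} [AddCommGroup G] {π : G → S}
    (h : Antipodal Y π) : ¬ HasSpecialPair Y := by
  have key : ∀ {a}, a + a = 0 → Y.mul (π a) (π a) = {Y.e, Y.e} := fun {a} ha => by
    rw [h.mul, ha, sub_self, h.zero]
  rintro ⟨x, y, z, hx, hy, hz⟩
  obtain ⟨a, rfl⟩ := h.surj x
  obtain ⟨b, rfl⟩ := h.surj y
  rw [h.mul, pair_eq_diag_iff] at hz
  rcases h.fib (hz.1.trans hz.2.symm) with h1 | h1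
  · exact hy (key (by grind))
  · exact hx (key (by grind))

theorem IsUnipotentCosetProdOf.not_hasSpecialPair {n m : ℕ}
    (h : IsUnipotentCosetProdOf Y (C2vec n) (C2vec m)) : ¬ HasSpecialPair Y := by
  obtain ⟨f, hs, h1, hn, hf, hm, -⟩ := h
  have key : ∀ b w, Y.mul (f ((1, b), w)) (f ((1, b), w)) = {Y.e, Y.e} := fun b w => by
    rw [hm, mul_one, one_mul, c2vec_mul_self, c2vec_mul_self, h1]
  rintro ⟨x, y, z, hx, hy, hz⟩
  obtain ⟨⟨⟨a, b⟩, w⟩, rfl⟩ := hs x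
  obtain ⟨⟨⟨c, d⟩, w'⟩, rfl⟩ := hs y
  rw [hm, pair_eq_diag_iff] at hz
  rcases (hf _ _ (hz.1.trans hz.2.symm)).2 with h2 | h2
  · have h3 := congrArg Prod.snd h2
    simp only [mul_assoc, mul_eq_right] at h3
    subst h3
    exact hy (key _ _)
  · have h3 := congrArg Prod.snd h2
    simp only [mul_comm a c, mul_assoc, mul_right_inj] at h3
    rw [right_eq_mul] at h3
    subst h3
    exact hx (key _ _)

theorem IsYProdOf.hasSpecialPair {n m : ℕ} (hn : 2 ≤ n)
    (h : IsYProdOf Y (C2vec n) (C2vec m)) : HasSpecialPair Y := by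
  obtain ⟨f, hb, h1, hm, -⟩ := h
  obtain ⟨a, b, ha, hb', hab⟩ := exists_c2vec_pair hn
  have key : ∀ a : C2vec n, a ≠ 1 → Y.mul (f (some a, 1)) (f (some a, 1)) ≠ {Y.e, Y.e} := by
    intro a ha h2
    rw [hm, mulY, if_pos rfl, if_neg ha, map_pair, pair_eq_diag_iff, ← h1] at h2
    simpa using hb.1 h2.2
  refine ⟨_, _, f (some (a * b), 1 * 1), key a ha, key b hb', ?_⟩
  rw [hm, mulY, if_neg hab, map_pair]

theorem IsUnipotentCosetProdOf.card_squares {n m : ℕ}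
    (h : IsUnipotentCosetProdOf Y (C2vec n) (C2vec m)) :
    Nat.card {y // ∃ x, Y.mul x x = {Y.e, y}} = 2 ^ n := by
  obtain ⟨f, hs, h1, hn, hf, hm, -⟩ := h
  have key : ∀ a b w, Y.mul (f ((a, b), w)) (f ((a, b), w)) = {Y.e, f ((1, a), 1)} := by
    intro a b w
    rw [hm, mul_assoc a b b, c2vec_mul_self, c2vec_mul_self, c2vec_mul_self, mul_one, h1]
  rw [← card_c2vec n]
  symm
  refine Nat.card_eq_of_bijective (fun a => ⟨f ((1, a), 1), f ((a, 1), 1), key a 1 1⟩) ⟨?_, ?_⟩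
  · intro a b hab
    have := (hf _ _ (congrArg Subtype.val hab)).2
    simp only [Prod.mk.injEq, true_and, one_mul, or_self] at this
    exact this.symm
  · rintro ⟨y, x, hx⟩
    obtain ⟨⟨⟨a, b⟩, w⟩, rfl⟩ := hs x
    rw [key, pair_eq_pair_iff] at hx
    refine ⟨a, Subtype.ext ?_⟩
    rcases hx with hx | hx
    · exact hx.2
    · exact hx.2.trans hx.1

theorem IsUnipotentCosetProdOf.card_bool {n m : ℕ}
    (h : IsUnipotentCosetProdOf Y (C2vec n) (C2vec m)) :
    Nat.card {x // Y.mul x x = {Y.e, Y.e}} = 2 ^ n * 2 ^ m := by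
  obtain ⟨f, hs, h1, hn, hf, hm, -⟩ := h
  have key : ∀ a b w, Y.mul (f ((a, b), w)) (f ((a, b), w)) = {Y.e, f ((1, a), 1)} := by
    intro a b w
    rw [hm, mul_assoc a b b, c2vec_mul_self, c2vec_mul_self, c2vec_mul_self, mul_one, h1]
  rw [← card_c2vec n, ← card_c2vec m, ← Nat.card_prod]
  symm
  refine Nat.card_eq_of_bijective (fun p => ⟨f ((1, p.1), p.2), by rw [key, h1]⟩) ⟨?_, ?_⟩
  · rintro ⟨a, w⟩ ⟨b, w'⟩ hab
    have := hf _ _ (congrArg Subtype.val hab)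
    simp only [Prod.mk.injEq, true_and, one_mul, or_self] at this
    rw [this.1, this.2]
  · rintro ⟨x, hx⟩
    obtain ⟨⟨⟨a, b⟩, w⟩, rfl⟩ := hs x
    rw [key, pair_eq_diag_iff, ← h1] at hx
    have := (hf _ _ hx.2).2
    simp only [Prod.mk.injEq, true_and, one_mul, or_self] at this
    subst this
    exact ⟨(b, w), rfl⟩

theorem IsYProdOf.card_eq {n m : ℕ} (h : IsYProdOf Y (C2vec n) (C2vec m)) :
    Nat.card S = (2 ^ n + 1) * 2 ^ m := by
  obtain ⟨f, hb, -⟩ := h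
  rw [← Nat.card_eq_of_bijective f hb, Nat.card_prod, Finite.card_option, card_c2vec, card_c2vec]

theorem IsYProdOf.card_bool {n m : ℕ} (h : IsYProdOf Y (C2vec n) (C2vec m)) :
    Nat.card {x // Y.mul x x = {Y.e, Y.e}} = 2 * 2 ^ m := by
  obtain ⟨f, hb, h1, hm, -⟩ := h
  have key : ∀ u w, Y.mul (f (u, w)) (f (u, w)) = {Y.e, Y.e} ↔ u = none ∨ u = some 1 := by
    intro u w
    rw [hm, c2vec_mul_self]
    rcases u with _ | a
    · rw [mulY, map_pair, h1]; simp
    · rw [mulY, if_pos rfl]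
      split_ifs with ha
      · rw [map_pair, h1, ha]; simp
      · rw [map_pair, h1, pair_eq_diag_iff, ← h1, hb.1.eq_iff, hb.1.eq_iff]; simp [ha]
  have h2 : Nat.card Bool = 2 := by simp
  rw [← card_c2vec m, ← h2, ← Nat.card_prod]
  symm
  refine Nat.card_eq_of_bijective (fun p : Bool × C2vec m =>
    ⟨f (if p.1 then some 1 else none, p.2), by rw [key]; cases p.1 <;> simp⟩) ⟨?_, ?_⟩
  · rintro ⟨a, w⟩ ⟨b, w'⟩ hab
    have := hb.1 (congrArg Subtype.val hab)
    cases a <;> cases b <;> simp_all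
  · rintro ⟨x, hx⟩
    obtain ⟨⟨u, w⟩, rfl⟩ := hb.2 x
    rcases (key u w).1 hx with rfl | rfl
    · exact ⟨(false, w), rfl⟩
    · exact ⟨(true, w), rfl⟩

theorem Realizes.unip_unique {n m n' m' : ℕ} (h : Realizes Y (.unip n m))
    (h' : Realizes Y (.unip n' m')) : ListedLabel.unip n m = .unip n' m' := by
  have h1 := (IsUnipotentCosetProdOf.card_squares h).symm.trans
    (IsUnipotentCosetProdOf.card_squares h')
  obtain rfl := Nat.pow_right_injective le_rfl h1
  have h2 := (IsUnipotentCosetProdOf.card_bool h).symm.trans (IsUnipotentCosetProdOf.card_bool h')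
  obtain rfl := Nat.pow_right_injective le_rfl (Nat.eq_of_mul_eq_mul_left (by positivity) h2)
  rfl

theorem Realizes.spec_unique {n m n' m' : ℕ} (h : Realizes Y (.spec n m))
    (h' : Realizes Y (.spec n' m')) : ListedLabel.spec n m = .spec n' m' := by
  have h2 := (IsYProdOf.card_bool h).symm.trans (IsYProdOf.card_bool h')
  obtain rfl := Nat.pow_right_injective le_rfl (Nat.eq_of_mul_eq_mul_left (by positivity) h2)
  have h1 := (IsYProdOf.card_eq h).symm.trans (IsYProdOf.card_eq h')
  obtain rfl := Nat.pow_right_injective le_rfl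
    (Nat.add_right_cancel (Nat.eq_of_mul_eq_mul_right (by positivity) h1))
  rfl

end TwoValuedGroup

namespace TwoValuedGroup

variable {S : Type u} {Y : TwoValuedGroup S}

theorem Antipodal.eq_or_eq_of_mem {G : Type v} [AddCommGroup G] {π : G → S} (h : Antipodal Y π)
    {x y z : S} {α β : G} (hα : π α = x) (hβ : π β = y) (hz : z ∈ Y.mul x y) :
    π (α + β) = z ∨ π (α - β) = z := by
  rw [← hα, ← hβ, h.mul] at hz
  simpa [eq_comm] using hz

/-- An antipodal coset group admits no multiplicative section of squares over three independent
elements of a Boolean group. -/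
theorem Antipodal.false_of_independent {G : Type v} [AddCommGroup G] {π : G → S}
    (h : Antipodal Y π) {V : Type w} [CommGroup V] (x s : V → S)
    (hx : ∀ u v, x (u * v) ∈ Y.mul (x u) (x v)) (hx2 : ∀ u, Y.mul (x u) (x u) = {Y.e, s u})
    (hs : ∀ u v, Y.mul (s u) (s v) = {s (u * v), s (u * v)}) (hs1 : ∀ v, s v = Y.e → v = 1)
    (hV : ∀ v : V, v * v = 1) {a b c : V} (ha : a ≠ 1) (hb : b ≠ 1) (hc : c ≠ 1)
    (hab : a * b ≠ 1) (hac : a * c ≠ 1) (hbc : b * c ≠ 1) (habc : a * b * c ≠ 1) : False := by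
  obtain ⟨α, hα⟩ := h.surj (x a)
  obtain ⟨β, hβ, hαβ⟩ : ∃ β, π β = x b ∧ π (α + β) = x (a * b) := by
    obtain ⟨β, hβ⟩ := h.surj (x b)
    rcases h.eq_or_eq_of_mem hα hβ (hx a b) with h1 | h1
    · exact ⟨β, hβ, h1⟩
    · exact ⟨-β, by rw [h.neg, hβ], by rwa [← sub_eq_add_neg]⟩
  obtain ⟨γ, hγ, hαγ⟩ : ∃ γ, π γ = x c ∧ π (α + γ) = x (a * c) := by
    obtain ⟨γ, hγ⟩ := h.surj (x c)
    rcases h.eq_or_eq_of_mem hα hγ (hx a c) with h1 | h1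
    · exact ⟨γ, hγ, h1⟩
    · exact ⟨-γ, by rw [h.neg, hγ], by rwa [← sub_eq_add_neg]⟩
  have double : ∀ {u δ}, π δ = x u → π (δ + δ) = s u := by
    intro u δ hδ
    have h1 := hx2 u
    rw [← hδ, h.mul, sub_self, h.zero, pair_eq_pair_iff] at h1
    rcases h1 with h1 | h1
    · exact h1.1.trans h1.2
    · exact h1.1
  have add : ∀ {u v δ ε}, π δ = s u → π ε = s v → π (δ + ε) = s (u * v) := by
    intro u v δ ε hδ hε
    have h1 := hs u v
    rw [← hδ, ← hε, h.mul, pair_eq_diag_iff] at h1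
    exact h1.1
  have ne : ∀ {u δ}, π δ = s u → u ≠ 1 → δ ≠ 0 := by
    rintro u δ hδ hu rfl
    exact hu (hs1 u (by rw [← hδ, h.zero]))
  have n1 := ne (double hα) ha
  have n2 := ne (double hβ) hb
  have n3 := ne (double hγ) hc
  have n4 := ne (add (double hα) (double hβ)) hab
  have n5 := ne (add (double hα) (double hγ)) hac
  have n6 := ne (add (double hβ) (double hγ)) hbc
  have n7 := ne (add (add (double hα) (double hβ)) (double hγ)) habc
  have n8 : β + β - (γ + γ) ≠ 0 := by
    have h1 := hs b c
    rw [← double hβ, ← double hγ, h.mul, pair_eq_diag_iff] at h1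
    exact ne h1.2 hbc
  clear double add ne
  have e1 : a * b * (b * c) = a * c := by rw [mul_assoc, ← mul_assoc b, hV, one_mul]
  have e2 : a * c * b = a * b * c := mul_right_comm a c b
  have e3 : a * (b * c) = a * b * c := (mul_assoc a b c).symm
  have h1 := hx (a * b) (b * c)
  have h2 := hx (a * c) b
  have h3 := hx a (b * c)
  rw [e1] at h1
  rw [e2] at h2
  rw [e3] at h3
  rcases h.eq_or_eq_of_mem hβ hγ (hx b c) with hβγ | hβγ
  · rcases h.eq_or_eq_of_mem hαβ hβγ h1 with h4 | h4 <;>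
      rcases h.fib (h4.trans hαγ.symm) with h5 | h5 <;> grind
  · rcases h.eq_or_eq_of_mem hαβ hγ (hx (a * b) c) with h4 | h4
    · rcases h.eq_or_eq_of_mem hα hβγ h3 with h6 | h6 <;>
        rcases h.fib (h4.trans h6.symm) with h5 | h5 <;> grind
    · rcases h.eq_or_eq_of_mem hαγ hβ h2 with h6 | h6 <;>
        rcases h.fib (h4.trans h6.symm) with h5 | h5 <;> grind

theorem IsUnipotentCosetProdOf.not_antipodal {n m : ℕ} (hn : 3 ≤ n)
    (h : IsUnipotentCosetProdOf Y (C2vec n) (C2vec m)) {G : Type v} [AddCommGroup G] {π : G → S}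
    (hπ : Antipodal Y π) : False := by
  obtain ⟨f, -, h1, -, hf, hm, -⟩ := h
  let g : Fin n → C2vec n := fun i => Pi.mulSingle i (.ofAdd 1)
  have hg : ∀ v : C2vec n, (∃ i, v i ≠ 1) → v ≠ 1 := by
    rintro _ ⟨i, hi⟩ rfl
    exact hi rfl
  refine hπ.false_of_independent (V := C2vec n) (fun u => f ((u, 1), 1)) (fun v => f ((1, v), 1))
    (fun u v => ?_) (fun u => ?_) (fun u v => ?_) (fun v hv => ?_) c2vec_mul_self
    (a := g ⟨0, by omega⟩) (b := g ⟨1, by omega⟩) (c := g ⟨2, by omega⟩)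
    (hg _ ⟨⟨0, by omega⟩, ?_⟩) (hg _ ⟨⟨1, by omega⟩, ?_⟩) (hg _ ⟨⟨2, by omega⟩, ?_⟩)
    (hg _ ⟨⟨0, by omega⟩, ?_⟩) (hg _ ⟨⟨0, by omega⟩, ?_⟩) (hg _ ⟨⟨1, by omega⟩, ?_⟩)
    (hg _ ⟨⟨0, by omega⟩, ?_⟩)
  · rw [hm]
    simp
  · rw [hm, c2vec_mul_self, c2vec_mul_self, mul_one, mul_one, mul_one, h1]
  · rw [hm]
    simp
  · rw [← h1] at hv
    have := (hf _ _ hv).2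
    simp only [Prod.mk.injEq, true_and, one_mul, or_self] at this
    exact this.symm
  all_goals simp [g]

/-- Distinct canonical labels name non-isomorphic two-valued groups. -/
theorem canonical_label_unique {l₁ l₂ : ListedLabel} (v₁ : ValidLabel l₁) (v₂ : ValidLabel l₂)
    (c₁ : canon l₁ = l₁) (c₂ : canon l₂ = l₂) (h₁ : Realizes Y l₁) (h₂ : Realizes Y l₂) :
    l₁ = l₂ := by
  have unip_ge : ∀ {n m}, ValidLabel (.unip n m) → canon (.unip n m) = .unip n m → 3 ≤ n := by
    intro n m hv hc
    rcases n with _ | _ | _ | n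
    · exact absurd hv (by simp [ValidLabel])
    · simp [canon] at hc
    · simp [canon] at hc
    · omega
  have spec_ge : ∀ {n m}, ValidLabel (.spec n m) → canon (.spec n m) = .spec n m → 2 ≤ n := by
    intro n m hv hc
    rcases n with _ | _ | n
    · exact absurd hv (by simp [ValidLabel])
    · simp [canon] at hc
    · omega
  have princ_unip : ∀ {k d n m}, Realizes Y (.princ k d) → Realizes Y (.unip n m) →
      3 ≤ n → False := fun hp hu hn => by
    obtain ⟨π, hπ⟩ := hp.antipodal
    exact IsUnipotentCosetProdOf.not_antipodal hn hu hπ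
  have princ_spec : ∀ {k d n m}, Realizes Y (.princ k d) → Realizes Y (.spec n m) →
      2 ≤ n → False := fun hp hs hn => by
    obtain ⟨π, hπ⟩ := hp.antipodal
    exact hπ.not_hasSpecialPair (IsYProdOf.hasSpecialPair hn hs)
  have unip_spec : ∀ {n m n' m'}, Realizes Y (.unip n m) → Realizes Y (.spec n' m') →
      2 ≤ n' → False := fun hu hs hn =>
    IsUnipotentCosetProdOf.not_hasSpecialPair hu (IsYProdOf.hasSpecialPair hn hs)
  match l₁, l₂ with
  | .princ _ _, .princ _ _ => exact h₁.princ_unique h₂ v₁ v₂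
  | .unip _ _, .unip _ _ => exact h₁.unip_unique h₂
  | .spec _ _, .spec _ _ => exact h₁.spec_unique h₂
  | .princ _ _, .unip _ _ => exact (princ_unip h₁ h₂ (unip_ge v₂ c₂)).elim
  | .unip _ _, .princ _ _ => exact (princ_unip h₂ h₁ (unip_ge v₁ c₁)).elim
  | .princ _ _, .spec _ _ => exact (princ_spec h₁ h₂ (spec_ge v₂ c₂)).elim
  | .spec _ _, .princ _ _ => exact (princ_spec h₂ h₁ (spec_ge v₁ c₁)).elim
  | .unip _ _, .spec _ _ => exact (unip_spec h₁ h₂ (spec_ge v₂ c₂)).elim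
  | .spec _ _, .unip _ _ => exact (unip_spec h₂ h₁ (spec_ge v₁ c₁)).elim

theorem canon_canon (l : ListedLabel) : canon (canon l) = canon l := by
  rcases canon_eq_cases l with h | ⟨m, h, -⟩ | ⟨m, h, -⟩
  · rw [h, h]
  · rw [h]; rfl
  · rw [h]; rfl

theorem isomorphic_iff_sameClass {S₁ : Type v} {S₂ : Type w} {Y₁ : TwoValuedGroup S₁}
    {Y₂ : TwoValuedGroup S₂} {l₁ l₂ : ListedLabel} (v₁ : ValidLabel l₁) (v₂ : ValidLabel l₂)
    (h₁ : Realizes Y₁ l₁) (h₂ : Realizes Y₂ l₂) : Isomorphic Y₁ Y₂ ↔ SameClass l₁ l₂ := by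
  rw [sameClass_iff_canon]
  constructor
  · intro h
    exact canonical_label_unique (validLabel_canon v₁) (validLabel_canon v₂) (canon_canon l₁)
      (canon_canon l₂) (h.realizes h₁).canon h₂.canon
  · intro h
    have h₁' := h₁.canon
    rw [h] at h₁'
    exact isomorphic_of_realizes h₁' h₂.canon

end TwoValuedGroup

namespace TwoValuedGroup

/-- **Theorem 1.1 (theorem_main_fg).** Every finitely generated involutive commutative
two-valued group is isomorphic to one of: `X^a_{C_{d₁} × ⋯ × C_{d_k}}` with
`2 ≤ dᵢ ≤ ∞`, `d₁ ∣ ⋯ ∣ d_k`; `X^u_n × C₂^m` with `n ≥ 1`; or `Y_n × C₂^m` with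
`n ≥ 1`. Moreover two listed two-valued groups are isomorphic exactly when their labels
coincide or form one of the exceptional coincidences
`X^a_{m×2,4} ≅ X^u_1 × C₂^m ≅ Y_1 × C₂^m` and `X^a_{m×2,4,4} ≅ X^u_2 × C₂^m`. -/
theorem classification_fg {T : Type u} (X : TwoValuedGroup T)
    (hc : X.Commutative) (hinv : X.Involutive) (hfg : X.FinitelyGenerated) :
    (∃ lab : ListedLabel, ValidLabel lab ∧ Realizes X lab) ∧
    (∀ lab₁ lab₂ : ListedLabel, ValidLabel lab₁ → ValidLabel lab₂ →
      ∀ (S₁ : Type v) (S₂ : Type w) (Y₁ : TwoValuedGroup S₁) (Y₂ : TwoValuedGroup S₂),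
        Realizes Y₁ lab₁ → Realizes Y₂ lab₂ →
        (Isomorphic Y₁ Y₂ ↔ SameClass lab₁ lab₂)) := by
  exact ⟨exists_label X hc hinv hfg, fun _ _ v₁ v₂ _ _ _ _ h₁ h₂ =>
    isomorphic_iff_sameClass v₁ v₂ h₁ h₂⟩

end TwoValuedGroup
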